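/- arXiv:2102.08568 — 2 statements merged into one kernel-verified Lean document; each statement's English description precedes it below -/
import Mathlib

section
/- For all real x, y ≥ 1, the sum M(x, y) = ∑_{n ≤ x, p_min(n) > y} μ(n) satisfies M(x, y) ≪ x · exp(−c√(log x) + y) for some absolute constant c > 0, uniformly in x and y, where p_min(1) = ∞ by convention (so n = 1 is included). -/
open scoped Classical
open Finset Filter

/-- Borel–Carathéodory for a nonvanishing function, in logarithmic form. -/
lemma bc_log {h : ℂ → ℂ} {R M : ℝ} (hR : 0 < R) (hM : 0 < M)
    (hd : DifferentiableOn ℂ h (Metric.ball 0 R)) (hne : ∀ z ∈ Metric.ball (0:ℂ) R, h z ≠ 0)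
    (hb : ∀ z ∈ Metric.ball (0:ℂ) R, ‖h z‖ ≤ Real.exp M * ‖h 0‖) :
    ∃ φ : ℂ → ℂ, DifferentiableOn ℂ φ (Metric.ball 0 R) ∧ φ 0 = 0 ∧
      (∀ z ∈ Metric.ball (0:ℂ) R, h z = h 0 * Complex.exp (φ z)) ∧
      (∀ z ∈ Metric.ball (0:ℂ) R, ‖φ z‖ ≤ 2 * M * ‖z‖ / (R - ‖z‖)) := by
  have h0 : (0:ℂ) ∈ Metric.ball (0:ℂ) R := Metric.mem_ball_self hR
  have hopen : IsOpen (Metric.ball (0:ℂ) R) := Metric.isOpen_ball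
  have hdd : DifferentiableOn ℂ (fun z => deriv h z / h z) (Metric.ball 0 R) :=
    (hd.deriv hopen).div hd hne
  obtain ⟨φ₀, hφ₀⟩ := hdd.isExactOn_ball
  let φ : ℂ → ℂ := fun z => φ₀ z - φ₀ 0
  have hφd : ∀ z ∈ Metric.ball (0:ℂ) R, HasDerivAt φ (deriv h z / h z) z :=
    fun z hz => (hφ₀ z hz).sub_const _
  have hφdiff : DifferentiableOn ℂ φ (Metric.ball 0 R) :=
    fun z hz => (hφd z hz).differentiableAt.differentiableWithinAt
  have hφ0 : φ 0 = 0 := sub_self _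
  have key : ∀ z ∈ Metric.ball (0:ℂ) R, h z = h 0 * Complex.exp (φ z) := by
    intro z hz
    have hc : ∀ w ∈ Metric.ball (0:ℂ) R,
        HasDerivAt (fun w => h w * Complex.exp (-φ w)) 0 w := by
      intro w hw
      have h1 := (hd.differentiableAt (hopen.mem_nhds hw)).hasDerivAt
      have h2 := (hφd w hw).neg.cexp
      have h3 := h1.mul h2
      refine h3.congr_deriv ?_
      have := hne w hw
      simp only [Pi.neg_apply]
      field_simp
      ring
    have heq := (convex_ball (0:ℂ) R).is_const_of_fderivWithin_eq_zero (𝕜 := ℂ)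
      (f := fun w => h w * Complex.exp (-φ w))
      (fun w hw => (hc w hw).differentiableAt.differentiableWithinAt)
      (fun w hw => by
        rw [fderivWithin_of_isOpen hopen hw]
        ext
        simp [(hc w hw).deriv])
      hz h0
    simp only [hφ0, neg_zero, Complex.exp_zero, mul_one] at heq
    rw [← heq, mul_assoc, ← Complex.exp_add]
    simp
  refine ⟨φ, hφdiff, hφ0, key, ?_⟩
  intro z hz
  refine Complex.borelCaratheodory_zero hM hφdiff ?_ hR hz hφ0
  intro w hw
  have h1 := hb w hw
  rw [key w hw, norm_mul, Complex.norm_exp] at h1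
  have h2 : 0 < ‖h 0‖ := norm_pos_iff.mpr (hne 0 h0)
  have h3 : Real.exp (φ w).re ≤ Real.exp M := by
    by_contra hcon
    push Not at hcon
    nlinarith
  exact Real.exp_le_exp.mp h3

lemma logderiv_nonvanish {h : ℂ → ℂ} {R M : ℝ} (hR : 0 < R) (hM : 0 < M)
    (hd : Differentiable ℂ h) (hne : ∀ z ∈ Metric.ball (0:ℂ) R, h z ≠ 0)
    (hb : ∀ z ∈ Metric.ball (0:ℂ) R, ‖h z‖ ≤ Real.exp M * ‖h 0‖) :
    ‖deriv h 0 / h 0‖ ≤ 4 * M / R := by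
  obtain ⟨φ, hφd, hφ0, hφ, hφb⟩ := bc_log hR hM hd.differentiableOn hne hb
  have h0 : (0:ℂ) ∈ Metric.ball (0:ℂ) R := Metric.mem_ball_self hR
  have hopen : IsOpen (Metric.ball (0:ℂ) R) := Metric.isOpen_ball
  have e1 : deriv h 0 = h 0 * deriv φ 0 := by
    have : h =ᶠ[nhds 0] fun z => h 0 * Complex.exp (φ z) := by
      filter_upwards [hopen.mem_nhds h0] with z hz using hφ z hz
    rw [this.deriv_eq]
    have h1 := (hφd.differentiableAt (hopen.mem_nhds h0)).hasDerivAt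
    have h2 := (h1.cexp.const_mul (h 0)).deriv
    rw [h2, hφ0]; simp
  rw [e1, mul_div_cancel_left₀ _ (hne 0 h0)]
  have hsub : Metric.closedBall (0:ℂ) (R/2) ⊆ Metric.ball 0 R :=
    Metric.closedBall_subset_ball (by linarith)
  have := Complex.norm_deriv_le_of_forall_mem_sphere_norm_le (c := (0:ℂ)) (R := R/2) (C := 2*M)
    (f := φ) (by positivity)
    ⟨hφd.mono (Metric.ball_subset_ball (by linarith)), by
      rw [closure_ball _ (by positivity)]; exact hφd.continuousOn.mono hsub⟩
    (by
      intro z hz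
      have hz' : ‖z‖ = R/2 := by simpa using hz
      have := hφb z (hsub (Metric.sphere_subset_closedBall hz))
      rw [hz'] at this
      refine this.trans (le_of_eq ?_)
      field_simp
      ring)
  refine this.trans (le_of_eq ?_)
  field_simp
  ring

/-- One Blaschke step: remove a zero `ρ`. -/
lemma blaschke_step {h : ℂ → ℂ} {R : ℝ} (hR : 0 < R) (hd : Differentiable ℂ h) (h0 : h 0 ≠ 0)
    {ρ : ℂ} (hρ : ‖ρ‖ < R) (hz : h ρ = 0) :
    ∃ k : ℂ → ℂ, Differentiable ℂ k ∧ (∀ z, ‖z‖ = 2 * R → ‖k z‖ = ‖h z‖) ∧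
      2 * ‖h 0‖ ≤ ‖k 0‖ ∧ (∀ z, ‖z‖ < R → k z = 0 → h z = 0) ∧
      (deriv h 0 / h 0).re = (deriv k 0 / k 0).re
        + (-ρ.re) * (1 / ‖ρ‖ ^ 2 - 1 / (2 * R) ^ 2) := by
  have hρ0 : ρ ≠ 0 := by rintro rfl; exact h0 hz
  have hρn : 0 < ‖ρ‖ := norm_pos_iff.mpr hρ0
  set g : ℂ → ℂ := dslope h ρ with hg
  have hgd : Differentiable ℂ g := by
    rw [← differentiableOn_univ]
    exact (Complex.differentiableOn_dslope Filter.univ_mem).mpr hd.differentiableOn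
  have hgh : ∀ z, h z = (z - ρ) * g z := by
    intro z
    have := sub_smul_dslope h ρ z
    rw [hz, sub_zero, smul_eq_mul] at this
    exact this.symm
  have hRc : (R:ℂ) ≠ 0 := by exact_mod_cast hR.ne'
  set b : ℂ → ℂ := fun z => ((2 * R : ℝ) - (starRingEnd ℂ ρ) * z / (2 * R : ℝ)) with hb
  have hbd : Differentiable ℂ b := by rw [hb]; fun_prop
  have hb' : deriv b 0 = - (starRingEnd ℂ ρ) / (2 * R : ℝ) := by
    have : HasDerivAt b (- ((starRingEnd ℂ ρ) * 1 / (2 * R : ℝ))) 0 :=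
      (((hasDerivAt_id (0:ℂ)).const_mul _).div_const _).const_sub _
    rw [this.deriv]; ring
  have hb0 : b 0 = (2 * R : ℝ) := by simp [hb]
  have hg0 : g 0 ≠ 0 := by
    intro h; apply h0; rw [hgh, h, mul_zero]
  have hdh : deriv h 0 = g 0 - ρ * deriv g 0 := by
    have h1 : HasDerivAt (fun z => (z - ρ) * g z) (1 * g 0 + (0 - ρ) * deriv g 0) 0 :=
      ((hasDerivAt_id (0:ℂ)).sub_const ρ).mul (hgd 0).hasDerivAt
    have : h = fun z => (z - ρ) * g z := funext hgh
    rw [this, h1.deriv]; ring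
  refine ⟨fun z => g z * b z, hgd.mul hbd, ?_, ?_, ?_, ?_⟩
  · intro z hz
    rw [hgh, norm_mul, norm_mul, mul_comm]
    congr 1
    have e : b z = (starRingEnd ℂ (z - ρ)) * z / (2 * R : ℝ) := by
      have : (starRingEnd ℂ z) * z = (2 * R : ℝ) * (2 * R : ℝ) := by
        rw [← Complex.normSq_eq_conj_mul_self, Complex.normSq_eq_norm_sq, hz]; push_cast; ring
      rw [map_sub, sub_mul, this, hb]
      have : ((2 * R : ℝ) : ℂ) ≠ 0 := by exact_mod_cast (by positivity : (2 * R) ≠ 0)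
      field_simp
    rw [e, norm_div, norm_mul, RCLike.norm_conj, hz, Complex.norm_real, Real.norm_of_nonneg (by positivity)]
    field_simp
  · rw [hgh 0, norm_mul, norm_mul, hb0, Complex.norm_real, Real.norm_of_nonneg (by positivity)]
    simp only [zero_sub, norm_neg]
    have := norm_nonneg (g 0)
    nlinarith
  · intro z hz hk
    rcases mul_eq_zero.mp hk with h1 | h1
    · rw [hgh, h1, mul_zero]
    · exfalso
      have h2 : ((2 * R : ℝ):ℂ) = (starRingEnd ℂ ρ) * z / (2 * R : ℝ) := sub_eq_zero.mp h1
      have h3 := congrArg norm h2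
      rw [norm_div, norm_mul, RCLike.norm_conj, Complex.norm_real,
        Real.norm_of_nonneg (by positivity), eq_div_iff (by positivity)] at h3
      nlinarith [norm_nonneg z]
  · have hk : deriv (fun z => g z * b z) 0 = deriv g 0 * b 0 + g 0 * deriv b 0 :=
      ((hgd 0).hasDerivAt.mul (hbd 0).hasDerivAt).deriv
    change (deriv h 0 / h 0).re = (deriv (fun z => g z * b z) 0 / (g 0 * b 0)).re + _
    rw [hk, hb', hb0, hdh, hgh 0]
    have hR2 : ((2 * R : ℝ) : ℂ) ≠ 0 := by exact_mod_cast (by positivity : (2 * R) ≠ 0)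
    have e1 : (g 0 - ρ * deriv g 0) / ((0 - ρ) * g 0) = deriv g 0 / g 0 - ρ⁻¹ := by
      have : (0 - ρ) ≠ 0 := by simpa using hρ0
      field_simp
      ring
    have e2 : (deriv g 0 * (2 * R : ℝ) + g 0 * (- (starRingEnd ℂ ρ) / (2 * R : ℝ))) / (g 0 * (2 * R : ℝ))
        = deriv g 0 / g 0 - (starRingEnd ℂ ρ) / ((2 * R : ℝ) : ℂ) ^ 2 := by
      field_simp
      ring
    have e3 : ((starRingEnd ℂ ρ) / ((2 * R : ℝ) : ℂ) ^ 2).re = ρ.re / (2 * R) ^ 2 := by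
      rw [← Complex.ofReal_pow, Complex.div_ofReal_re]; simp
    rw [e1, e2, Complex.sub_re, Complex.sub_re, e3, Complex.inv_re, Complex.normSq_eq_norm_sq]
    ring

/-- Lower bound for the real part of the logarithmic derivative when all zeros are to the left. -/
lemma logderiv_lower {f : ℂ → ℂ} {R M : ℝ} (hR : 0 < R) (hM : 0 < M) (hd : Differentiable ℂ f)
    (h0 : f 0 ≠ 0) (hb : ∀ z, ‖z‖ = 2 * R → ‖f z‖ ≤ Real.exp M * ‖f 0‖)
    (hz : ∀ z, ‖z‖ < R → f z = 0 → z.re ≤ 0) :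
    -(4 * M / R) ≤ (deriv f 0 / f 0).re := by
  -- a function with `n` zeros removed
  let E : ℕ → Prop := fun n => ∃ h : ℂ → ℂ, Differentiable ℂ h ∧
    (∀ z, ‖z‖ = 2 * R → ‖h z‖ = ‖f z‖) ∧ 2 ^ n * ‖f 0‖ ≤ ‖h 0‖ ∧
    (∀ z, ‖z‖ < R → h z = 0 → f z = 0) ∧ (deriv h 0 / h 0).re ≤ (deriv f 0 / f 0).re
  have hf0 : 0 < ‖f 0‖ := norm_pos_iff.mpr h0
  have hmax : ∀ h : ℂ → ℂ, Differentiable ℂ h → (∀ z, ‖z‖ = 2 * R → ‖h z‖ = ‖f z‖) →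
      ∀ z, ‖z‖ ≤ 2 * R → ‖h z‖ ≤ Real.exp M * ‖f 0‖ := by
    intro h hh hs z hz
    refine Complex.norm_le_of_forall_mem_frontier_norm_le (U := Metric.ball 0 (2*R))
      Metric.isBounded_ball hh.diffContOnCl ?_ ?_
    · intro w hw
      rw [frontier_ball _ (by positivity)] at hw
      have hw' : ‖w‖ = 2 * R := by simpa using hw
      rw [hs w hw']; exact hb w hw'
    · rw [closure_ball _ (by positivity)]; simpa using hz
  have hE0 : E 0 := ⟨f, hd, fun _ _ => rfl, by simp, fun _ _ h => h, le_rfl⟩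
  have hex : ∃ n, E n ∧ ¬ E (n+1) := by
    by_contra hcon
    push Not at hcon
    have hall : ∀ n, E n := fun n => by
      induction n with
      | zero => exact hE0
      | succ k ih => exact hcon k ih
    obtain ⟨n, hn⟩ := pow_unbounded_of_one_lt (Real.exp M) (one_lt_two : (1:ℝ) < 2)
    obtain ⟨h, hh, hs, hl, -, -⟩ := hall n
    have h1 := hmax h hh hs 0 (by simp; positivity)
    have := hl.trans h1
    nlinarith
  obtain ⟨n, ⟨h, hh, hs, hl, hzz, hre⟩, hn⟩ := hex
  have hl1 : ‖f 0‖ ≤ ‖h 0‖ := by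
    have : (1:ℝ) ≤ 2 ^ n := one_le_pow₀ (by norm_num)
    nlinarith
  have hh0 : h 0 ≠ 0 := norm_pos_iff.mp (hf0.trans_le hl1)
  have hne : ∀ z ∈ Metric.ball (0:ℂ) R, h z ≠ 0 := by
    intro ρ hρ hρ0
    have hρ' : ‖ρ‖ < R := by simpa using hρ
    apply hn
    obtain ⟨k, hk, hks, hkl, hkz, hkre⟩ := blaschke_step hR hh hh0 hρ' hρ0
    refine ⟨k, hk, fun z hz => (hks z hz).trans (hs z hz), ?_, fun z hz h => hzz z hz (hkz z hz h), ?_⟩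
    · rw [pow_succ]; nlinarith
    · have h1 := hz ρ hρ' (hzz ρ hρ' hρ0)
      have hρn : 0 < ‖ρ‖ := norm_pos_iff.mpr (by rintro rfl; exact hh0 hρ0)
      have h2 : 1 / (2 * R) ^ 2 ≤ 1 / ‖ρ‖ ^ 2 := by
        apply one_div_le_one_div_of_le (by positivity)
        gcongr; linarith
      have h3 : 0 ≤ (-ρ.re) * (1 / ‖ρ‖ ^ 2 - 1 / (2 * R) ^ 2) :=
        mul_nonneg (by linarith) (by linarith)
      linarith
  have := logderiv_nonvanish hR hM hh hne (by
    intro z hz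
    have hz' : ‖z‖ < R := by simpa using hz
    refine (hmax h hh hs z (by linarith)).trans ?_
    gcongr)
  have h2 := (Complex.abs_re_le_norm _).trans this
  have := (abs_le.mp h2).1
  linarith

/-- The same with the contribution of one real zero `-r` kept. -/
lemma logderiv_lower_zero {f : ℂ → ℂ} {R M : ℝ} (hR : 0 < R) (hM : 0 < M) (hd : Differentiable ℂ f)
    (h0 : f 0 ≠ 0) (hb : ∀ z, ‖z‖ = 2 * R → ‖f z‖ ≤ Real.exp M * ‖f 0‖)
    (hz : ∀ z, ‖z‖ < R → f z = 0 → z.re ≤ 0) {r : ℝ} (hr : 0 < r) (hrR : r < R)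
    (hfr : f (-r : ℝ) = 0) :
    -(4 * M / R) + (1 / r - r / (2 * R) ^ 2) ≤ (deriv f 0 / f 0).re := by
  have hn : ‖((-r : ℝ) : ℂ)‖ = r := by
    rw [Complex.norm_real, norm_neg, Real.norm_of_nonneg hr.le]
  obtain ⟨k, hk, hks, hkl, hkz, hkre⟩ := blaschke_step hR hd h0 (by rwa [hn]) hfr
  have hf0 : 0 < ‖f 0‖ := norm_pos_iff.mpr h0
  have hk0 : k 0 ≠ 0 := norm_pos_iff.mp (by linarith)
  have h1 := logderiv_lower hR hM hk hk0 (fun z hz => by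
    rw [hks z hz]; refine (hb z hz).trans ?_; gcongr; linarith)
    (fun z hz' h => hz z hz' (hkz z hz' h))
  rw [hkre, hn]
  simp only [Complex.ofReal_re, neg_neg]
  have : r * (1 / r ^ 2 - 1 / (2 * R) ^ 2) = 1 / r - r / (2 * R) ^ 2 := by
    field_simp
  linarith

/-- Terms of the series continuing `(s-1)ζ(s) - 1`. -/
noncomputable def zterm (n : ℕ) (s : ℂ) : ℂ :=
  (s - 1) * ((n : ℂ) + 1) ^ (-s) - (((n : ℂ) + 1) ^ (1 - s) - ((n : ℂ) + 2) ^ (1 - s))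

lemma cpow_sub_cpow_bound {N : ℝ} (hN : 0 < N) {s : ℂ} (hs : 0 < s.re) {u : ℝ}
    (hu : u ∈ Set.Icc N (N + 1)) :
    ‖(u : ℂ) ^ (-s) - (N : ℂ) ^ (-s)‖ ≤ ‖s‖ * N ^ (-s.re - 1) := by
  have h := Convex.norm_image_sub_le_of_norm_hasDerivWithin_le (𝕜 := ℝ)
    (f := fun x : ℝ => (x : ℂ) ^ (-s)) (f' := fun x : ℝ => -s * (x : ℂ) ^ (-s - 1))
    (s := Set.Icc N (N + 1)) (C := ‖s‖ * N ^ (-s.re - 1)) (x := N) (y := u)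
    (fun x hx => by
      have hx0 : 0 < x := hN.trans_le hx.1
      have := (hasDerivAt_id (x : ℂ)).cpow_const (c := -s) (Or.inl (by simpa using hx0))
      have h2 := this.comp_ofReal
      simp only [id, mul_one] at h2
      exact h2.hasDerivWithinAt)
    (fun x hx => by
      have hx0 : 0 < x := hN.trans_le hx.1
      rw [norm_mul, norm_neg, Complex.norm_cpow_eq_rpow_re_of_pos hx0]
      simp only [Complex.sub_re, Complex.neg_re, Complex.one_re]
      gcongr ‖s‖ * ?_
      exact Real.rpow_le_rpow_of_nonpos hN hx.1 (by linarith))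
    (convex_Icc _ _) ⟨le_rfl, by linarith⟩ hu
  refine h.trans ?_
  have h1 : ‖u - N‖ ≤ 1 := by
    rw [Real.norm_eq_abs, abs_le]; constructor <;> linarith [hu.1, hu.2]
  have : 0 ≤ ‖s‖ * N ^ (-s.re - 1) := by positivity
  nlinarith

lemma zterm_bound (n : ℕ) {s : ℂ} (hs : 0 < s.re) :
    ‖zterm n s‖ ≤ ‖s - 1‖ * ‖s‖ * ((n : ℝ) + 1) ^ (-s.re - 1) := by
  set N : ℝ := (n : ℝ) + 1 with hNdef
  have hN : 0 < N := by positivity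
  have h := Convex.norm_image_sub_le_of_norm_hasDerivWithin_le (𝕜 := ℝ)
    (f := fun x : ℝ => (x : ℂ) * ((s - 1) * (N : ℂ) ^ (-s)) + (x : ℂ) ^ (1 - s))
    (f' := fun x : ℝ => 1 * ((s - 1) * (N : ℂ) ^ (-s)) + (1 - s) * (x : ℂ) ^ (1 - s - 1))
    (s := Set.Icc N (N + 1)) (C := ‖s - 1‖ * (‖s‖ * N ^ (-s.re - 1))) (x := N) (y := N + 1)
    (fun x hx => by
      have hx0 : 0 < x := hN.trans_le hx.1
      have h1 := (hasDerivAt_id (x : ℂ)).cpow_const (c := 1 - s) (Or.inl (by simpa using hx0))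
      have h2 := (((hasDerivAt_id (x : ℂ)).mul_const ((s - 1) * (N : ℂ) ^ (-s))).add h1).comp_ofReal
      simp only [id, mul_one] at h2
      exact h2.hasDerivWithinAt)
    (fun x hx => by
      have e : 1 * ((s - 1) * (N : ℂ) ^ (-s)) + (1 - s) * (x : ℂ) ^ (1 - s - 1)
        = (1 - s) * ((x : ℂ) ^ (-s) - (N : ℂ) ^ (-s)) := by
        rw [show 1 - s - 1 = -s by ring]; ring
      rw [e, norm_mul, norm_sub_rev 1 s]
      gcongr
      exact cpow_sub_cpow_bound hN hs hx)
    (convex_Icc _ _) ⟨le_rfl, by linarith⟩ ⟨by linarith, le_rfl⟩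
  have e2 : zterm n s = ((N + 1 : ℝ) : ℂ) * ((s - 1) * (N : ℂ) ^ (-s)) + ((N + 1 : ℝ) : ℂ) ^ (1 - s)
      - ((N : ℂ) * ((s - 1) * (N : ℂ) ^ (-s)) + (N : ℂ) ^ (1 - s)) := by
    have a1 : (N : ℂ) = (n : ℂ) + 1 := by simp [hNdef]
    have a2 : ((N + 1 : ℝ) : ℂ) = (n : ℂ) + 2 := by rw [hNdef]; push_cast; ring
    rw [a2, a1, zterm]; ring
  rw [e2]
  refine h.trans (le_of_eq ?_)
  simp
  ring

lemma zterm_differentiable (n : ℕ) : Differentiable ℂ (zterm n) := by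
  unfold zterm
  have h1 : (n : ℂ) + 1 ≠ 0 := by exact_mod_cast Nat.succ_ne_zero n
  have h2 : (n : ℂ) + 2 ≠ 0 := by exact_mod_cast Nat.succ_ne_zero (n+1)
  intro s
  refine DifferentiableAt.sub (DifferentiableAt.mul (by fun_prop) ?_) (DifferentiableAt.sub ?_ ?_)
  · exact DifferentiableAt.const_cpow (by fun_prop) (Or.inl h1)
  · exact DifferentiableAt.const_cpow (by fun_prop) (Or.inl h1)
  · exact DifferentiableAt.const_cpow (by fun_prop) (Or.inl h2)

lemma summable_aux {a : ℝ} (ha : 1 < a) : Summable fun n : ℕ => ((n : ℝ) + 1) ^ (-a) := by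
  have := (summable_nat_add_iff 1).mpr (Real.summable_nat_rpow (p := -a) |>.mpr (by linarith))
  simpa using this

lemma zterm_summable {s : ℂ} (hs : 0 < s.re) : Summable fun n => zterm n s := by
  refine Summable.of_norm_bounded (g := fun n : ℕ => ‖s - 1‖ * ‖s‖ * ((n : ℝ) + 1) ^ (-(s.re + 1)))
    ((summable_aux (by linarith)).mul_left _) fun n => ?_
  have := zterm_bound n hs
  rwa [show -(s.re + 1) = -s.re - 1 by ring]

lemma zeta1_eq_of_one_lt {s : ℂ} (hs : 1 < s.re) :
    riemannZeta₁ s = 1 + ∑' n, zterm n s := by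
  have hs1 : s ≠ 1 := by rintro rfl; simp at hs
  have hz : riemannZeta₁ s = (s - 1) * riemannZeta s := by
    rw [riemannZeta_eq_inv_sub_mul hs1]
    have := sub_ne_zero.mpr hs1
    field_simp
  have hsum := (zterm_summable (s := s) (by linarith)).hasSum.tendsto_sum_nat
  have hzs : HasSum (fun n : ℕ => ((n : ℂ) + 1) ^ (-s)) (riemannZeta s) := by
    have h1 : Summable (fun n : ℕ => ((n : ℂ) + 1) ^ (-s)) := by
      refine Summable.of_norm_bounded (g := fun n : ℕ => ((n : ℝ) + 1) ^ (-(s.re)))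
        (summable_aux hs) fun n => ?_
      have : ((n : ℂ) + 1) = (((n : ℝ) + 1 : ℝ) : ℂ) := by push_cast; ring
      rw [this, Complex.norm_cpow_eq_rpow_re_of_pos (by positivity)]
      simp
    rw [zeta_eq_tsum_one_div_nat_add_one_cpow hs]
    convert h1.hasSum using 3 with n
    rw [Complex.cpow_neg, one_div]
  have hpart : ∀ N : ℕ, ∑ n ∈ Finset.range N, zterm n s =
      (s - 1) * ∑ n ∈ Finset.range N, ((n : ℂ) + 1) ^ (-s) - (1 - ((N : ℂ) + 1) ^ (1 - s)) := by
    intro N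
    induction N with
    | zero => simp
    | succ k ih =>
      rw [Finset.sum_range_succ, ih, Finset.sum_range_succ, zterm]
      push_cast
      rw [show (k : ℂ) + 1 + 1 = k + 2 by ring]
      ring
  have hlim : Tendsto (fun N : ℕ => ((N : ℂ) + 1) ^ (1 - s)) atTop (nhds 0) := by
    rw [tendsto_zero_iff_norm_tendsto_zero]
    have h1 : Tendsto (fun x : ℝ => x ^ (-(s.re - 1))) atTop (nhds 0) :=
      tendsto_rpow_neg_atTop (by linarith)
    have h2 := h1.comp (tendsto_natCast_atTop_atTop.atTop_add (tendsto_const_nhds (x := (1:ℝ))) : Tendsto (fun N : ℕ => (N : ℝ) + 1) atTop atTop)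
    refine h2.congr fun n => ?_
    have : ((n : ℂ) + 1) = (((n : ℝ) + 1 : ℝ) : ℂ) := by push_cast; ring
    rw [this, Complex.norm_cpow_eq_rpow_re_of_pos (by positivity)]
    simp
  have h3 : Tendsto (fun N : ℕ => ∑ n ∈ Finset.range N, zterm n s) atTop
      (nhds ((s - 1) * riemannZeta s - (1 - 0))) := by
    simp_rw [hpart]
    exact (hzs.tendsto_sum_nat.const_mul _).sub (hlim.const_sub 1)
  have := tendsto_nhds_unique hsum h3
  rw [hz, this]; ring

lemma zeta1_eq {s : ℂ} (hs : 1 / 4 < s.re) :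
    riemannZeta₁ s = 1 + ∑' n, zterm n s := by
  set K : ℝ := ‖s‖ + 3
  set U : Set ℂ := {z : ℂ | 1 / 4 < z.re} ∩ Metric.ball 0 K
  have hU : IsOpen U := (isOpen_lt continuous_const Complex.continuous_re).inter Metric.isOpen_ball
  have hUc : Convex ℝ U := (convex_halfSpace_re_gt _).inter (convex_ball _ _)
  have hG : DifferentiableOn ℂ (fun z => ∑' n, zterm n z) U := by
    refine Complex.differentiableOn_tsum_of_summable_norm
      (u := fun n : ℕ => (K + 1) * K * ((n : ℝ) + 1) ^ (-(5/4 : ℝ)))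
      ((summable_aux (by norm_num)).mul_left _)
      (fun n => (zterm_differentiable n).differentiableOn) hU ?_
    intro n w hw
    have hw1 : 1 / 4 < w.re := hw.1
    have hw2 : ‖w‖ < K := by simpa using hw.2
    refine (zterm_bound n (by linarith)).trans ?_
    have h3 : ‖w - 1‖ ≤ K + 1 := (norm_sub_le _ _).trans (by simp; linarith)
    gcongr
    · linarith
    · linarith [(Nat.cast_nonneg n : (0:ℝ) ≤ n)]
  have h1 : AnalyticOnNhd ℂ riemannZeta₁ U :=
    differentiable_riemannZeta₁.differentiableOn.analyticOnNhd hU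
  have h2 : AnalyticOnNhd ℂ (fun z => 1 + ∑' n, zterm n z) U :=
    (hG.const_add 1).analyticOnNhd hU
  have hK : 3 ≤ K := by simp only [K]; linarith [norm_nonneg s]
  have h2U : (2 : ℂ) ∈ U := ⟨by simp; norm_num, by simp; linarith⟩
  have hsU : s ∈ U := ⟨hs, by simp [K]⟩
  refine h1.eqOn_of_preconnected_of_eventuallyEq h2 hUc.isPreconnected h2U ?_ hsU
  have : {z : ℂ | 1 < z.re} ∈ nhds (2 : ℂ) :=
    (isOpen_lt continuous_const Complex.continuous_re).mem_nhds (by simp)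
  filter_upwards [this] with z hz using zeta1_eq_of_one_lt hz

lemma zeta1_bound : ∃ C : ℝ, 1 ≤ C ∧ ∀ s : ℂ, 1 / 2 ≤ s.re →
    ‖riemannZeta₁ s‖ ≤ C * (‖s‖ + 1) ^ 2 := by
  set S := ∑' n : ℕ, ((n : ℝ) + 1) ^ (-(3/2 : ℝ)) with hS
  have hSs : Summable fun n : ℕ => ((n : ℝ) + 1) ^ (-(3/2 : ℝ)) := summable_aux (by norm_num)
  have hS0 : 0 ≤ S := tsum_nonneg fun n => by positivity
  refine ⟨1 + S, by linarith, fun s hs => ?_⟩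
  rw [zeta1_eq (by linarith)]
  have h1 : ‖∑' n, zterm n s‖ ≤ ‖s - 1‖ * ‖s‖ * S := by
    rw [hS, ← tsum_mul_left]
    refine tsum_of_norm_bounded (hSs.mul_left _).hasSum fun n => ?_
    refine (zterm_bound n (by linarith)).trans ?_
    gcongr
    · linarith [(Nat.cast_nonneg n : (0:ℝ) ≤ n)]
    · linarith
  have h3 : ‖s - 1‖ ≤ ‖s‖ + 1 := (norm_sub_le _ _).trans (by simp)
  have h4 := norm_nonneg s
  calc ‖1 + ∑' n, zterm n s‖ ≤ 1 + ‖s - 1‖ * ‖s‖ * S := (norm_add_le _ _).trans (by simpa using h1)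
    _ ≤ 1 * (‖s‖ + 1) ^ 2 + (‖s‖ + 1) * (‖s‖ + 1) * S := by
        gcongr
        · nlinarith
        · linarith
    _ = _ := by ring

lemma three_four_one {δ : ℝ} (hδ : 0 < δ) (t : ℝ) :
    0 ≤ 3 * (-deriv riemannZeta (1 + δ) / riemannZeta (1 + δ)).re
      + 4 * (-deriv riemannZeta (1 + δ + t * Complex.I) / riemannZeta (1 + δ + t * Complex.I)).re
      + (-deriv riemannZeta (1 + δ + 2 * t * Complex.I)
          / riemannZeta (1 + δ + 2 * t * Complex.I)).re := by
  have h0 : 1 < (1 + δ : ℂ).re := by simp [hδ]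
  have h1 : 1 < (1 + δ + t * Complex.I : ℂ).re := by simp [hδ]
  have h2 : 1 < (1 + δ + 2 * t * Complex.I : ℂ).re := by simp [hδ]
  rw [← ArithmeticFunction.LSeries_vonMangoldt_eq_deriv_riemannZeta_div h0,
    ← ArithmeticFunction.LSeries_vonMangoldt_eq_deriv_riemannZeta_div h1,
    ← ArithmeticFunction.LSeries_vonMangoldt_eq_deriv_riemannZeta_div h2]
  have s0 := (ArithmeticFunction.LSeriesSummable_vonMangoldt h0).hasSum
  have s1 := (ArithmeticFunction.LSeriesSummable_vonMangoldt h1).hasSum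
  have s2 := (ArithmeticFunction.LSeriesSummable_vonMangoldt h2).hasSum
  have s := ((Complex.hasSum_re s0).mul_left 3).add ((Complex.hasSum_re s1).mul_left 4)
    |>.add (Complex.hasSum_re s2)
  refine s.nonneg fun n => ?_
  rcases eq_or_ne n 0 with rfl | hn
  · simp
  rw [LSeries.term_of_ne_zero hn, LSeries.term_of_ne_zero hn, LSeries.term_of_ne_zero hn]
  have hnc : (n : ℂ) ≠ 0 := by exact_mod_cast hn
  have hnpos : (0 : ℝ) < n := by exact_mod_cast Nat.pos_of_ne_zero hn
  set w : ℂ := ((n : ℂ) ^ (t * Complex.I))⁻¹ with hw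
  have hwn : ‖w‖ = 1 := by
    rw [hw, norm_inv, ← Complex.ofReal_natCast, Complex.norm_cpow_eq_rpow_re_of_pos hnpos]
    simp
  set a : ℝ := ArithmeticFunction.vonMangoldt n / (n : ℝ) ^ (1 + δ) with ha
  have ha0 : 0 ≤ a := div_nonneg ArithmeticFunction.vonMangoldt_nonneg (by positivity)
  have e0 : (ArithmeticFunction.vonMangoldt n : ℂ) / (n : ℂ) ^ (1 + δ : ℂ) = a := by
    rw [ha]; push_cast
    rw [Complex.ofReal_cpow hnpos.le]; push_cast; rfl
  have e1 : (ArithmeticFunction.vonMangoldt n : ℂ) / (n : ℂ) ^ (1 + δ + t * Complex.I : ℂ) = a * w := by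
    rw [Complex.cpow_add _ _ hnc, ← e0, hw]
    field_simp
  have e2 : (ArithmeticFunction.vonMangoldt n : ℂ) / (n : ℂ) ^ (1 + δ + 2 * t * Complex.I : ℂ)
      = a * (w * w) := by
    rw [show (1 + δ + 2 * t * Complex.I : ℂ) = (1 + δ) + (t * Complex.I + t * Complex.I) by ring,
      Complex.cpow_add (1 + δ : ℂ) (t * Complex.I + t * Complex.I) hnc,
      Complex.cpow_add (t * Complex.I) (t * Complex.I) hnc, ← e0, hw]
    field_simp
  rw [e0, e1, e2]
  have hxy : w.re * w.re + w.im * w.im = 1 := by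
    rw [← Complex.normSq_apply, Complex.normSq_eq_norm_sq, hwn]; norm_num
  simp only [Complex.ofReal_re, Complex.mul_re, Complex.ofReal_im, zero_mul, sub_zero]
  have : 3 * a + 4 * (a * w.re) + a * (w.re * w.re - w.im * w.im) = 2 * a * (1 + w.re) ^ 2 := by
    linear_combination (-a) * hxy
  rw [this]; positivity

lemma zeta1_ne_zero_of_one_le {s : ℂ} (hs : 1 ≤ s.re) : riemannZeta₁ s ≠ 0 := by
  rcases eq_or_ne s 1 with rfl | h1
  · simp
  · intro h
    apply riemannZeta_ne_zero_of_one_le_re hs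
    rw [riemannZeta_eq_inv_sub_mul h1, h, mul_zero]

lemma logderiv_zeta_eq {s : ℂ} (hs : 1 < s.re) :
    -deriv riemannZeta s / riemannZeta s = 1 / (s - 1) - deriv riemannZeta₁ s / riemannZeta₁ s := by
  have hs1 : s ≠ 1 := by rintro rfl; simp at hs
  have h1 := sub_ne_zero.mpr hs1
  have h2 := zeta1_ne_zero_of_one_le hs.le
  rw [deriv_riemannZeta_eq_neg_inv_sub_sq_mul_add hs1, riemannZeta_eq_inv_sub_mul hs1]
  field_simp
  ring

lemma inv_zeta_bound : ∃ C : ℝ, 1 ≤ C ∧ ∀ s : ℂ, 1 < s.re → s.re ≤ 2 →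
    ‖(riemannZeta s)⁻¹‖ ≤ C / (s.re - 1) := by
  obtain ⟨C, hC, hb⟩ := zeta1_bound
  refine ⟨9 * C, by linarith, fun s hs hs2 => ?_⟩
  have hL : (riemannZeta s)⁻¹ = LSeries (fun n => ((ArithmeticFunction.moebius n : ℤ) : ℂ)) s := by
    have := ArithmeticFunction.LSeries_zeta_mul_Lseries_moebius hs
    rw [ArithmeticFunction.LSeries_zeta_eq_riemannZeta hs] at this
    exact inv_eq_of_mul_eq_one_right this
  have hσ : 1 < ((s.re : ℝ) : ℂ).re := by simpa using hs
  have hsum : HasSum (fun n : ℕ => ((n : ℝ)) ^ (-s.re)) ((riemannZeta (s.re : ℂ)).re) := by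
    have h1 : Summable (fun n : ℕ => ((n : ℝ)) ^ (-s.re)) :=
      Real.summable_nat_rpow.mpr (by linarith)
    have : riemannZeta (s.re : ℂ) = ((∑' n : ℕ, (n : ℝ) ^ (-s.re) : ℝ) : ℂ) := by
      rw [zeta_eq_tsum_one_div_nat_cpow hσ, Complex.ofReal_tsum]
      congr 1; ext n
      rw [Complex.ofReal_cpow (by positivity)]
      push_cast
      rw [Complex.cpow_neg, one_div]
    rw [this, Complex.ofReal_re]
    exact h1.hasSum
  have hle : ‖(riemannZeta s)⁻¹‖ ≤ (riemannZeta (s.re : ℂ)).re := by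
    rw [hL]
    refine tsum_of_norm_bounded hsum fun n => ?_
    rcases eq_or_ne n 0 with rfl | hn
    · simp; positivity
    rw [LSeries.term_of_ne_zero hn, norm_div]
    have hnpos : (0 : ℝ) < n := by exact_mod_cast Nat.pos_of_ne_zero hn
    rw [← Complex.ofReal_natCast, Complex.norm_cpow_eq_rpow_re_of_pos hnpos, Real.rpow_neg hnpos.le,
      div_eq_mul_inv]
    have : ‖((ArithmeticFunction.moebius n : ℤ) : ℂ)‖ ≤ 1 := by
      have := ArithmeticFunction.abs_moebius_le_one (n := n)
      rw [Complex.norm_intCast]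
      exact_mod_cast this
    have h2 : 0 ≤ ((n : ℝ) ^ s.re)⁻¹ := by positivity
    nlinarith
  refine hle.trans ((Complex.re_le_norm _).trans ?_)
  have hne : (s.re : ℂ) ≠ 1 := by
    intro h; rw [h] at hσ; simp at hσ
  rw [riemannZeta_eq_inv_sub_mul hne, norm_mul, norm_inv, inv_mul_eq_div]
  have e : ‖(s.re : ℂ) - 1‖ = s.re - 1 := by
    rw [← Complex.ofReal_one, ← Complex.ofReal_sub, Complex.norm_real,
      Real.norm_of_nonneg (by linarith)]
  rw [e]
  have h3 := hb (s.re : ℂ) (by simp; linarith)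
  have h4 : ‖(s.re : ℂ)‖ ≤ 2 := by
    rw [Complex.norm_real, Real.norm_of_nonneg (by linarith)]; exact hs2
  have : ‖riemannZeta₁ (s.re : ℂ)‖ ≤ 9 * C := by
    refine h3.trans ?_
    have : (‖(s.re : ℂ)‖ + 1) ^ 2 ≤ 3 ^ 2 := by gcongr; linarith
    nlinarith
  gcongr

lemma zeta1_lower : ∃ C : ℝ, 1 ≤ C ∧ ∀ s : ℂ, 1 < s.re → s.re ≤ 2 →
    (s.re - 1) ^ 2 / C ≤ ‖riemannZeta₁ s‖ := by
  obtain ⟨C, hC, hb⟩ := inv_zeta_bound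
  refine ⟨C, hC, fun s hs hs2 => ?_⟩
  have hs1 : s ≠ 1 := by rintro rfl; simp at hs
  have h1 := hb s hs hs2
  have hz := riemannZeta_ne_zero_of_one_le_re hs.le
  have h3 : riemannZeta₁ s = (s - 1) * riemannZeta s := by
    rw [riemannZeta_eq_inv_sub_mul hs1]
    have := sub_ne_zero.mpr hs1
    field_simp
  have hd : 0 < s.re - 1 := by linarith
  have h4 : s.re - 1 ≤ ‖s - 1‖ := by
    have := Complex.re_le_norm (s - 1); simpa using this
  have h5 : (s.re - 1) / C ≤ ‖riemannZeta s‖ := by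
    rw [norm_inv] at h1
    have hp : 0 < ‖riemannZeta s‖ := norm_pos_iff.mpr hz
    have := inv_anti₀ (by positivity) h1
    rw [inv_inv, inv_div] at this
    exact this
  rw [h3, norm_mul]
  calc (s.re - 1) ^ 2 / C = (s.re - 1) * ((s.re - 1) / C) := by ring
    _ ≤ _ := by gcongr

/-- Growth of `ζ₁` around a point `1+δ+it` compared with its value there. -/
lemma zeta1_growth : ∃ B : ℝ, 1 ≤ B ∧ ∀ δ t : ℝ, 0 < δ → δ ≤ 1 / 4 → ∀ z : ℂ, ‖z‖ ≤ 1 / 2 →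
    ‖riemannZeta₁ (1 + δ + t * Complex.I + z)‖ ≤
      Real.exp (B + 2 * Real.log (|t| + 3) + 2 * Real.log (1 / δ))
        * ‖riemannZeta₁ (1 + δ + t * Complex.I)‖ := by
  obtain ⟨C1, hC1, h1⟩ := zeta1_bound
  obtain ⟨C2, hC2, h2⟩ := zeta1_lower
  refine ⟨1 + Real.log (C1 * C2), ?_, fun δ t hδ hδ4 z hz => ?_⟩
  · have : 0 ≤ Real.log (C1 * C2) := Real.log_nonneg (by nlinarith)
    linarith
  have hre : (1 + δ + t * Complex.I : ℂ).re = 1 + δ := by simp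
  have hl := h2 (1 + δ + t * Complex.I) (by rw [hre]; linarith) (by rw [hre]; linarith)
  rw [hre] at hl
  have hzre := (abs_le.mp ((Complex.abs_re_le_norm z).trans hz)).1
  have hu := h1 (1 + δ + t * Complex.I + z) (by rw [Complex.add_re, hre]; linarith)
  have hn : ‖(1 + δ + t * Complex.I + z : ℂ)‖ + 1 ≤ |t| + 3 := by
    have : ‖(1 + δ + t * Complex.I + z : ℂ)‖ ≤ 1 + δ + |t| + 1/2 := by
      refine (norm_add_le _ _).trans (add_le_add ((norm_add_le _ _).trans
        (add_le_add ((norm_add_le _ _).trans ?_) ?_)) hz)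
      · simp [abs_of_pos hδ]
      · simp
    linarith
  have hexp : Real.exp (1 + Real.log (C1 * C2) + 2 * Real.log (|t| + 3) + 2 * Real.log (1 / δ))
      = Real.exp 1 * ((C1 * C2) * (|t| + 3) ^ 2 * (1 / δ) ^ 2) := by
    rw [Real.exp_add, Real.exp_add, Real.exp_add, Real.exp_log (by positivity), two_mul, two_mul,
      Real.exp_add, Real.exp_add, Real.exp_log (by positivity), Real.exp_log (by positivity)]
    ring
  rw [hexp]
  have he : 1 ≤ Real.exp 1 := by linarith [Real.add_one_le_exp (1:ℝ)]
  calc _ ≤ C1 * (|t| + 3) ^ 2 := hu.trans (by gcongr)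
    _ = 1 * (C1 * C2 * (|t| + 3) ^ 2 * (1 / δ) ^ 2) * ((1 + δ - 1) ^ 2 / C2) := by
        field_simp; ring
    _ ≤ _ := by gcongr

lemma zeta1_logderiv : ∃ B : ℝ, 1 ≤ B ∧ ∀ δ t : ℝ, 0 < δ → δ ≤ 1 / 4 → ∀ M : ℝ,
    M = B + 2 * Real.log (|t| + 3) + 2 * Real.log (1 / δ) →
    (-(16 * M) ≤ (deriv riemannZeta₁ (1 + δ + t * Complex.I)
        / riemannZeta₁ (1 + δ + t * Complex.I)).re) ∧
    ∀ r : ℝ, 0 < r → r < 1 / 4 → riemannZeta₁ (1 + δ + t * Complex.I - r) = 0 →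
      -(16 * M) + (1 / r - 4 * r) ≤ (deriv riemannZeta₁ (1 + δ + t * Complex.I)
        / riemannZeta₁ (1 + δ + t * Complex.I)).re := by
  obtain ⟨B, hB, hg⟩ := zeta1_growth
  refine ⟨B, hB, fun δ t hδ hδ4 M hM => ?_⟩
  set s0 : ℂ := 1 + δ + t * Complex.I with hs0
  have hre : s0.re = 1 + δ := by simp [hs0]
  set f : ℂ → ℂ := fun z => riemannZeta₁ (s0 + z) with hf
  have hfd : Differentiable ℂ f := differentiable_riemannZeta₁.comp (by fun_prop)
  have hf0 : f 0 = riemannZeta₁ s0 := by simp [hf]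
  have hfd0 : deriv f 0 = deriv riemannZeta₁ s0 := by
    rw [hf, deriv_comp_const_add]; simp
  have hM0 : 0 < M := by
    have h1 : 0 ≤ Real.log (|t| + 3) := Real.log_nonneg (by linarith [abs_nonneg t])
    have h2 : 0 ≤ Real.log (1 / δ) := Real.log_nonneg (by rw [le_div_iff₀ hδ]; linarith)
    linarith
  have hne : f 0 ≠ 0 := by rw [hf0]; exact zeta1_ne_zero_of_one_le (by rw [hre]; linarith)
  have hb : ∀ z, ‖z‖ = 2 * (1/4 : ℝ) → ‖f z‖ ≤ Real.exp M * ‖f 0‖ := by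
    intro z hz
    rw [hf0, hM]
    exact hg δ t hδ hδ4 z (by rw [hz]; norm_num)
  have hzz : ∀ z, ‖z‖ < (1/4 : ℝ) → f z = 0 → z.re ≤ 0 := by
    intro z _ hz
    by_contra hcon
    push Not at hcon
    exact zeta1_ne_zero_of_one_le (by rw [Complex.add_re, hre]; linarith) hz
  constructor
  · have := logderiv_lower (by norm_num : (0:ℝ) < 1/4) hM0 hfd hne hb hzz
    rw [hf0, hfd0] at this
    linarith
  · intro r hr hr4 hz
    have := logderiv_lower_zero (by norm_num : (0:ℝ) < 1/4) hM0 hfd hne hb hzz hr hr4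
      (by rw [hf]; simpa [sub_eq_add_neg] using hz)
    rw [hf0, hfd0] at this
    have e : r / (2 * (1/4 : ℝ)) ^ 2 = 4 * r := by ring
    rw [e] at this
    linarith

lemma zeta1_logderiv_real : ∃ A : ℝ, 0 ≤ A ∧ ∀ δ : ℝ, 0 ≤ δ → δ ≤ 1 →
    ‖deriv riemannZeta₁ (1 + δ) / riemannZeta₁ (1 + δ)‖ ≤ A := by
  have hc : ContinuousOn (fun δ : ℝ => deriv riemannZeta₁ (1 + δ) / riemannZeta₁ (1 + δ))
      (Set.Icc 0 1) := by
    have h1 : Continuous (deriv riemannZeta₁) := differentiable_riemannZeta₁.deriv.continuous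
    have h2 : Continuous riemannZeta₁ := differentiable_riemannZeta₁.continuous
    refine ContinuousOn.div (by fun_prop) (by fun_prop) fun δ hδ => ?_
    exact zeta1_ne_zero_of_one_le (by simp; exact hδ.1)
  obtain ⟨A, hA⟩ := isCompact_Icc.exists_bound_of_continuousOn hc
  exact ⟨A, (norm_nonneg _).trans (hA 0 ⟨le_rfl, zero_le_one⟩), fun δ h0 h1 => hA δ ⟨h0, h1⟩⟩

lemma re_one_div_bound {δ t : ℝ} (hδ : 0 < δ) (hδ1 : δ ≤ 1) (ht : 1 ≤ |t|) :
    (1 / ((1 + δ + t * Complex.I : ℂ) - 1)).re ≤ 1 := by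
  have : ((1 + δ + t * Complex.I : ℂ) - 1) = δ + t * Complex.I := by ring
  rw [this, one_div, Complex.inv_re]
  simp only [Complex.normSq_apply]
  simp
  rw [div_le_one (by nlinarith [mul_pos hδ hδ, mul_self_nonneg t])]
  have : 1 ≤ t * t := by
    rw [← abs_mul_abs_self t]; nlinarith
  nlinarith

lemma log_ge_one (t : ℝ) : 1 ≤ Real.log (|t| + 3) := by
  rw [Real.le_log_iff_exp_le (by positivity)]
  linarith [Real.exp_one_lt_three, abs_nonneg t]

lemma zero_free_high : ∃ c : ℝ, 0 < c ∧ c ≤ 1 / 8 ∧ ∀ t : ℝ, 1 ≤ |t| → ∀ l : ℝ, 0 < l →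
    l ≤ c / Real.log (|t| + 3) → riemannZeta₁ (1 - l + t * Complex.I) ≠ 0 := by
  obtain ⟨A, hA, hAb⟩ := zeta1_logderiv_real
  obtain ⟨B, hB, hBb⟩ := zeta1_logderiv
  set E : ℝ := 3 * A + 9 + 80 * B + 352 with hE
  set q : ℝ := E + 2000 with hq
  have hq1 : 2000 ≤ q := by rw [hq, hE]; linarith
  set η : ℝ := 1 / q ^ 2 with hη
  have hη0 : 0 < η := by positivity
  have hη1 : η ≤ 1 / 2000 := by
    rw [hη]; apply one_div_le_one_div_of_le (by norm_num); nlinarith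
  refine ⟨η / 10, by positivity, by linarith, fun t ht l hl hlc hzero => ?_⟩
  set L := Real.log (|t| + 3) with hL
  have hL1 : 1 ≤ L := log_ge_one t
  set δ := η / L with hδ
  have hδ0 : 0 < δ := by positivity
  have hδ1 : δ ≤ η := div_le_self hη0.le hL1
  have hlδ : l ≤ δ / 10 := by rw [hδ]; refine hlc.trans (le_of_eq ?_); ring
  set r := δ + l with hr
  have hr0 : 0 < r := by positivity
  obtain ⟨-, h1⟩ := hBb δ t hδ0 (by linarith) _ rfl
  have h1' := h1 r hr0 (by linarith) (by
    rw [← hzero]; congr 1; rw [hr]; push_cast; ring)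
  obtain ⟨h2, -⟩ := hBb δ (2 * t) hδ0 (by linarith) _ rfl
  have h341 := three_four_one hδ0 t
  rw [logderiv_zeta_eq (by simp [hδ0]), logderiv_zeta_eq (by simp [hδ0]),
    logderiv_zeta_eq (by simp [hδ0])] at h341
  simp only [Complex.sub_re (1 / _)] at h341
  have h0 := (abs_le.mp ((Complex.abs_re_le_norm _).trans (hAb δ hδ0.le (by linarith)))).1
  have i0 : (1 / ((1 + δ : ℂ) - 1)).re = 1 / δ := by
    rw [add_sub_cancel_left, ← Complex.ofReal_one, ← Complex.ofReal_div, Complex.ofReal_re]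
  have i1 := re_one_div_bound hδ0 (by linarith) ht
  have i2 := re_one_div_bound (t := 2 * t) hδ0 (by linarith) (by rw [abs_mul]; norm_num; linarith)
  push_cast at i2 h2
  rw [i0] at h341
  -- logs
  have hlogδ : Real.log (1 / δ) ≤ L + 2 * q := by
    have e : 1 / δ = L * q ^ 2 := by rw [hδ, hη]; field_simp
    rw [e, Real.log_mul (by positivity) (by positivity), Real.log_pow]
    have a1 := Real.log_le_sub_one_of_pos (show 0 < L by linarith)
    have a2 := Real.log_le_sub_one_of_pos (show 0 < q by linarith)
    push_cast
    linarith
  have hlog2 : Real.log (|2 * t| + 3) ≤ L + 1 := by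
    have e : |2 * t| + 3 ≤ 2 * (|t| + 3) := by rw [abs_mul]; norm_num; linarith [abs_nonneg t]
    refine (Real.log_le_log (by positivity) e).trans ?_
    rw [Real.log_mul (by norm_num) (by positivity)]
    linarith [Real.log_two_lt_d9]
  have hrr : 3.6 / δ ≤ 4 / r := by
    rw [div_le_div_iff₀ hδ0 hr0]; rw [hr]; linarith
  have e4 : 4 * (1 / r) = 4 / r := by ring
  have hfin : 0.6 / δ ≤ E * L + 320 * q := by
    have e5 : 3.6 / δ = 3 * (1 / δ) + 0.6 / δ := by ring
    have hEL : E ≤ 3 * A + 9 + 80 * B + 352 := le_rfl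
    have : E * L ≥ 3 * A + 9 + 80 * B + 352 * L := by
      rw [hE]; nlinarith
    linarith
  have e6 : 0.6 / δ = 0.6 * q ^ 2 * L := by rw [hδ, hη]; field_simp
  rw [e6] at hfin
  have : E * L + 320 * q ≤ (E + 320 * q) * L := by nlinarith
  have h7 : (0.6 * q ^ 2) * L ≤ (E + 320 * q) * L := hfin.trans this
  have h8 := le_of_mul_le_mul_right h7 (by linarith)
  nlinarith

lemma zero_free_low : ∃ ε : ℝ, 0 < ε ∧ ∀ t : ℝ, |t| ≤ 1 → ∀ l : ℝ, 0 < l →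
    l ≤ ε → riemannZeta₁ (1 - l + t * Complex.I) ≠ 0 := by
  set K : Set ℂ := (fun t : ℝ => (1 + t * Complex.I : ℂ)) '' Set.Icc (-1) 1 with hK
  have hKc : IsCompact K := isCompact_Icc.image (by fun_prop)
  set U : Set ℂ := {s | riemannZeta₁ s ≠ 0}
  have hU : IsOpen U := isOpen_ne_fun differentiable_riemannZeta₁.continuous continuous_const
  have hKU : K ⊆ U := by
    rintro _ ⟨t, _, rfl⟩
    exact zeta1_ne_zero_of_one_le (by simp)
  obtain ⟨ε, hε, hsub⟩ := hKc.exists_cthickening_subset_open hU hKU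
  refine ⟨ε, hε, fun t ht l hl hle => ?_⟩
  apply hsub
  refine Metric.mem_cthickening_of_dist_le _ (1 + t * Complex.I) _ _ ⟨t, abs_le.mp ht, rfl⟩ ?_
  rw [dist_eq_norm, show (1 - l + t * Complex.I - (1 + t * Complex.I) : ℂ) = -(l : ℂ) by ring,
    norm_neg, Complex.norm_real, Real.norm_of_nonneg hl.le]
  exact hle

/-- The classical zero-free region. -/
lemma zero_free : ∃ c : ℝ, 0 < c ∧ c ≤ 1 / 8 ∧ ∀ s : ℂ,
    1 - c / Real.log (|s.im| + 3) ≤ s.re → riemannZeta₁ s ≠ 0 := by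
  obtain ⟨c, hc, hc8, h1⟩ := zero_free_high
  obtain ⟨ε, hε, h2⟩ := zero_free_low
  refine ⟨min c ε, lt_min hc hε, (min_le_left _ _).trans hc8, fun s hs => ?_⟩
  rcases le_or_gt 1 s.re with h | h
  · exact zeta1_ne_zero_of_one_le h
  have hL := log_ge_one s.im
  have e : s = 1 - ((1 - s.re : ℝ) : ℂ) + s.im * Complex.I := by
    apply Complex.ext <;> simp
  rw [e]
  rcases le_total 1 |s.im| with ht | ht
  · refine h1 _ ht _ (by linarith) ?_
    have : min c ε / Real.log (|s.im| + 3) ≤ c / Real.log (|s.im| + 3) := by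
      gcongr; exact min_le_left _ _
    linarith
  · refine h2 _ ht _ (by linarith) ?_
    have : min c ε / Real.log (|s.im| + 3) ≤ ε :=
      (div_le_self (lt_min hc hε).le hL).trans (min_le_right _ _)
    linarith

lemma norm_inv_zeta1 {s : ℂ} (h1 : s ≠ 1) :
    ‖(s - 1) / riemannZeta₁ s‖ = ‖(riemannZeta s)⁻¹‖ := by
  rw [riemannZeta_eq_inv_sub_mul h1, mul_inv, inv_inv, div_eq_mul_inv]

set_option maxHeartbeats 1000000 in
lemma inv_zeta1_bound : ∃ c : ℝ, 0 < c ∧ c ≤ 1 / 8 ∧ ∃ C : ℝ, 1 ≤ C ∧ ∀ T : ℝ, 0 ≤ T →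
    ∀ s : ℂ, |s.im| ≤ T → 1 - c / Real.log (T + 4) ≤ s.re → s.re ≤ 2 →
    riemannZeta₁ s ≠ 0 ∧ ‖(s - 1) / riemannZeta₁ s‖ ≤ C * Real.sqrt (T + 4) := by
  obtain ⟨c0, hc0, hc08, hzf⟩ := zero_free
  obtain ⟨B, hB, hg⟩ := zeta1_growth
  obtain ⟨C, hC, hinv⟩ := inv_zeta_bound
  obtain ⟨K, hK⟩ : ∃ K, K = B + 2 * (1 / c0) + 4 := ⟨_, rfl⟩
  have hK1 : 1 ≤ K := by rw [hK]; have : 0 < 1 / c0 := by positivity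
                         linarith
  obtain ⟨η, hη⟩ : ∃ η, η = 1 / (32 * (K + 4)) := ⟨_, rfl⟩
  have hη0 : 0 < η := by rw [hη]; positivity
  have hη1 : η ≤ 1 / 160 := by
    rw [hη]; apply one_div_le_one_div_of_le <;> linarith
  have hηK : 8 * η * (K + 4) = 1 / 4 := by rw [hη]; field_simp; norm_num
  have hε1 : η ^ 2 ≤ 1 / 160 := by nlinarith
  have hε0 : 0 < η ^ 2 := by positivity
  refine ⟨η ^ 2 * c0, by positivity, by nlinarith, 4 * C / (η ^ 2 * c0), ?_, ?_⟩
  · rw [le_div_iff₀ (by positivity)]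
    nlinarith
  intro T hT s hsT hs1 hs2
  obtain ⟨L, hL⟩ : ∃ L, L = Real.log (T + 4) := ⟨_, rfl⟩
  rw [← hL] at hs1
  have hL1 : 1 ≤ L := by
    rw [hL, Real.le_log_iff_exp_le (by positivity)]
    linarith [Real.exp_one_lt_three]
  have hLs : L * Real.exp (L / 4) ≤ 4 * Real.sqrt (T + 4) := by
    have h1 : L / 4 ≤ Real.exp (L / 4) := by linarith [Real.add_one_le_exp (L / 4)]
    have h2 : Real.sqrt (T + 4) = Real.exp (L / 4) * Real.exp (L / 4) := by
      rw [← Real.exp_add, show L / 4 + L / 4 = L * (1/2) by ring, hL, Real.sqrt_eq_rpow,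
        Real.rpow_def_of_pos (by linarith)]
    rw [h2]
    nlinarith [Real.exp_pos (L / 4)]
  have hLs' : L ≤ L * Real.exp (L / 4) := by
    nlinarith [Real.one_le_exp (show 0 ≤ L / 4 by linarith)]
  obtain ⟨r, hr⟩ : ∃ r, r = η ^ 2 * c0 / L := ⟨_, rfl⟩
  rw [← hr] at hs1
  have hr0 : 0 < r := by rw [hr]; positivity
  obtain ⟨R, hR⟩ : ∃ R, R = c0 / L := ⟨_, rfl⟩
  have hR0 : 0 < R := by rw [hR]; positivity
  have hR8 : R ≤ 1 / 8 := by
    rw [hR]; refine (div_le_self hc0.le hL1).trans hc08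
  have hrR : r = η ^ 2 * R := by rw [hr, hR]; ring
  have hrR' : r ≤ R / 160 := by rw [hrR]; nlinarith
  have hCr : C / r = C / (η ^ 2 * c0) * L := by rw [hr]; field_simp
  rcases le_or_gt (1 + r) s.re with hcase | hcase
  · have hgt : 1 < s.re := by linarith
    have hne : s ≠ 1 := by rintro rfl; simp at hgt
    refine ⟨zeta1_ne_zero_of_one_le hgt.le, ?_⟩
    rw [norm_inv_zeta1 hne]
    calc _ ≤ C / (s.re - 1) := hinv s hgt hs2
      _ ≤ C / r := by gcongr; linarith
      _ = C / (η ^ 2 * c0) * L := hCr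
      _ ≤ C / (η ^ 2 * c0) * (4 * Real.sqrt (T + 4)) := by gcongr; linarith
      _ = _ := by ring
  obtain ⟨t, ht⟩ : ∃ t, t = s.im := ⟨_, rfl⟩
  rw [← ht] at hsT
  obtain ⟨s0, hs0⟩ : ∃ s0 : ℂ, s0 = 1 + r + t * Complex.I := ⟨_, rfl⟩
  have hs0re : s0.re = 1 + r := by simp [hs0]
  have hs0im : s0.im = t := by simp [hs0]
  obtain ⟨M, hM⟩ : ∃ M, M = B + 2 * Real.log (|t| + 3) + 2 * Real.log (1 / r) := ⟨_, rfl⟩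
  have hlt := log_ge_one t
  have hlogr : Real.log (1 / r) ≤ 1 / c0 + 2 / η + L := by
    have : 1 / r = (1 / c0) * (1 / η * (1 / η * L)) := by rw [hr]; field_simp
    rw [this, Real.log_mul (by positivity) (by positivity), Real.log_mul (by positivity) (by positivity),
      Real.log_mul (by positivity) (by positivity)]
    have h1 := Real.log_le_sub_one_of_pos (show 0 < 1 / c0 by positivity)
    have h2 := Real.log_le_sub_one_of_pos (show 0 < 1 / η by positivity)
    have h3 := Real.log_le_sub_one_of_pos (show 0 < L by positivity)
    have : 2 / η = 1 / η + 1 / η := by ring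
    linarith
  have hM0 : 0 < M := by
    have : 0 ≤ Real.log (1 / r) := by
      apply Real.log_nonneg; rw [le_div_iff₀ hr0]; linarith
    linarith
  have hML : M ≤ (K + 4 / η) * L := by
    have h1 : Real.log (|t| + 3) ≤ L := by
      rw [hL]; apply Real.log_le_log (by positivity); linarith
    have h2 : B ≤ B * L := le_mul_of_one_le_right (by linarith) hL1
    have h3 : 1 / c0 ≤ 1 / c0 * L := le_mul_of_one_le_right (by positivity) hL1
    have h4 : 4 / η ≤ 4 / η * L := le_mul_of_one_le_right (by positivity) hL1
    have h5 : 2 * (2 / η) = 4 / η := by ring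
    have h6 : (K + 4 / η) * L = B * L + 2 * (1 / c0 * L) + 4 * L + 4 / η * L := by rw [hK]; ring
    rw [hM, h6]; linarith
  have hnz : ∀ z ∈ Metric.ball (0:ℂ) R, riemannZeta₁ (s0 + z) ≠ 0 := by
    intro z hz
    rw [mem_ball_zero_iff] at hz
    apply hzf
    have h1 := (abs_le.1 (Complex.abs_re_le_norm z)).1
    have h2 := Complex.abs_im_le_norm z
    have h3 : Real.log (|(s0 + z).im| + 3) ≤ L := by
      rw [hL]; apply Real.log_le_log (by positivity)
      rw [Complex.add_im, hs0im]
      have := abs_add_le t z.im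
      linarith
    have h4 : R ≤ c0 / Real.log (|(s0 + z).im| + 3) := by
      rw [hR]
      have := log_ge_one (s0 + z).im
      gcongr
    rw [Complex.add_re, hs0re]
    linarith
  obtain ⟨φ, -, -, hφ, hφb⟩ := bc_log (h := fun z => riemannZeta₁ (s0 + z)) hR0 hM0
    ((differentiable_riemannZeta₁.comp (by fun_prop)).differentiableOn) hnz (by
      intro z hz
      rw [mem_ball_zero_iff] at hz
      have := hg r t hr0 (by linarith) z (by linarith)
      simpa [hs0, hM] using this)
  obtain ⟨z, hz⟩ : ∃ z : ℂ, z = ((s.re - 1 - r : ℝ) : ℂ) := ⟨_, rfl⟩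
  have hsz : s0 + z = s := by
    apply Complex.ext
    · rw [Complex.add_re, hs0re, hz, Complex.ofReal_re]; ring
    · rw [Complex.add_im, hs0im, hz, Complex.ofReal_im, ht]; ring
  have hzn : ‖z‖ ≤ 2 * r := by
    rw [hz, Complex.norm_real, Real.norm_eq_abs, abs_le]; constructor <;> linarith
  have hzR : z ∈ Metric.ball (0:ℂ) R := by
    rw [mem_ball_zero_iff]; linarith
  have e1 := hφ z hzR
  have e2 := hφb z hzR
  simp only [hsz, add_zero] at e1
  have hφL : ‖φ z‖ ≤ L / 4 := by
    refine e2.trans ?_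
    rw [div_le_iff₀ (by linarith)]
    have h1 : 2 * M * ‖z‖ ≤ 2 * ((K + 4 / η) * L) * (2 * r) := by gcongr
    have h2 : 2 * ((K + 4 / η) * L) * (2 * r) ≤ L / 4 * (R / 2) := by
      have : (K + 4 / η) * r ≤ η * (K + 4) * R := by
        rw [hrR]
        have : (K + 4 / η) * (η ^ 2 * R) = η * (K * η + 4) * R := by field_simp
        rw [this]
        gcongr
        nlinarith
      have h3 : η * (K + 4) * R = R / 32 := by
        have : η * (K + 4) = 1 / 32 := by linarith
        rw [this]; ring
      rw [h3] at this
      calc _ = 4 * L * ((K + 4 / η) * r) := by ring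
        _ ≤ 4 * L * (R / 32) := by gcongr
        _ = _ := by ring
    have h4 : L / 4 * (R / 2) ≤ L / 4 * (R - ‖z‖) := by
      gcongr; linarith
    linarith
  have hs0ne : s0 ≠ 1 := by
    intro h; rw [h] at hs0re; simp at hs0re; linarith
  have hb0 : ‖(s0 - 1) / riemannZeta₁ s0‖ ≤ C / r := by
    rw [norm_inv_zeta1 hs0ne]
    have := hinv s0 (by rw [hs0re]; linarith) (by rw [hs0re]; linarith)
    rwa [hs0re, add_sub_cancel_left] at this
  have hnorm : ‖s - 1‖ ≤ ‖s0 - 1‖ := by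
    rw [Complex.norm_def, Complex.norm_def]
    apply Real.sqrt_le_sqrt
    rw [Complex.normSq_apply, Complex.normSq_apply]
    simp only [Complex.sub_re, Complex.sub_im, Complex.one_re, Complex.one_im, hs0re, hs0im, ← ht]
    nlinarith
  have hexp : ‖Complex.exp (-φ z)‖ ≤ Real.exp (L / 4) := by
    rw [Complex.norm_exp]
    apply Real.exp_le_exp.2
    have := Complex.abs_re_le_norm (-φ z)
    rw [norm_neg] at this
    exact (le_abs_self _).trans (this.trans hφL)
  refine ⟨hsz ▸ hnz z hzR, ?_⟩
  have : ‖(s - 1) / riemannZeta₁ s‖ = ‖s - 1‖ / ‖riemannZeta₁ s0‖ * ‖Complex.exp (-φ z)‖ := by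
    rw [e1, Complex.exp_neg, norm_div, norm_mul, norm_inv, div_mul_eq_div_div, div_eq_mul_inv _ ‖Complex.exp _‖]
  rw [this]
  calc _ ≤ ‖s0 - 1‖ / ‖riemannZeta₁ s0‖ * Real.exp (L / 4) := by gcongr
    _ = ‖(s0 - 1) / riemannZeta₁ s0‖ * Real.exp (L / 4) := by rw [norm_div]
    _ ≤ C / r * Real.exp (L / 4) := by gcongr
    _ = C / (η ^ 2 * c0) * (L * Real.exp (L / 4)) := by rw [hCr]; ring
    _ ≤ C / (η ^ 2 * c0) * (4 * Real.sqrt (T + 4)) := by gcongr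
    _ = _ := by ring

lemma kernel_bound {s : ℂ} (hs : 1 / 2 ≤ s.re) :
    ‖1 / (s * (s + 1))‖ ≤ 2 * (1 + s.im ^ 2)⁻¹ := by
  have h1 : (1 + s.im ^ 2) ≤ 2 * (‖s‖ * ‖s + 1‖) := by
    apply abs_le_of_sq_le_sq' _ (by positivity) |>.2
    have e1 : ‖s‖ ^ 2 = s.re * s.re + s.im * s.im := by
      rw [← Complex.normSq_eq_norm_sq, Complex.normSq_apply]
    have e2 : ‖s + 1‖ ^ 2 = (s.re + 1) * (s.re + 1) + s.im * s.im := by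
      rw [← Complex.normSq_eq_norm_sq, Complex.normSq_apply]; simp
    have f1 : (1 + s.im ^ 2) / 4 ≤ ‖s‖ ^ 2 := by rw [e1]; nlinarith [mul_self_nonneg s.im]
    have f2 : (1 + s.im ^ 2) ≤ ‖s + 1‖ ^ 2 := by rw [e2]; nlinarith [mul_self_nonneg s.im]
    have f3 : (1 + s.im ^ 2) / 4 * (1 + s.im ^ 2) ≤ ‖s‖ ^ 2 * ‖s + 1‖ ^ 2 := by gcongr
    nlinarith
  have hp : 0 < 1 + s.im ^ 2 := by positivity
  have hq : 0 < ‖s‖ * ‖s + 1‖ := by nlinarith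
  rw [norm_div, norm_one, norm_mul, ← div_eq_mul_inv, div_le_div_iff₀ hq hp]
  linarith

lemma kernel_cont {σ : ℝ} (hσ : 1 / 2 ≤ σ) :
    Continuous (fun y : ℝ => 1 / (((σ : ℂ) + y * Complex.I) * (((σ : ℂ) + y * Complex.I) + 1))) := by
  refine Continuous.div (by fun_prop) (by fun_prop) fun y => mul_ne_zero ?_ ?_
  · intro h; have := congrArg Complex.re h; simp at this; linarith
  · intro h; have := congrArg Complex.re h; simp at this; linarith

lemma kernel_integrable {σ : ℝ} (hσ : 1 / 2 ≤ σ) :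
    MeasureTheory.Integrable
      (fun y : ℝ => 1 / (((σ : ℂ) + y * Complex.I) * (((σ : ℂ) + y * Complex.I) + 1))) := by
  refine MeasureTheory.Integrable.mono' (integrable_inv_one_add_sq.const_mul 2)
    (kernel_cont hσ).aestronglyMeasurable (Filter.Eventually.of_forall fun y => ?_)
  have := kernel_bound (s := (σ : ℂ) + y * Complex.I) (by simpa using hσ)
  simpa using this

noncomputable def tri (u : ℝ) : ℂ := ((max (1 - u) 0 : ℝ) : ℂ)

lemma tri_mellin {s : ℂ} (hs : 0 < s.re) : HasMellin tri s (1 / (s * (s + 1))) := by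
  have h1 := hasMellin_one_Ioc hs
  have h2 := hasMellin_cpow_Ioc 1 (s := s) (by simp; linarith)
  have h3 := hasMellin_sub h1.1 h2.1
  rw [h1.2, h2.2] at h3
  have e : (1 / s - 1 / (s + 1)) = 1 / (s * (s + 1)) := by
    have : s ≠ 0 := by rintro rfl; simp at hs
    have : s + 1 ≠ 0 := by
      intro h; have := congrArg Complex.re h; simp at this; linarith
    field_simp; ring
  rw [e] at h3
  have key : ∀ t ∈ Set.Ioi (0:ℝ), (fun t => Set.indicator (Set.Ioc 0 1) (fun _ => 1 : ℝ → ℂ) t -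
     Set.indicator (Set.Ioc 0 1) (fun t => ↑t ^ (1:ℂ) : ℝ → ℂ) t) t = tri t := by
    intro t ht
    have ht : 0 < t := ht
    by_cases h : t ≤ 1
    · have hm : t ∈ Set.Ioc (0:ℝ) 1 := ⟨ht, h⟩
      simp only [Set.indicator_of_mem hm, tri, Complex.cpow_one]
      rw [max_eq_left (by linarith)]; push_cast; rfl
    · have hm : t ∉ Set.Ioc (0:ℝ) 1 := fun h' => h h'.2
      simp only [Set.indicator_of_notMem hm, tri]
      rw [max_eq_right (by linarith)]; simp
  refine ⟨?_, ?_⟩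
  · refine h3.1.congr_fun (fun t ht => ?_) measurableSet_Ioi
    simp only [← key t ht]
  · rw [← h3.2]
    refine MeasureTheory.setIntegral_congr_fun measurableSet_Ioi (fun t ht => ?_)
    simp only [← key t ht]

lemma tri_inv {κ : ℝ} (hκ : 1 < κ) {u : ℝ} (hu : 0 < u) :
    (tri u : ℂ) = (1 / (2 * Real.pi) : ℝ) • ∫ y : ℝ, (u : ℂ) ^ (-((κ : ℂ) + y * Complex.I)) *
      (1 / (((κ : ℂ) + y * Complex.I) * (((κ : ℂ) + y * Complex.I) + 1))) := by
  have e : ∀ y : ℝ, mellin tri ((κ : ℂ) + y * Complex.I) =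
      1 / (((κ : ℂ) + y * Complex.I) * (((κ : ℂ) + y * Complex.I) + 1)) := fun y =>
    (tri_mellin (s := (κ : ℂ) + y * Complex.I) (by simp; linarith)).2
  have hc : Continuous tri := by unfold tri; fun_prop
  have := mellinInv_mellin_eq κ tri hu (tri_mellin (s := (κ:ℂ)) (by simp; linarith)).1
    (by
      unfold Complex.VerticalIntegrable
      simp only [e]; exact kernel_integrable (by linarith)) hc.continuousAt
  rw [← this, mellinInv]
  simp only [e, smul_eq_mul]

open ArithmeticFunction in
lemma perron {κ : ℝ} (hκ : 1 < κ) {x : ℝ} (hx : 0 < x) :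
    ((∑ n ∈ Finset.Icc 1 ⌊x⌋₊, (moebius n : ℝ) * (1 - n / x) : ℝ) : ℂ) =
      (1 / (2 * Real.pi) : ℝ) • ∫ y : ℝ, (x : ℂ) ^ ((κ : ℂ) + y * Complex.I) *
        (riemannZeta ((κ : ℂ) + y * Complex.I))⁻¹ *
      (1 / (((κ : ℂ) + y * Complex.I) * (((κ : ℂ) + y * Complex.I) + 1))) := by
  set G : ℝ → ℂ := fun y => 1 / (((κ : ℂ) + y * Complex.I) * (((κ : ℂ) + y * Complex.I) + 1)) with hG
  have hGi : MeasureTheory.Integrable G := kernel_integrable (by linarith)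
  have hxc : (x : ℂ) ≠ 0 := by exact_mod_cast hx.ne'
  let F : ℕ → ℝ → ℂ := fun n y =>
    LSeries.term (fun n => (moebius n : ℂ)) ((κ : ℂ) + y * Complex.I) n
      * ((x : ℂ) ^ ((κ : ℂ) + y * Complex.I) * G y)
  have hFn : ∀ n y, ‖F n y‖ = ‖LSeries.term (fun n => (moebius n : ℂ)) (κ : ℂ) n‖ * (x ^ κ * ‖G y‖) := by
    intro n y
    simp only [F, norm_mul]
    rw [Complex.norm_cpow_eq_rpow_re_of_pos hx, LSeries.norm_term_eq, LSeries.norm_term_eq]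
    simp
  have hmeas : ∀ n, Continuous (F n) := by
    intro n
    rcases eq_or_ne n 0 with rfl | hn
    · simp [F]; exact continuous_const
    · simp only [F, LSeries.term_of_ne_zero hn]
      have hnc : (n : ℂ) ≠ 0 := by exact_mod_cast hn
      refine Continuous.mul (Continuous.div continuous_const ?_ ?_) (Continuous.mul ?_ ?_)
      · exact Continuous.const_cpow (by fun_prop) (Or.inl hnc)
      · intro y; simp [Complex.cpow_eq_zero_iff, hnc]
      · exact Continuous.const_cpow (by fun_prop) (Or.inl hxc)
      · exact kernel_cont (by linarith)
  have hFi : ∀ n, MeasureTheory.Integrable (F n) := by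
    intro n
    refine MeasureTheory.Integrable.mono'
      ((hGi.norm.const_mul (x ^ κ)).const_mul ‖LSeries.term (fun n => (moebius n : ℂ)) (κ : ℂ) n‖)
      (hmeas n).aestronglyMeasurable (Filter.Eventually.of_forall fun y => (hFn n y).le)
  have hsum : Summable fun n => ∫ y, ‖F n y‖ := by
    simp only [hFn, MeasureTheory.integral_const_mul]
    apply Summable.mul_right
    exact (LSeriesSummable_moebius_iff.2 (by simpa using hκ)).norm
  have key := MeasureTheory.hasSum_integral_of_summable_integral_norm hFi hsum
  have hIntF : ∀ n : ℕ, n ≠ 0 → ∫ y, F n y = (2 * Real.pi : ℝ) * ((moebius n : ℂ) * tri (n / x)) := by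
    intro n hn
    have hnp : (0:ℝ) < n := by exact_mod_cast Nat.pos_of_ne_zero hn
    rw [tri_inv hκ (div_pos hnp hx)]
    have e : ∀ y, F n y = (moebius n : ℂ) * ((((n / x : ℝ)) : ℂ) ^ (-((κ : ℂ) + y * Complex.I)) * G y) := by
      intro y
      simp only [F, LSeries.term_of_ne_zero hn]
      rw [Complex.ofReal_div, Complex.div_cpow_ofReal_nonneg hnp.le hx.le, Complex.cpow_neg,
        Complex.cpow_neg, Complex.ofReal_natCast]
      field_simp
    simp only [e]
    rw [MeasureTheory.integral_const_mul]
    rw [Complex.real_smul]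
    change _ = ((2 * Real.pi : ℝ) : ℂ) * ((moebius n : ℂ) * (((1 / (2 * Real.pi) : ℝ) : ℂ) *
      ∫ y : ℝ, (((n / x : ℝ)) : ℂ) ^ (-((κ : ℂ) + y * Complex.I)) * G y))
    generalize (∫ y : ℝ, (((n / x : ℝ)) : ℂ) ^ (-((κ : ℂ) + y * Complex.I)) * G y) = J
    push_cast
    have : (Real.pi : ℂ) ≠ 0 := by exact_mod_cast Real.pi_ne_zero
    field_simp
  have hIntF0 : ∫ y, F 0 y = 0 := by simp [F]
  have hlhs : ∑' n, ∫ y, F n y = (2 * Real.pi : ℝ) *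
      ((∑ n ∈ Finset.Icc 1 ⌊x⌋₊, (moebius n : ℝ) * (1 - n / x) : ℝ) : ℂ) := by
    rw [tsum_eq_sum (s := Finset.Icc 1 ⌊x⌋₊)]
    · push_cast
      rw [Finset.mul_sum]
      refine Finset.sum_congr rfl fun n hn => ?_
      rw [Finset.mem_Icc] at hn
      rw [hIntF n (by omega), tri, max_eq_left]
      · push_cast; rfl
      · have : (n : ℝ) ≤ x := (Nat.le_floor_iff hx.le).1 hn.2
        rw [sub_nonneg, div_le_one hx]; exact this
    · intro n hn
      rcases eq_or_ne n 0 with rfl | h0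
      · exact hIntF0
      rw [hIntF n h0, tri, max_eq_right]
      · simp
      · have : x < n := by
          rw [← Nat.floor_lt hx.le]
          by_contra h
          exact hn (Finset.mem_Icc.2 ⟨by omega, by omega⟩)
        rw [sub_nonpos, le_div_iff₀ hx]; linarith
  have hrhs : ∀ y, ∑' n, F n y = (x : ℂ) ^ ((κ : ℂ) + y * Complex.I) *
        (riemannZeta ((κ : ℂ) + y * Complex.I))⁻¹ * G y := by
    intro y
    simp only [F]
    rw [tsum_mul_right]
    have hre : 1 < ((κ : ℂ) + y * Complex.I).re := by simpa using hκ
    have := LSeries_zeta_mul_Lseries_moebius hre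
    rw [LSeries_zeta_eq_riemannZeta hre] at this
    have h2 : LSeries (fun n => (moebius n : ℂ)) ((κ : ℂ) + y * Complex.I)
        = (riemannZeta ((κ : ℂ) + y * Complex.I))⁻¹ := eq_inv_of_mul_eq_one_right this
    rw [← h2, LSeries]
    ring
  have := key.tsum_eq
  rw [hlhs] at this
  simp only [hrhs] at this
  rw [← this, Complex.real_smul]
  push_cast
  have : (Real.pi : ℂ) ≠ 0 := by exact_mod_cast Real.pi_ne_zero
  field_simp

noncomputable def HH (x : ℝ) (s : ℂ) : ℂ :=
  (x : ℂ) ^ s * ((s - 1) / riemannZeta₁ s) * (1 / (s * (s + 1)))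

lemma norm_HH {x : ℝ} (hx : 0 < x) {s : ℂ} (hs : 1 / 2 ≤ s.re) {K : ℝ}
    (hK : ‖(s - 1) / riemannZeta₁ s‖ ≤ K) :
    ‖HH x s‖ ≤ x ^ s.re * K * (2 * (1 + s.im ^ 2)⁻¹) := by
  have h0 : 0 ≤ K := (norm_nonneg _).trans hK
  unfold HH
  rw [norm_mul, norm_mul, Complex.norm_cpow_eq_rpow_re_of_pos hx]
  have := kernel_bound hs
  gcongr

lemma tail_bound {f : ℝ → ℂ} {K T : ℝ} (hK : 0 ≤ K) (hT : 1 ≤ T)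
    (hf : MeasureTheory.Integrable f) (hb : ∀ y, ‖f y‖ ≤ K * (1 + y ^ 2)⁻¹) :
    ‖∫ y, f y‖ ≤ ‖∫ y in (-T)..T, f y‖ + K * (2 / T) := by
  have hg : MeasureTheory.Integrable (fun y : ℝ => K * (1 + y ^ 2)⁻¹) :=
    integrable_inv_one_add_sq.const_mul K
  have h1 := MeasureTheory.integral_add_compl (measurableSet_Ioc (a := -T) (b := T)) hf
  have h2 := MeasureTheory.integral_add_compl (measurableSet_Ioc (a := -T) (b := T)) hg
  rw [← intervalIntegral.integral_of_le (by linarith)] at h1 h2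
  have h3 : ‖∫ y in (Set.Ioc (-T) T)ᶜ, f y‖ ≤ ∫ y in (Set.Ioc (-T) T)ᶜ, K * (1 + y ^ 2)⁻¹ :=
    MeasureTheory.norm_integral_le_of_norm_le hg.integrableOn (Filter.Eventually.of_forall hb)
  have h4 : ∫ y in (-T)..T, K * (1 + y ^ 2)⁻¹ = K * (2 * Real.arctan T) := by
    rw [intervalIntegral.integral_const_mul, integral_inv_one_add_sq, Real.arctan_neg]; ring
  rw [h4, MeasureTheory.integral_const_mul (μ := MeasureTheory.volume) K (fun y : ℝ => (1 + y ^ 2)⁻¹),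
    integral_univ_inv_one_add_sq] at h2
  have h5 : Real.pi - 2 * Real.arctan T ≤ 2 / T := by
    have e := Real.arctan_inv_of_pos (show 0 < T by linarith)
    have : Real.arctan T⁻¹ ≤ T⁻¹ := by
      have := Real.le_tan (x := Real.arctan T⁻¹) (by rw [Real.arctan_nonneg]; positivity)
        (Real.arctan_lt_pi_div_two _)
      rwa [Real.tan_arctan] at this
    rw [div_eq_mul_inv]; linarith
  rw [← h1]
  refine (norm_add_le _ _).trans ?_
  have : K * (Real.pi - 2 * Real.arctan T) ≤ K * (2 / T) := by gcongr
  linarith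

lemma contour : ∃ c : ℝ, 0 < c ∧ c ≤ 1 / 8 ∧ ∃ C : ℝ, 1 ≤ C ∧ ∀ x : ℝ, 0 < x → 1 ≤ Real.log x →
    ∀ T : ℝ, 1 ≤ T →
    |∑ n ∈ Finset.Icc 1 ⌊x⌋₊, (ArithmeticFunction.moebius n : ℝ) * (1 - n / x)| ≤
      C * x * (Real.log x / T + T ^ 2 * x ^ (-(c / Real.log (T + 4)))) := by
  obtain ⟨c, hc0, hc8, C, hC, hb⟩ := inv_zeta1_bound
  obtain ⟨C1, hC1, hinv⟩ := inv_zeta_bound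
  refine ⟨c, hc0, hc8, 100 * (C + C1), by linarith, ?_⟩
  intro x hx hlx T hT
  obtain ⟨κ, hκ⟩ : ∃ κ, κ = 1 + 1 / Real.log x := ⟨_, rfl⟩
  have hlx0 : 0 < Real.log x := by linarith
  have hκ1 : 1 < κ := by rw [hκ]; have : 0 < 1 / Real.log x := by positivity
                         linarith
  have hκ2 : κ ≤ 2 := by
    have : 1 / Real.log x ≤ 1 := by rw [div_le_one hlx0]; exact hlx
    linarith
  have hx1 : 1 ≤ x := by
    by_contra h
    have := Real.log_nonpos hx.le (by linarith)
    linarith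
  have hxκ : x ^ κ ≤ 3 * x := by
    have : x ^ κ = x * Real.exp 1 := by
      rw [hκ, Real.rpow_add hx, Real.rpow_one, Real.rpow_def_of_pos hx]
      congr 2; field_simp
    rw [this]
    nlinarith [Real.exp_one_lt_three]
  obtain ⟨r, hr⟩ : ∃ r, r = c / Real.log (T + 4) := ⟨_, rfl⟩
  have hL1 : 1 ≤ Real.log (T + 4) := by
    rw [Real.le_log_iff_exp_le (by positivity)]
    linarith [Real.exp_one_lt_three]
  have hr0 : 0 < r := by rw [hr]; positivity
  have hr8 : r ≤ 1 / 8 := by rw [hr]; exact (div_le_self hc0.le hL1).trans hc8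
  rw [← hr]
  have hsq : Real.sqrt (T + 4) ≤ 3 * T := by
    rw [Real.sqrt_le_iff]; constructor
    · positivity
    · nlinarith
  have hbK : ∀ s : ℂ, |s.im| ≤ T → 1 - r ≤ s.re → s.re ≤ 2 →
      riemannZeta₁ s ≠ 0 ∧ ‖(s - 1) / riemannZeta₁ s‖ ≤ C * (3 * T) := by
    intro s h1 h2 h3
    have := hb T (by linarith) s h1 (hr ▸ h2) h3
    exact ⟨this.1, this.2.trans (by gcongr)⟩
  -- integrand on the line
  have hline : ∀ y : ℝ, ‖((κ : ℂ) + y * Complex.I - 1) / riemannZeta₁ ((κ : ℂ) + y * Complex.I)‖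
      ≤ C1 * Real.log x := by
    intro y
    have hre : ((κ : ℂ) + y * Complex.I).re = κ := by simp
    have hne : ((κ : ℂ) + y * Complex.I) ≠ 1 := by
      intro h; rw [h] at hre; simp at hre; linarith
    rw [norm_inv_zeta1 hne]
    refine (hinv _ (by rw [hre]; exact hκ1) (by rw [hre]; exact hκ2)).trans (le_of_eq ?_)
    rw [hre, hκ]; simp
  have hHb : ∀ y : ℝ, ‖HH x ((κ : ℂ) + y * Complex.I)‖ ≤
      (3 * x * (C1 * Real.log x) * 2) * (1 + y ^ 2)⁻¹ := by
    intro y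
    have h1 := norm_HH hx (s := (κ : ℂ) + y * Complex.I) (by simp; linarith) (hline y)
    have hre : ((κ : ℂ) + y * Complex.I).re = κ := by simp
    have him : ((κ : ℂ) + y * Complex.I).im = y := by simp
    rw [hre, him] at h1
    refine h1.trans ?_
    have : x ^ κ * (C1 * Real.log x) * (2 * (1 + y ^ 2)⁻¹)
      ≤ 3 * x * (C1 * Real.log x) * (2 * (1 + y ^ 2)⁻¹) := by gcongr
    linarith
  have hxc : (x : ℂ) ≠ 0 := by exact_mod_cast hx.ne'
  have hHc : Continuous (fun y : ℝ => HH x ((κ : ℂ) + y * Complex.I)) := by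
    unfold HH
    refine Continuous.mul (Continuous.mul ?_ (Continuous.div (by fun_prop) ?_ ?_)) (kernel_cont (by linarith))
    · exact Continuous.const_cpow (by fun_prop) (Or.inl hxc)
    · exact differentiable_riemannZeta₁.continuous.comp (by fun_prop)
    · intro y; exact zeta1_ne_zero_of_one_le (by simp; linarith)
  have hHi : MeasureTheory.Integrable (fun y : ℝ => HH x ((κ : ℂ) + y * Complex.I)) :=
    MeasureTheory.Integrable.mono' (integrable_inv_one_add_sq.const_mul _)
      hHc.aestronglyMeasurable (Filter.Eventually.of_forall hHb)
  have htail := tail_bound (by positivity) hT hHi hHb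
  -- Perron
  have hper := perron hκ1 hx
  have hcongr : ∀ y : ℝ, (x : ℂ) ^ ((κ : ℂ) + y * Complex.I) *
        (riemannZeta ((κ : ℂ) + y * Complex.I))⁻¹ *
      (1 / (((κ : ℂ) + y * Complex.I) * (((κ : ℂ) + y * Complex.I) + 1)))
      = HH x ((κ : ℂ) + y * Complex.I) := by
    intro y
    have hne : ((κ : ℂ) + y * Complex.I) ≠ 1 := by
      intro h; have := congrArg Complex.re h; simp at this; linarith
    unfold HH
    rw [riemannZeta_eq_inv_sub_mul hne, mul_inv, inv_inv, ← div_eq_mul_inv]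
  simp only [hcongr] at hper
  -- contour
  have hrect := Complex.integral_boundary_rect_eq_zero_of_differentiableOn (HH x)
    (⟨1 - r, -T⟩ : ℂ) (⟨κ, T⟩ : ℂ) (by
      intro s hs
      rw [Complex.mem_reProdIm, Set.uIcc_of_le (by simp; linarith), Set.uIcc_of_le (by simp; linarith)] at hs
      obtain ⟨⟨h1, h2⟩, h3, h4⟩ := hs
      simp only at h1 h2 h3 h4
      have hz := (hbK s (abs_le.2 ⟨h3, h4⟩) h1 (by linarith)).1
      apply DifferentiableAt.differentiableWithinAt
      unfold HH
      have hs0 : s ≠ 0 := by rintro rfl; simp at h1; linarith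
      have hs1 : s + 1 ≠ 0 := by
        intro h; have := congrArg Complex.re h; simp at this; linarith
      refine DifferentiableAt.mul (DifferentiableAt.mul ?_ (DifferentiableAt.div (by fun_prop) ?_ hz))
        (DifferentiableAt.div (by fun_prop) (by fun_prop) (mul_ne_zero hs0 hs1))
      · exact DifferentiableAt.const_cpow differentiableAt_id (Or.inl hxc)
      · exact differentiable_riemannZeta₁ s)
  simp only at hrect
  have hinvT : (1 + T ^ 2)⁻¹ * (3 * T) ≤ 3 / T := by
    rw [inv_mul_eq_div, div_le_div_iff₀ (by positivity) (by positivity)]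
    nlinarith
  have hhor : ∀ t : ℝ, t ^ 2 = T ^ 2 → |t| ≤ T →
      ‖∫ u : ℝ in (1 - r)..κ, HH x ((u : ℂ) + t * Complex.I)‖ ≤ 36 * C * x / T := by
    intro t ht ht'
    have hcst : ∀ u ∈ Set.uIoc (1 - r) κ, ‖HH x ((u : ℂ) + t * Complex.I)‖ ≤ 18 * C * x / T := by
      intro u hu
      rw [Set.uIoc_of_le (by linarith)] at hu
      have hre : ((u : ℂ) + t * Complex.I).re = u := by simp
      have him : ((u : ℂ) + t * Complex.I).im = t := by simp
      have h1 := norm_HH hx (s := (u : ℂ) + t * Complex.I) (by rw [hre]; linarith [hu.1])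
        (hbK _ (by rw [him]; exact ht') (by rw [hre]; exact hu.1.le) (by rw [hre]; linarith [hu.2])).2
      rw [hre, him, ht] at h1
      refine h1.trans ?_
      have h2 : x ^ u ≤ 3 * x := (Real.rpow_le_rpow_of_exponent_le hx1 hu.2).trans hxκ
      calc x ^ u * (C * (3 * T)) * (2 * (1 + T ^ 2)⁻¹)
          = x ^ u * (2 * C) * ((1 + T ^ 2)⁻¹ * (3 * T)) := by ring
        _ ≤ 3 * x * (2 * C) * (3 / T) := by gcongr
        _ = _ := by ring
    refine (intervalIntegral.norm_integral_le_of_norm_le_const hcst).trans ?_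
    have : |κ - (1 - r)| ≤ 2 := by rw [abs_of_nonneg (by linarith)]; linarith
    calc _ ≤ 18 * C * x / T * 2 := by gcongr
      _ = _ := by ring
  have hleft : ‖∫ y : ℝ in (-T)..T, HH x (((1 - r : ℝ) : ℂ) + y * Complex.I)‖
      ≤ 12 * C * x * (T ^ 2 * x ^ (-r)) := by
    have hcst : ∀ y ∈ Set.uIoc (-T) T, ‖HH x (((1 - r : ℝ) : ℂ) + y * Complex.I)‖ ≤
        6 * C * x * (T * x ^ (-r)) := by
      intro y hy
      rw [Set.uIoc_of_le (by linarith)] at hy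
      have hre : (((1 - r : ℝ) : ℂ) + y * Complex.I).re = 1 - r := by simp
      have him : (((1 - r : ℝ) : ℂ) + y * Complex.I).im = y := by simp
      have h1 := norm_HH hx (s := ((1 - r : ℝ) : ℂ) + y * Complex.I) (by rw [hre]; linarith)
        (hbK _ (by rw [him, abs_le]; exact ⟨hy.1.le, hy.2⟩) (by rw [hre])
          (by rw [hre]; linarith)).2
      rw [hre, him] at h1
      refine h1.trans ?_
      have h2 : (1 + y ^ 2)⁻¹ ≤ 1 := inv_le_one_of_one_le₀ (by nlinarith)
      have h3 : x ^ (1 - r) = x * x ^ (-r) := by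
        rw [sub_eq_add_neg, Real.rpow_add hx, Real.rpow_one]
      rw [h3]
      calc _ ≤ x * x ^ (-r) * (C * (3 * T)) * (2 * 1) := by gcongr
        _ = _ := by ring
    refine (intervalIntegral.norm_integral_le_of_norm_le_const hcst).trans (le_of_eq ?_)
    rw [abs_of_nonneg (by linarith)]; ring
  have hbot := hhor (-T) (by ring) (by rw [abs_neg, abs_of_nonneg (by linarith)])
  have htop := hhor T rfl (by rw [abs_of_nonneg (by linarith)])
  have hmid : ‖∫ y : ℝ in (-T)..T, HH x ((κ : ℂ) + y * Complex.I)‖ ≤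
      12 * C * x * (T ^ 2 * x ^ (-r)) + 36 * C * x / T + 36 * C * x / T := by
    generalize (∫ u : ℝ in (1 - r)..κ, HH x ((u : ℂ) + ((-T : ℝ) : ℂ) * Complex.I)) = a1 at *
    generalize (∫ u : ℝ in (1 - r)..κ, HH x ((u : ℂ) + (T : ℂ) * Complex.I)) = a2 at *
    generalize (∫ y : ℝ in (-T)..T, HH x (((1 - r : ℝ) : ℂ) + y * Complex.I)) = a3 at *
    generalize (∫ y : ℝ in (-T)..T, HH x ((κ : ℂ) + y * Complex.I)) = a4 at *
    have e : Complex.I * a4 = Complex.I * a3 - a1 + a2 := by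
      rw [smul_eq_mul, smul_eq_mul] at hrect
      linear_combination hrect
    have e2 : ‖a4‖ = ‖Complex.I * a4‖ := by simp
    rw [e2, e]
    refine (norm_add_le _ _).trans ?_
    refine (add_le_add_left (norm_sub_le _ _) _).trans ?_
    simp only [norm_mul, Complex.norm_I, one_mul]
    linarith
  have hfin : |∑ n ∈ Finset.Icc 1 ⌊x⌋₊, (ArithmeticFunction.moebius n : ℝ) * (1 - n / x)| ≤
      ‖∫ y : ℝ, HH x ((κ : ℂ) + y * Complex.I)‖ := by
    rw [← Real.norm_eq_abs, ← Complex.norm_real, hper, norm_smul]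
    refine mul_le_of_le_one_left (norm_nonneg _) ?_
    rw [Real.norm_of_nonneg (by positivity), div_le_one (by positivity)]
    linarith [Real.two_le_pi]
  have h1T : C * x / T ≤ C * x * (Real.log x / T) := by
    rw [← mul_div_assoc]
    exact div_le_div_of_nonneg_right (le_mul_of_one_le_right (by positivity) hlx) (by linarith)
  have hxr : 0 < x ^ (-r) := Real.rpow_pos_of_pos hx _
  have f1 : 0 ≤ C * x * (T ^ 2 * x ^ (-r)) := by positivity
  have f2 : 0 ≤ C1 * x * (T ^ 2 * x ^ (-r)) := by positivity
  have f3 : 0 ≤ C1 * x * (Real.log x / T) := by positivity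
  have f4 : 0 ≤ C * x * (Real.log x / T) := by positivity
  have g1 : 3 * x * (C1 * Real.log x) * 2 * (2 / T) = 12 * (C1 * x * (Real.log x / T)) := by ring
  have g2 : 36 * C * x / T = 36 * (C * x / T) := by ring
  rw [g1] at htail
  rw [g2] at hmid
  linarith

lemma smooth_bound : ∃ b : ℝ, 0 < b ∧ b ≤ 1 ∧ ∃ C : ℝ, 1 ≤ C ∧ ∀ x : ℝ, 0 < x → 1 ≤ Real.log x →
    |∑ n ∈ Finset.Icc 1 ⌊x⌋₊, (ArithmeticFunction.moebius n : ℝ) * (1 - n / x)| ≤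
      C * x * Real.exp (-b * Real.sqrt (Real.log x)) := by
  obtain ⟨c, hc0, hc8, C, hC, hb⟩ := contour
  obtain ⟨a, ha⟩ : ∃ a, a = c / 12 := ⟨_, rfl⟩
  have ha0 : 0 < a := by rw [ha]; positivity
  refine ⟨a / 2, by positivity, by linarith, C * (8 / a ^ 2 + 1), ?_, ?_⟩
  · have : 0 < 8 / a ^ 2 := by positivity
    nlinarith
  intro x hx hlx
  obtain ⟨u, hu⟩ : ∃ u, u = Real.sqrt (Real.log x) := ⟨_, rfl⟩
  have hu2 : u ^ 2 = Real.log x := by rw [hu, Real.sq_sqrt (by linarith)]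
  have hu1 : 1 ≤ u := by rw [hu]; exact Real.one_le_sqrt.2 hlx
  rw [← hu]
  have hT : 1 ≤ Real.exp (a * u) := Real.one_le_exp (by positivity)
  refine (hb x hx hlx (Real.exp (a * u)) hT).trans ?_
  have hlog : Real.log (Real.exp (a * u) + 4) ≤ 3 * u := by
    have h1 : Real.exp (a * u) + 4 ≤ Real.exp 2 * Real.exp (a * u) := by
      have : 5 ≤ Real.exp 2 := by
        have := Real.exp_one_gt_d9
        have e : Real.exp 2 = Real.exp 1 * Real.exp 1 := by rw [← Real.exp_add]; norm_num
        rw [e]; nlinarith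
      nlinarith
    rw [← Real.exp_add] at h1
    have h2 := Real.log_le_log (by positivity) h1
    rw [Real.log_exp] at h2
    nlinarith
  have hlogpos : 0 < Real.log (Real.exp (a * u) + 4) := Real.log_pos (by linarith)
  have h1 : x ^ (-(c / Real.log (Real.exp (a * u) + 4))) ≤ Real.exp (-(4 * a * u)) := by
    rw [Real.rpow_def_of_pos hx, ← hu2]
    apply Real.exp_le_exp.2
    rw [mul_neg, neg_le_neg_iff, ← mul_div_assoc, le_div_iff₀ hlogpos]
    have : 4 * a * u * Real.log (Real.exp (a * u) + 4) ≤ 4 * a * u * (3 * u) := by gcongr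
    rw [ha] at this ⊢
    nlinarith
  have h2 : Real.exp (a * u) ^ 2 * x ^ (-(c / Real.log (Real.exp (a * u) + 4)))
      ≤ Real.exp (-(a / 2) * u) := by
    calc _ ≤ Real.exp (a * u) ^ 2 * Real.exp (-(4 * a * u)) := by gcongr
      _ = Real.exp (-(2 * a * u)) := by
        rw [← Real.exp_nat_mul, ← Real.exp_add]; congr 1; push_cast; ring
      _ ≤ _ := by apply Real.exp_le_exp.2; nlinarith [mul_pos ha0 (show 0 < u by linarith)]
  have h3 : Real.log x / Real.exp (a * u) ≤ 8 / a ^ 2 * Real.exp (-(a / 2) * u) := by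
    have h4 : (a / 2 * u) ^ 2 / 2 ≤ Real.exp (a / 2 * u) := by
      have := Real.quadratic_le_exp_of_nonneg (show 0 ≤ a / 2 * u by positivity)
      have : 0 ≤ a / 2 * u := by positivity
      linarith
    rw [← hu2, div_le_iff₀ (by positivity), mul_assoc, ← Real.exp_add,
      show -(a / 2) * u + a * u = a / 2 * u by ring, div_mul_eq_mul_div, le_div_iff₀ (by positivity)]
    nlinarith
  have hE := Real.exp_pos (-(a / 2) * u)
  calc _ ≤ C * x * (8 / a ^ 2 * Real.exp (-(a / 2) * u) + Real.exp (-(a / 2) * u)) := by gcongr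
    _ = _ := by ring

lemma abs_moebius_real (n : ℕ) : |(ArithmeticFunction.moebius n : ℝ)| ≤ 1 := by
  have := ArithmeticFunction.abs_moebius_le_one (n := n)
  exact_mod_cast this

lemma desmooth (x h : ℝ) (hx : 0 < x) (hh : 0 < h) :
    h * |∑ n ∈ Finset.Icc 1 ⌊x⌋₊, (ArithmeticFunction.moebius n : ℝ)| ≤
      x * |∑ n ∈ Finset.Icc 1 ⌊x⌋₊, (ArithmeticFunction.moebius n : ℝ) * (1 - n / x)| +
      (x + h) * |∑ n ∈ Finset.Icc 1 ⌊x + h⌋₊,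
        (ArithmeticFunction.moebius n : ℝ) * (1 - n / (x + h))| + h * (h + 1) := by
  have e0 : ∀ z : ℝ, 0 < z →
      z * |∑ n ∈ Finset.Icc 1 ⌊z⌋₊, (ArithmeticFunction.moebius n : ℝ) * (1 - n / z)| =
      |∑ n ∈ Finset.Icc 1 ⌊z⌋₊, (ArithmeticFunction.moebius n : ℝ) * (z - n)| := by
    intro z hz
    rw [← abs_of_pos hz, ← abs_mul, abs_of_pos hz, Finset.mul_sum]
    congr 1
    refine Finset.sum_congr rfl fun n _ => ?_
    field_simp
  rw [e0 x hx, e0 (x + h) (by linarith)]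
  have hle : ⌊x⌋₊ ≤ ⌊x + h⌋₊ := Nat.floor_le_floor (by linarith)
  have hsplit : Finset.Icc 1 ⌊x + h⌋₊ = Finset.Icc 1 ⌊x⌋₊ ∪ Finset.Ioc ⌊x⌋₊ ⌊x + h⌋₊ := by
    ext n; simp only [Finset.mem_union, Finset.mem_Icc, Finset.mem_Ioc]; omega
  have hdisj : Disjoint (Finset.Icc 1 ⌊x⌋₊) (Finset.Ioc ⌊x⌋₊ ⌊x + h⌋₊) := by
    rw [Finset.disjoint_left]; intro n; simp only [Finset.mem_Icc, Finset.mem_Ioc]; omega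
  rw [hsplit, Finset.sum_union hdisj]
  have e1 : ∑ n ∈ Finset.Icc 1 ⌊x⌋₊, (ArithmeticFunction.moebius n : ℝ) * (x + h - n) =
      ∑ n ∈ Finset.Icc 1 ⌊x⌋₊, (ArithmeticFunction.moebius n : ℝ) * (x - n) +
      h * ∑ n ∈ Finset.Icc 1 ⌊x⌋₊, (ArithmeticFunction.moebius n : ℝ) := by
    rw [Finset.mul_sum, ← Finset.sum_add_distrib]
    exact Finset.sum_congr rfl fun n _ => by ring
  rw [e1]
  have e2 : |∑ n ∈ Finset.Ioc ⌊x⌋₊ ⌊x + h⌋₊, (ArithmeticFunction.moebius n : ℝ) * (x + h - n)|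
      ≤ h * (h + 1) := by
    refine (Finset.abs_sum_le_sum_abs _ _).trans ?_
    have : ∀ n ∈ Finset.Ioc ⌊x⌋₊ ⌊x + h⌋₊, |(ArithmeticFunction.moebius n : ℝ) * (x + h - n)| ≤ h := by
      intro n hn
      rw [Finset.mem_Ioc] at hn
      have h1 : x < n := (Nat.floor_lt hx.le).1 hn.1
      have h2 : (n : ℝ) ≤ x + h := (Nat.le_floor_iff (by linarith)).1 hn.2
      rw [abs_mul, abs_of_nonneg (show 0 ≤ x + h - n by linarith)]
      calc _ ≤ 1 * (x + h - n) := by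
            have := abs_moebius_real n
            gcongr
        _ ≤ h := by linarith
    refine (Finset.sum_le_card_nsmul _ _ _ this).trans ?_
    rw [Nat.card_Ioc, nsmul_eq_mul, Nat.cast_sub hle, mul_comm]
    have h1 := Nat.floor_le (show 0 ≤ x + h by linarith)
    have h2 := Nat.lt_floor_add_one x
    gcongr
    linarith
  generalize (∑ n ∈ Finset.Icc 1 ⌊x⌋₊, (ArithmeticFunction.moebius n : ℝ) * (x - n)) = A
  generalize (∑ n ∈ Finset.Icc 1 ⌊x⌋₊, (ArithmeticFunction.moebius n : ℝ)) = M
  generalize (∑ n ∈ Finset.Ioc ⌊x⌋₊ ⌊x + h⌋₊, (ArithmeticFunction.moebius n : ℝ) * (x + h - n)) = B at *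
  have e3 : h * M = (A + h * M + B) - A - B := by ring
  have e4 : h * |M| = |(A + h * M + B) - A - B| := by rw [← e3, abs_mul, abs_of_pos hh]
  rw [e4]
  have t1 := abs_sub (A + h * M + B) A
  have t2 := abs_sub (A + h * M + B - A) B
  linarith

lemma abs_mertens_le (x : ℝ) (hx : 0 ≤ x) :
    |∑ n ∈ Finset.Icc 1 ⌊x⌋₊, (ArithmeticFunction.moebius n : ℝ)| ≤ x := by
  refine (Finset.abs_sum_le_sum_abs _ _).trans ?_
  refine (Finset.sum_le_card_nsmul _ _ 1 fun n _ => abs_moebius_real n).trans ?_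
  simp
  exact Nat.floor_le hx

lemma mertens_bound : ∃ b : ℝ, 0 < b ∧ b ≤ 1 ∧ ∃ C : ℝ, 1 ≤ C ∧ ∀ x : ℝ, 1 ≤ x →
    |∑ n ∈ Finset.Icc 1 ⌊x⌋₊, (ArithmeticFunction.moebius n : ℝ)| ≤
      C * x * Real.exp (-b * Real.sqrt (Real.log x)) := by
  obtain ⟨b, hb0, hb1, C, hC, hb⟩ := smooth_bound
  refine ⟨b / 2, by positivity, by linarith, 5 * C + 3, by linarith, ?_⟩
  intro x hx
  have hx0 : 0 < x := by linarith
  obtain ⟨u, hu⟩ : ∃ u, u = Real.sqrt (Real.log x) := ⟨_, rfl⟩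
  have hlx0 : 0 ≤ Real.log x := Real.log_nonneg hx
  have hu2 : u ^ 2 = Real.log x := by rw [hu, Real.sq_sqrt hlx0]
  have hu0 : 0 ≤ u := by rw [hu]; positivity
  rw [← hu]
  have hE := Real.exp_pos (-(b / 2) * u)
  rcases lt_or_ge (Real.log x) 1 with hl | hl
  · refine (abs_mertens_le x hx0.le).trans ?_
    have hu1 : u ≤ 1 := by nlinarith
    have : 1 ≤ 3 * Real.exp (-(b / 2) * u) := by
      have h1 : Real.exp (-1) ≤ Real.exp (-(b / 2) * u) := by
        apply Real.exp_le_exp.2; nlinarith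
      have h2 : Real.exp (-1) * Real.exp 1 = 1 := by rw [← Real.exp_add]; norm_num
      have h3 := Real.exp_one_lt_three
      nlinarith [Real.exp_pos (-1)]
    calc x ≤ x * (3 * Real.exp (-(b / 2) * u)) := le_mul_of_one_le_right hx0.le this
      _ ≤ _ := by nlinarith [mul_pos hx0 hE, mul_pos (mul_pos hx0 hE) (show 0 < C by linarith)]
  have hu1 : 1 ≤ u := by rw [hu]; exact Real.one_le_sqrt.2 hl
  obtain ⟨E, hEd⟩ : ∃ E, E = Real.exp (-(b / 2) * u) := ⟨_, rfl⟩
  rw [← hEd] at hE ⊢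
  have hE2 : Real.exp (-b * u) = E * E := by
    rw [hEd, ← Real.exp_add]; congr 1; ring
  have hE1 : E ≤ 1 := by
    rw [hEd]; apply Real.exp_le_one_iff.2; nlinarith
  have hxE : 1 ≤ x * E := by
    have hxe : x = Real.exp (u ^ 2) := by rw [hu2, Real.exp_log hx0]
    rw [hEd, hxe, ← Real.exp_add]
    apply Real.one_le_exp; nlinarith
  have hh : 0 < x * E := by positivity
  have h1 := desmooth x (x * E) hx0 hh
  have h2 := hb x hx0 hl
  have hlx' : Real.log x ≤ Real.log (x + x * E) := Real.log_le_log hx0 (by linarith)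
  have h3 := hb (x + x * E) (by linarith) (hl.trans hlx')
  rw [← hu, hE2] at h2
  have h4 : Real.exp (-b * Real.sqrt (Real.log (x + x * E))) ≤ E * E := by
    rw [← hE2, hu]
    apply Real.exp_le_exp.2
    have := Real.sqrt_le_sqrt hlx'
    nlinarith
  have h5 : x + x * E ≤ 2 * x := by nlinarith
  have h6 : (x + x * E) * |∑ n ∈ Finset.Icc 1 ⌊x + x * E⌋₊,
        (ArithmeticFunction.moebius n : ℝ) * (1 - n / (x + x * E))| ≤ 4 * (C * x ^ 2 * (E * E)) := by
    calc _ ≤ (2 * x) * (C * (2 * x) * (E * E)) := by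
          gcongr
          refine h3.trans ?_
          gcongr
      _ = _ := by ring
  have h7 : x * |∑ n ∈ Finset.Icc 1 ⌊x⌋₊, (ArithmeticFunction.moebius n : ℝ) * (1 - n / x)|
      ≤ C * x ^ 2 * (E * E) := by
    calc _ ≤ x * (C * x * (E * E)) := by gcongr
      _ = _ := by ring
  have h8 : x * E * |∑ n ∈ Finset.Icc 1 ⌊x⌋₊, (ArithmeticFunction.moebius n : ℝ)| ≤
      x * E * ((5 * C + 3) * x * E) := by
    refine h1.trans ?_
    have : x * E * (x * E + 1) ≤ x * E * (x * E + x * E) := by gcongr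
    have : 0 < x * E * (x * E) := by positivity
    nlinarith
  exact le_of_mul_le_mul_left h8 hh

noncomputable def roughF (y : ℝ) : ArithmeticFunction ℝ :=
  ⟨fun n => if n = 0 then 0 else if ∀ p : ℕ, p.Prime → p ∣ n → y < (p : ℝ) then 1 else 0, by simp⟩

noncomputable def smoothF (y : ℝ) : ArithmeticFunction ℝ :=
  ⟨fun n => if n = 0 then 0 else if ∀ p : ℕ, p.Prime → p ∣ n → (p : ℝ) ≤ y then 1 else 0, by simp⟩

lemma roughF_apply (y : ℝ) (n : ℕ) : roughF y n =
    if n = 0 then 0 else if ∀ p : ℕ, p.Prime → p ∣ n → y < (p : ℝ) then 1 else 0 := rfl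

lemma smoothF_apply (y : ℝ) (n : ℕ) : smoothF y n =
    if n = 0 then 0 else if ∀ p : ℕ, p.Prime → p ∣ n → (p : ℝ) ≤ y then 1 else 0 := rfl

lemma forall_prime_dvd_mul (P : ℕ → Prop) (m n : ℕ) :
    (∀ p : ℕ, p.Prime → p ∣ m * n → P p) ↔
      (∀ p : ℕ, p.Prime → p ∣ m → P p) ∧ (∀ p : ℕ, p.Prime → p ∣ n → P p) := by
  constructor
  · intro h
    exact ⟨fun p hp hd => h p hp (hd.mul_right n), fun p hp hd => h p hp (hd.mul_left m)⟩
  · rintro ⟨h1, h2⟩ p hp hd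
    rcases (Nat.Prime.dvd_mul hp).1 hd with h | h
    · exact h1 p hp h
    · exact h2 p hp h

lemma forall_prime_dvd_pow (P : ℕ → Prop) {p k : ℕ} (hp : p.Prime) (hk : k ≠ 0) :
    (∀ q : ℕ, q.Prime → q ∣ p ^ k → P q) ↔ P p := by
  constructor
  · intro h; exact h p hp (dvd_pow_self p hk)
  · intro h q hq hd
    have := (Nat.prime_dvd_prime_iff_eq hq hp).1 (hq.dvd_of_dvd_pow hd)
    rwa [this]

lemma forall_prime_dvd_one (P : ℕ → Prop) : (∀ q : ℕ, q.Prime → q ∣ 1 → P q) := by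
  intro q hq hd
  exact absurd (Nat.dvd_one.1 hd) hq.one_lt.ne'

lemma roughF_mult (y : ℝ) : (roughF y).IsMultiplicative := by
  refine ⟨?_, fun {m n} _ => ?_⟩
  · rw [roughF_apply, if_neg one_ne_zero, if_pos (forall_prime_dvd_one _)]
  · rw [roughF_apply, roughF_apply, roughF_apply, forall_prime_dvd_mul]
    rcases eq_or_ne m 0 with h1 | h1
    · simp [h1]
    rcases eq_or_ne n 0 with h2 | h2
    · simp [h2]
    rw [if_neg h1, if_neg h2, if_neg (mul_ne_zero h1 h2)]
    by_cases hA : ∀ p : ℕ, p.Prime → p ∣ m → y < (p : ℝ)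
    · by_cases hB : ∀ p : ℕ, p.Prime → p ∣ n → y < (p : ℝ)
      · rw [if_pos hA, if_pos hB, if_pos ⟨hA, hB⟩, one_mul]
      · rw [if_neg hB, if_neg (fun h => hB h.2), mul_zero]
    · rw [if_neg hA, if_neg (fun h => hA h.1), zero_mul]

lemma smoothF_mult (y : ℝ) : (smoothF y).IsMultiplicative := by
  refine ⟨?_, fun {m n} _ => ?_⟩
  · rw [smoothF_apply, if_neg one_ne_zero, if_pos (forall_prime_dvd_one (fun q => (q : ℝ) ≤ y))]
  · rw [smoothF_apply, smoothF_apply, smoothF_apply, forall_prime_dvd_mul (fun q => (q : ℝ) ≤ y)]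
    rcases eq_or_ne m 0 with h1 | h1
    · simp [h1]
    rcases eq_or_ne n 0 with h2 | h2
    · simp [h2]
    rw [if_neg h1, if_neg h2, if_neg (mul_ne_zero h1 h2)]
    by_cases hA : ∀ p : ℕ, p.Prime → p ∣ m → (p : ℝ) ≤ y
    · by_cases hB : ∀ p : ℕ, p.Prime → p ∣ n → (p : ℝ) ≤ y
      · rw [if_pos hA, if_pos hB, if_pos ⟨hA, hB⟩, one_mul]
      · rw [if_neg hB, if_neg (fun h => hB h.2), mul_zero]
    · rw [if_neg hA, if_neg (fun h => hA h.1), zero_mul]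

open ArithmeticFunction in
lemma rough_conv (y : ℝ) :
    ((moebius : ArithmeticFunction ℝ).pmul (roughF y)) = smoothF y * (moebius : ArithmeticFunction ℝ) := by
  have hμ : (moebius : ArithmeticFunction ℝ).IsMultiplicative := isMultiplicative_moebius.intCast
  have hζ : (zeta : ArithmeticFunction ℝ).IsMultiplicative := isMultiplicative_zeta.natCast
  have h : (zeta : ArithmeticFunction ℝ) * ((moebius : ArithmeticFunction ℝ).pmul (roughF y)) = smoothF y := by
    rw [IsMultiplicative.eq_iff_eq_on_prime_powers _ (hζ.mul (hμ.pmul (roughF_mult y))) _ (smoothF_mult y)]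
    intro p k hp
    rcases eq_or_ne k 0 with rfl | hk
    · rw [pow_zero, (smoothF_mult y).map_one, (hζ.mul (hμ.pmul (roughF_mult y))).map_one]
    rw [coe_zeta_mul_apply, Nat.sum_divisors_prime_pow hp]
    obtain ⟨j, rfl⟩ := Nat.exists_eq_succ_of_ne_zero hk
    rw [Finset.sum_range_succ', Finset.sum_range_succ']
    rw [Finset.sum_eq_zero]
    · rw [pow_zero, (hμ.pmul (roughF_mult y)).map_one, pmul_apply, intCoe_apply, zero_add, pow_one,
        moebius_apply_prime hp, roughF_apply, smoothF_apply, if_neg hp.ne_zero,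
        if_neg (pow_ne_zero _ hp.ne_zero), forall_prime_dvd_pow (fun q => (q : ℝ) ≤ y) hp hk]
      have := forall_prime_dvd_pow (fun q => y < (q : ℝ)) hp one_ne_zero
      rw [pow_one] at this
      rw [this]
      by_cases hy : y < p
      · rw [if_pos hy, if_neg (not_le.2 hy)]; norm_num
      · rw [if_neg hy, if_pos (not_lt.1 hy)]; norm_num
    · intro i _
      rw [pmul_apply, intCoe_apply, moebius_apply_prime_pow hp (by omega), if_neg (by omega)]
      simp
  rw [← h, mul_comm (zeta : ArithmeticFunction ℝ), mul_assoc, coe_zeta_mul_coe_moebius, mul_one]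

open ArithmeticFunction in
lemma rough_sum (x y : ℝ) (hx : 1 ≤ x) :
    ∑ n ∈ Finset.Icc 1 ⌊x⌋₊,
          (if ∀ p : ℕ, p.Prime → p ∣ n → y < (p : ℝ) then (moebius n : ℝ) else 0) =
    ∑ d ∈ Finset.Icc 1 ⌊x⌋₊, smoothF y d * ∑ n ∈ Finset.Icc 1 ⌊x / d⌋₊, (moebius n : ℝ) := by
  have h := sum_Ioc_mul_eq_sum_sum (smoothF y) (moebius : ArithmeticFunction ℝ) ⌊x⌋₊
  rw [← rough_conv] at h
  have e : ∀ N, Finset.Ioc 0 N = Finset.Icc 1 N := by intro N; ext n; simp; omega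
  simp only [e] at h
  have h1 : ∑ n ∈ Finset.Icc 1 ⌊x⌋₊,
          (if ∀ p : ℕ, p.Prime → p ∣ n → y < (p : ℝ) then (moebius n : ℝ) else 0) =
      ∑ n ∈ Finset.Icc 1 ⌊x⌋₊, ((moebius : ArithmeticFunction ℝ).pmul (roughF y)) n := by
    refine Finset.sum_congr rfl fun n hn => ?_
    rw [Finset.mem_Icc] at hn
    rw [pmul_apply, intCoe_apply, roughF_apply, if_neg (show ¬ n = 0 by omega)]
    split_ifs <;> simp
  rw [h1, h]
  refine Finset.sum_congr rfl fun n _ => ?_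
  rw [Nat.floor_div_natCast]
  simp only [intCoe_apply]

noncomputable def sqrtInv : ℕ →* ℝ where
  toFun n := (Real.sqrt n)⁻¹
  map_one' := by simp
  map_mul' m n := by
    push_cast
    rw [Real.sqrt_mul (by positivity), mul_inv]

lemma sqrtInv_apply (n : ℕ) : sqrtInv n = (Real.sqrt n)⁻¹ := rfl

lemma euler_factor {p : ℕ} (hp : p.Prime) :
    (1 - sqrtInv p)⁻¹ ≤ Real.exp 1 * (if p = 2 then 4 else 1) := by
  rw [sqrtInv_apply]
  have he := Real.exp_one_gt_d9
  split_ifs with h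
  · subst h
    have h1 : (1.4 : ℝ) ≤ Real.sqrt (2 : ℕ) := by
      apply Real.le_sqrt_of_sq_le; norm_num
    have h2 : (Real.sqrt (2 : ℕ))⁻¹ ≤ (1.4 : ℝ)⁻¹ := by gcongr
    have h3 : (1 / 4 : ℝ) ≤ 1 - (Real.sqrt (2 : ℕ))⁻¹ := by
      have : (1.4 : ℝ)⁻¹ ≤ 3 / 4 := by norm_num
      linarith
    calc _ ≤ (1 / 4 : ℝ)⁻¹ := by gcongr
      _ ≤ _ := by norm_num
  · have hp3 : 3 ≤ p := by have := hp.two_le; omega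
    have hp3' : (3 : ℝ) ≤ p := by exact_mod_cast hp3
    have h1 : (1.7 : ℝ) ≤ Real.sqrt p := by
      apply Real.le_sqrt_of_sq_le; norm_num; linarith
    have h2 : (Real.sqrt p)⁻¹ ≤ (1.7 : ℝ)⁻¹ := by gcongr
    have h3 : (0.4 : ℝ) ≤ 1 - (Real.sqrt p)⁻¹ := by
      have : (1.7 : ℝ)⁻¹ ≤ 0.6 := by norm_num
      linarith
    calc _ ≤ (0.4 : ℝ)⁻¹ := by gcongr
      _ ≤ _ := by norm_num; linarith

lemma sqrtInv_lt_one {p : ℕ} (hp : p.Prime) : sqrtInv p < 1 := by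
  rw [sqrtInv_apply]
  apply inv_lt_one_of_one_lt₀
  rw [Real.lt_sqrt (by norm_num)]
  have : (2 : ℝ) ≤ p := by exact_mod_cast hp.two_le
  linarith

lemma smooth_sum (y : ℝ) (hy : 1 ≤ y) (N : ℕ) :
    ∑ d ∈ Finset.Icc 1 N, smoothF y d * (Real.sqrt d)⁻¹ ≤ 4 * Real.exp y := by
  have hnn : ∀ n, 0 ≤ sqrtInv n := fun n => by rw [sqrtInv_apply]; positivity
  have h := (EulerProduct.summable_and_hasSum_smoothNumbers_prod_primesBelow_geometric
    (f := sqrtInv) (fun {p} hp => by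
      rw [Real.norm_of_nonneg (hnn p)]; exact sqrtInv_lt_one hp) (⌊y⌋₊ + 1)).2
  have h' : HasSum ((Nat.smoothNumbers (⌊y⌋₊ + 1)).indicator sqrtInv)
      (∏ p ∈ (⌊y⌋₊ + 1).primesBelow, (1 - sqrtInv p)⁻¹) := hasSum_subtype_iff_indicator.1 h
  have h1 : ∑ d ∈ Finset.Icc 1 N, smoothF y d * (Real.sqrt d)⁻¹ =
      ∑ d ∈ Finset.Icc 1 N, (Nat.smoothNumbers (⌊y⌋₊ + 1)).indicator sqrtInv d := by
    refine Finset.sum_congr rfl fun d hd => ?_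
    rw [Finset.mem_Icc] at hd
    have hiff : d ∈ Nat.smoothNumbers (⌊y⌋₊ + 1) ↔ (∀ p : ℕ, p.Prime → p ∣ d → (p : ℝ) ≤ y) := by
      refine Nat.mem_smoothNumbers'.trans ?_
      refine forall_congr' fun p => forall_congr' fun _ => forall_congr' fun _ => ?_
      rw [Nat.lt_succ_iff, Nat.le_floor_iff (by linarith)]
    rw [smoothF_apply, if_neg (show ¬ d = 0 by omega)]
    by_cases hs : d ∈ Nat.smoothNumbers (⌊y⌋₊ + 1)
    · rw [Set.indicator_of_mem hs, if_pos (hiff.1 hs), sqrtInv_apply, one_mul]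
    · rw [Set.indicator_of_notMem hs, if_neg (fun h => hs (hiff.2 h)), zero_mul]
  rw [h1]
  refine (sum_le_hasSum _ (fun n _ => Set.indicator_nonneg (fun n _ => hnn n) n) h').trans ?_
  have h2 : ∏ p ∈ (⌊y⌋₊ + 1).primesBelow, (1 - sqrtInv p)⁻¹ ≤
      ∏ p ∈ (⌊y⌋₊ + 1).primesBelow, (Real.exp 1 * (if p = 2 then 4 else 1)) := by
    refine Finset.prod_le_prod (fun p hp => ?_) (fun p hp => euler_factor (Nat.prime_of_mem_primesBelow hp))
    have := sqrtInv_lt_one (Nat.prime_of_mem_primesBelow hp)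
    rw [inv_nonneg]; linarith
  refine h2.trans ?_
  rw [Finset.prod_mul_distrib, Finset.prod_const, Finset.prod_ite_eq', ← Real.exp_nat_mul, mul_one, mul_comm]
  have hcard : (((⌊y⌋₊ + 1).primesBelow).card : ℝ) ≤ y := by
    have : ((⌊y⌋₊ + 1).primesBelow).card ≤ (Finset.Icc 1 ⌊y⌋₊).card := by
      apply Finset.card_le_card
      intro p hp
      have h3 := Nat.lt_of_mem_primesBelow hp
      have h4 := (Nat.prime_of_mem_primesBelow hp).one_lt
      rw [Finset.mem_Icc]; omega
    rw [Nat.card_Icc, Nat.add_sub_cancel] at this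
    exact (Nat.cast_le.2 this).trans (Nat.floor_le (by linarith))
  gcongr
  split_ifs <;> norm_num

lemma key_exp {b l v : ℝ} (hb : 0 < b) (hb1 : b ≤ 1) (hv : 0 ≤ v) (hvl : v ≤ l) :
    -b * Real.sqrt (l - v) ≤ 1 - b * Real.sqrt l + v / 2 := by
  have h1 : Real.sqrt l ≤ Real.sqrt (l - v) + Real.sqrt v := by
    rw [Real.sqrt_le_iff]
    constructor
    · positivity
    · have e1 := Real.sq_sqrt (show 0 ≤ l - v by linarith)
      have e2 := Real.sq_sqrt hv
      nlinarith [Real.sqrt_nonneg (l - v), Real.sqrt_nonneg v,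
        mul_nonneg (Real.sqrt_nonneg (l - v)) (Real.sqrt_nonneg v)]
  have e2 := Real.sq_sqrt hv
  have h2 : b * Real.sqrt v ≤ 1 + v / 2 := by
    nlinarith [sq_nonneg (Real.sqrt v - b), Real.sqrt_nonneg v]
  nlinarith

/-- The Möbius sum over integers `n ≤ x` all of whose prime factors exceed `y` satisfies
`M(x,y) ≪ x·exp(−c√(log x) + y)` uniformly for `x, y ≥ 1` (with `n = 1` included). -/
theorem moebius_sum_min_prime_bound :
    ∃ c : ℝ, 0 < c ∧ ∃ C : ℝ, 0 < C ∧ ∀ x y : ℝ, 1 ≤ x → 1 ≤ y →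
      |∑ n ∈ Finset.Icc 1 ⌊x⌋₊,
          (if ∀ p : ℕ, p.Prime → p ∣ n → y < (p : ℝ) then
            (ArithmeticFunction.moebius n : ℝ) else 0)|
        ≤ C * x * Real.exp (-c * Real.sqrt (Real.log x) + y) := by
  obtain ⟨b, hb0, hb1, C, hC, hb⟩ := mertens_bound
  refine ⟨b, hb0, C * Real.exp 1 * 4, by positivity, ?_⟩
  intro x y hx hy
  have hx0 : 0 < x := by linarith
  rw [rough_sum x y hx]
  refine (Finset.abs_sum_le_sum_abs _ _).trans ?_
  have hterm : ∀ d ∈ Finset.Icc 1 ⌊x⌋₊,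
      |smoothF y d * ∑ n ∈ Finset.Icc 1 ⌊x / d⌋₊, (ArithmeticFunction.moebius n : ℝ)| ≤
      (C * x * Real.exp (1 - b * Real.sqrt (Real.log x))) * (smoothF y d * (Real.sqrt d)⁻¹) := by
    intro d hd
    rw [Finset.mem_Icc] at hd
    have hd1 : (1 : ℝ) ≤ d := by exact_mod_cast hd.1
    have hd0 : (0 : ℝ) < d := by linarith
    have hdx : (d : ℝ) ≤ x := (Nat.le_floor_iff hx0.le).1 hd.2
    have hs : 0 ≤ smoothF y d := by
      rw [smoothF_apply]; split_ifs <;> norm_num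
    have h1 := hb (x / d) (by rw [le_div_iff₀ hd0]; linarith)
    rw [Real.log_div hx0.ne' hd0.ne'] at h1
    have h2 := key_exp hb0 hb1 (Real.log_nonneg hd1) (Real.log_le_log hd0 hdx)
    have h3 : Real.exp (Real.log d / 2) = Real.sqrt d := by
      rw [Real.sqrt_eq_rpow, Real.rpow_def_of_pos hd0]; congr 1; ring
    have h4 : Real.exp (-b * Real.sqrt (Real.log x - Real.log d)) ≤
        Real.exp (1 - b * Real.sqrt (Real.log x)) * Real.sqrt d := by
      rw [← h3, ← Real.exp_add]; exact Real.exp_le_exp.2 h2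
    rw [abs_mul, abs_of_nonneg hs]
    calc _ ≤ smoothF y d * (C * (x / d) * (Real.exp (1 - b * Real.sqrt (Real.log x)) * Real.sqrt d)) := by
          gcongr
          exact h1.trans (by gcongr)
      _ = (C * x * Real.exp (1 - b * Real.sqrt (Real.log x))) * (smoothF y d * (Real.sqrt d / d)) := by ring
      _ = _ := by rw [Real.sqrt_div_self]
  refine (Finset.sum_le_sum hterm).trans ?_
  rw [← Finset.mul_sum]
  calc _ ≤ (C * x * Real.exp (1 - b * Real.sqrt (Real.log x))) * (4 * Real.exp y) := by
        have := smooth_sum y hy ⌊x⌋₊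
        gcongr
    _ = _ := by
      rw [show 1 - b * Real.sqrt (Real.log x) = 1 + -b * Real.sqrt (Real.log x) by ring,
        Real.exp_add, Real.exp_add]
      ring
end

section
/- Let G be an additive arithmetical semigroup satisfying Axiom A^# with parameter q > 1, and suppose S ⊆ P is a set of primes with natural density δ(S) (i.e. π^#_{G,S}(n)/π^#_G(n) → δ(S)). Let Q_S(g) be the number of prime factors of g that lie in S and have degree equal to d⁺(g), the maximal degree among prime factors of g. Then ∑_{∂(g) = n} Q_S(g) = c_G δ(S) q^n + o(q^n). -/
open scoped Classical
open Finset Filter Finsupp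

noncomputable def degG {P : Type*} (deg : P → ℕ) (g : P →₀ ℕ) : ℕ :=
  g.sum fun p k => k * deg p

/-- The maximal degree `d⁺(g)` among prime summands of `g` (with `d⁺(0) = 0`). -/
noncomputable def dmaxG {P : Type*} (deg : P → ℕ) (g : P →₀ ℕ) : ℕ :=
  g.support.sup deg

/-- `Q_S(g)`: the number of prime factors of `g` lying in `S` of degree `d⁺(g)`. -/
noncomputable def QS {P : Type*} (deg : P → ℕ) (S : Set P) (g : P →₀ ℕ) : ℕ :=
  (g.support.filter fun p => p ∈ S ∧ deg p = dmaxG deg g).card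

/-- Power series expansion, with bounded coefficients, of `w H'/H` when `H` has no zeros in the open
unit disc. -/
theorem logDeriv_bdd_coeff (N : ℕ) : ∀ H : ℂ → ℂ, AnalyticOnNhd ℂ H (Metric.closedBall 0 1) →
    ∀ Zs : Finset ℂ, Zs.card = N → (∀ w ∈ Metric.closedBall (0 : ℂ) 1, H w = 0 ↔ w ∈ Zs) →
    (∀ w ∈ Zs, ‖w‖ = 1) →
    ∃ c : ℕ → ℂ, ∃ M : ℝ, (∀ n, ‖c n‖ ≤ M) ∧
      ∀ w ∈ Metric.ball (0 : ℂ) 1, HasSum (fun n => c n * w ^ n) (w * deriv H w / H w) := by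
  induction N with
  | zero =>
    intro H hH Zs hZ hz _
    have hZ' : Zs = ∅ := Finset.card_eq_zero.mp hZ
    subst hZ'
    have hne : ∀ w ∈ Metric.closedBall (0 : ℂ) 1, H w ≠ 0 := fun w hw h => by
      simpa using (hz w hw).1 h
    set f : ℂ → ℂ := fun w => w * deriv H w / H w with hf
    have hfan : AnalyticOnNhd ℂ f (Metric.closedBall 0 1) := by
      intro w hw
      exact (analyticAt_id.mul (hH w hw).deriv).div (hH w hw) (hne w hw)
    have hd : DiffContOnCl ℂ f (Metric.ball 0 ((1 : NNReal) : ℝ)) := by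
      apply DifferentiableOn.diffContOnCl
      rw [closure_ball _ (by simp)]
      simpa using hfan.differentiableOn
    have hp := hd.hasFPowerSeriesOnBall one_pos
    refine ⟨fun n => (cauchyPowerSeries f 0 ((1 : NNReal) : ℝ)).coeff n,
      ((2 * Real.pi)⁻¹ * ∫ (θ : ℝ) in 0..2 * Real.pi, ‖f (circleMap 0 ((1 : NNReal) : ℝ) θ)‖), fun n => ?_,
      fun w hw => ?_⟩
    · rw [← FormalMultilinearSeries.norm_apply_eq_norm_coef]
      refine (norm_cauchyPowerSeries_le f 0 _ n).trans ?_
      simp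
    · have := hp.hasSum (y := w) (by simpa [Metric.mem_eball, edist_eq_enorm_sub, enorm_eq_nnnorm, ← NNReal.coe_lt_coe] using hw)
      simpa [FormalMultilinearSeries.apply_eq_pow_smul_coeff, mul_comm] using this
  | succ N ih =>
    intro H hH Zs hZ hz h1
    obtain ⟨α, hα⟩ : Zs.Nonempty := Finset.card_pos.mp (by omega)
    have hα1 := h1 α hα
    have hαb : α ∈ Metric.closedBall (0 : ℂ) 1 := by simp [hα1]
    have hα0 : α ≠ 0 := by rintro rfl; simp at hα1
    have hnz : ¬ ∀ᶠ z in nhds α, H z = 0 := by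
      intro hev
      have h0 := hH.eqOn_zero_of_preconnected_of_eventuallyEq_zero
        (convex_closedBall (0 : ℂ) 1).isPreconnected hαb hev
      have := h1 0 ((hz 0 (by simp)).1 (h0 (by simp)))
      simp at this
    obtain ⟨m, g, hg, hg0, hge⟩ :=
      (AnalyticAt.exists_eventuallyEq_pow_smul_nonzero_iff (hH α hαb)).2 hnz
    set H1 : ℂ → ℂ := Function.update (fun z => H z / (z - α) ^ m) α (g α) with hH1
    have e1 : ∀ w, w ≠ α → H1 w = H w / (w - α) ^ m := fun w hw => by
      simp [hH1, Function.update_of_ne hw]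
    have e2 : H1 α = g α := by simp [hH1]
    have e3 : ∀ w, w ≠ α → ∀ᶠ z in nhds w, H1 z = H z / (z - α) ^ m := fun w hw => by
      filter_upwards [isOpen_ne.mem_nhds hw] with z hz using e1 z hz
    have han1 : AnalyticOnNhd ℂ H1 (Metric.closedBall 0 1) := by
      intro w hw
      by_cases h : w = α
      · subst h
        refine hg.congr ?_
        filter_upwards [hge] with z hz
        by_cases hzα : z = w
        · subst hzα; exact e2.symm
        · rw [e1 z hzα, hz, smul_eq_mul, mul_div_cancel_left₀]
          exact pow_ne_zero _ (sub_ne_zero.2 hzα)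
      · refine AnalyticAt.congr ?_ ((e3 w h).mono fun z hz => hz.symm)
        exact (hH w hw).div ((analyticAt_id.sub analyticAt_const).pow m)
          (pow_ne_zero _ (sub_ne_zero.2 h))
    obtain ⟨c, M, hM, hc⟩ := ih H1 han1 (Zs.erase α) (by rw [Finset.card_erase_of_mem hα]; omega)
      (by
        intro w hw
        by_cases h : w = α
        · subst h; simp [e2, hg0]
        · rw [e1 w h, Finset.mem_erase, ← hz w hw]
          simp [h, sub_ne_zero.2 h])
      (fun w hw => h1 w (Finset.mem_of_mem_erase hw))
    refine ⟨fun n => c n - m * (if n = 0 then 0 else (α⁻¹) ^ n), M + m, fun n => ?_, fun w hw => ?_⟩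
    · refine (norm_sub_le _ _).trans (add_le_add (hM n) ?_)
      split_ifs
      · simp
      · simp [hα1]
    · have hw1 : ‖w‖ < 1 := by simpa using hw
      have hwα : w ≠ α := by rintro rfl; linarith
      have hwc : w ∈ Metric.closedBall (0 : ℂ) 1 := Metric.ball_subset_closedBall hw
      have hHw : H w ≠ 0 := fun h => by
        have := h1 w ((hz w hwc).1 h); linarith
      have hs : w - α ≠ 0 := sub_ne_zero.2 hwα
      have hgeo : HasSum (fun n : ℕ => (if n = 0 then 0 else (α⁻¹) ^ n) * w ^ n) ((1 - α⁻¹ * w)⁻¹ - 1) := by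
        have hh := hasSum_geometric_of_norm_lt_one (ξ := α⁻¹ * w) (by simp [hα1, hw1])
        have h2 := hh.sub (hasSum_ite_eq (0 : ℕ) (1 : ℂ))
        refine h2.congr_fun ?_
        intro n
        by_cases hn : n = 0
        · simp [hn]
        · simp [hn, mul_pow]
      have hd1 : deriv H1 w = (deriv H w * (w - α) ^ m - H w * (m * (w - α) ^ (m - 1))) / ((w - α) ^ m) ^ 2 := by
        rw [Filter.EventuallyEq.deriv_eq (e3 w hwα)]
        have a1 : HasDerivAt H (deriv H w) w := (hH w hwc).differentiableAt.hasDerivAt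
        have a2 : HasDerivAt (fun z : ℂ => (z - α) ^ m) (m * (w - α) ^ (m - 1)) w := by
          have a3 := (hasDerivAt_pow m (w - α)).comp w ((hasDerivAt_id w).sub_const α)
          rw [mul_one] at a3
          exact a3
        exact (a1.div a2 (pow_ne_zero _ hs)).deriv
      have key : w * deriv H w / H w = w * deriv H1 w / H1 w - m * ((1 - α⁻¹ * w)⁻¹ - 1) := by
        have e4 : (1 - α⁻¹ * w)⁻¹ - 1 = - (w / (w - α)) := by
          have : α - w ≠ 0 := sub_ne_zero.2 (Ne.symm hwα)
          have h5 : 1 - α⁻¹ * w ≠ 0 := by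
            intro h; apply this; field_simp at h; simpa using h
          field_simp
          ring
        rw [e4, hd1, e1 w hwα]
        rcases m with _ | m
        · simp
        · simp only [Nat.add_sub_cancel]
          field_simp
          ring
      rw [key]
      have := (hc w hw).sub (hgeo.mul_left (m : ℂ))
      refine this.congr_fun fun n => ?_
      ring

theorem bdd_of_conv (h c : ℕ → ℝ) (C θ B : ℝ) (hθ0 : 0 < θ) (hθ1 : θ < 1)
    (hh : ∀ n, |h n| ≤ C * θ ^ n) (hh0 : h 0 = 1) (hc : ∀ n, |c n| ≤ B * n)
    (hrec : ∀ n : ℕ, n * h n = ∑ kl ∈ antidiagonal n, h kl.1 * c kl.2) :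
    ∃ M, ∀ n, |c n| ≤ M := by
  obtain ⟨R, hR1, hR2⟩ : ∃ R : ℝ, 1 < R ∧ R * θ < 1 := by
    refine ⟨(1 + θ⁻¹) / 2, ?_, ?_⟩
    · have := (one_lt_inv₀ hθ0).2 hθ1
      linarith
    · rw [div_mul_eq_mul_div, add_mul, inv_mul_cancel₀ hθ0.ne']; linarith
  have hR0 : 0 < R := by linarith
  have hC : 0 ≤ C := by simpa using (abs_nonneg _).trans (hh 0)
  have hB : 0 ≤ B := by simpa using (abs_nonneg _).trans (hc 1)
  have hRθ : ‖R * θ‖ < 1 := by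
    rw [Real.norm_of_nonneg (by positivity)]; exact hR2
  have sH : Summable (fun n : ℕ => C * (R * θ) ^ n) :=
    (summable_geometric_of_norm_lt_one hRθ).mul_left C
  have sH' : Summable (fun n : ℕ => C * (n * (R * θ) ^ n)) := by
    have := summable_pow_mul_geometric_of_norm_lt_one 1 hRθ
    simpa using this.mul_left C
  set H : ℂ → ℂ := fun w => ∑' n, (h n : ℂ) * w ^ n with hH
  have bH : ∀ (n : ℕ), ∀ w ∈ Metric.ball (0 : ℂ) R, ‖(h n : ℂ) * w ^ n‖ ≤ C * (R * θ) ^ n := by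
    intro n w hw
    have hw' : ‖w‖ ≤ R := by simpa using (Metric.mem_ball.1 hw).le
    rw [norm_mul, norm_pow, Complex.norm_real, Real.norm_eq_abs]
    calc |h n| * ‖w‖ ^ n ≤ (C * θ ^ n) * R ^ n :=
          mul_le_mul (hh n) (pow_le_pow_left₀ (norm_nonneg _) hw' n) (by positivity) (by positivity)
      _ = _ := by rw [mul_pow]; ring
  have dH : DifferentiableOn ℂ H (Metric.ball 0 R) :=
    Complex.differentiableOn_tsum_of_summable_norm sH
      (fun n => ((differentiable_const _).mul (differentiable_id.pow n)).differentiableOn)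
      Metric.isOpen_ball bH
  have hsub : Metric.closedBall (0 : ℂ) 1 ⊆ Metric.ball 0 R :=
    Metric.closedBall_subset_ball hR1
  have aH : AnalyticOnNhd ℂ H (Metric.closedBall 0 1) := fun w hw =>
    dH.analyticAt (Metric.isOpen_ball.mem_nhds (hsub hw))
  have hH0 : H 0 = 1 := by
    simp only [hH]
    rw [tsum_eq_single 0 (by intro n hn; simp [hn])]
    simp [hh0]
  -- derivative
  have derH : ∀ w ∈ Metric.ball (0 : ℂ) R, deriv H w = ∑' n, (h n : ℂ) * (n * w ^ (n - 1)) := by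
    intro w hw
    have := hasDerivAt_tsum_of_isPreconnected (u := fun n : ℕ => R⁻¹ * (C * (n * (R * θ) ^ n)))
      (g := fun n (w : ℂ) => (h n : ℂ) * w ^ n) (g' := fun n (w : ℂ) => (h n : ℂ) * (n * w ^ (n - 1)))
      (t := Metric.ball (0 : ℂ) R) (y₀ := 0) (y := w) (sH'.mul_left _) Metric.isOpen_ball
      (convex_ball (0 : ℂ) R).isPreconnected
      (fun n y _ => (hasDerivAt_pow n y).const_mul _)
      (by
        intro n y hy
        have hy' : ‖y‖ ≤ R := by simpa using (Metric.mem_ball.1 hy).le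
        rcases n with _ | n
        · simp
        · simp only [norm_mul, norm_pow, Complex.norm_real, Real.norm_eq_abs, Complex.norm_natCast,
            Nat.add_sub_cancel]
          calc |h (n+1)| * (((n+1 : ℕ) : ℝ) * ‖y‖ ^ n) ≤ (C * θ ^ (n+1)) * (((n+1 : ℕ) : ℝ) * R ^ n) := by
                gcongr
                exact hh _
            _ = _ := by rw [mul_pow, pow_succ R]; field_simp)
      (by simpa using hR0)
      (Summable.of_norm_bounded sH (fun n => bH n 0 (by simpa using hR0))) hw
    exact this.deriv
  -- F
  set F : ℂ → ℂ := fun w => ∑' n, (c n : ℂ) * w ^ n with hF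
  have sF : ∀ r : ℝ, 0 ≤ r → r < 1 → Summable (fun n : ℕ => B * (n * r ^ n)) := by
    intro r h0 h1
    have := summable_pow_mul_geometric_of_norm_lt_one (R := ℝ) 1 (r := r) (by
      rwa [Real.norm_of_nonneg h0])
    simpa using this.mul_left B
  have bF : ∀ (r : ℝ) (n : ℕ) (w : ℂ), ‖w‖ ≤ r → ‖(c n : ℂ) * w ^ n‖ ≤ B * (n * r ^ n) := by
    intro r n w hw
    rw [norm_mul, norm_pow, Complex.norm_real, Real.norm_eq_abs, ← mul_assoc]
    exact mul_le_mul (hc n) (pow_le_pow_left₀ (norm_nonneg _) hw n) (by positivity) (by positivity)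
  have aF : ∀ w ∈ Metric.ball (0 : ℂ) 1, AnalyticAt ℂ F w := by
    intro w hw
    have hw1 : ‖w‖ < 1 := by simpa using hw
    obtain ⟨r, hr, hr1⟩ := exists_between hw1
    have hr0 : 0 ≤ r := (norm_nonneg _).trans hr.le
    have : DifferentiableOn ℂ F (Metric.ball 0 r) :=
      Complex.differentiableOn_tsum_of_summable_norm (sF r hr0 hr1)
        (fun n => ((differentiable_const _).mul (differentiable_id.pow n)).differentiableOn)
        Metric.isOpen_ball (fun n y hy => bF r n y (by simpa using (Metric.mem_ball.1 hy).le))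
    exact this.analyticAt (Metric.isOpen_ball.mem_nhds (by simpa using hr))
  have hsF : ∀ w ∈ Metric.ball (0 : ℂ) 1, HasSum (fun n => (c n : ℂ) * w ^ n) (F w) := by
    intro w hw
    have hw1 : ‖w‖ < 1 := by simpa using hw
    exact (Summable.of_norm_bounded (sF ‖w‖ (norm_nonneg _) hw1) (fun n => bF _ n w le_rfl)).hasSum
  have hprod : ∀ w ∈ Metric.ball (0 : ℂ) 1, H w * F w = w * deriv H w := by
    intro w hw
    have hw1 : ‖w‖ < 1 := by simpa using hw
    have hwR : w ∈ Metric.ball (0 : ℂ) R := hsub (Metric.ball_subset_closedBall hw)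
    rw [derH w hwR, ← tsum_mul_left (a := w)]
    simp only [hH, hF]
    rw [tsum_mul_tsum_eq_tsum_sum_antidiagonal_of_summable_norm
      (Summable.of_nonneg_of_le (fun _ => norm_nonneg _) (fun n => bH n w hwR) sH)
      (Summable.of_nonneg_of_le (fun _ => norm_nonneg _) (fun n => bF ‖w‖ n w le_rfl)
        (sF ‖w‖ (norm_nonneg _) hw1))]
    congr 1
    ext n
    have e1 : ∑ kl ∈ antidiagonal n, (h kl.1 : ℂ) * w ^ kl.1 * ((c kl.2 : ℂ) * w ^ kl.2)
        = ((n * h n : ℝ) : ℂ) * w ^ n := by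
      rw [hrec n]
      push_cast
      rw [Finset.sum_mul]
      refine Finset.sum_congr rfl fun kl hkl => ?_
      rw [← Finset.HasAntidiagonal.mem_antidiagonal.1 hkl, pow_add]; ring
    rw [e1]
    rcases n with _ | n
    · simp
    · rw [Nat.add_sub_cancel, pow_succ]; push_cast; ring
  have hfreq : ∀ α ∈ Metric.closedBall (0 : ℂ) 1, ¬ ∃ᶠ z in nhdsWithin α {α}ᶜ, H z = 0 := by
    intro α hα hf
    have := aH.eqOn_zero_of_preconnected_of_frequently_eq_zero
      (convex_closedBall (0 : ℂ) 1).isPreconnected hα hf (x := 0) (by simp)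
    simp [hH0] at this
  have hnoz : ∀ α ∈ Metric.ball (0 : ℂ) 1, H α ≠ 0 := by
    intro α hα h0
    have hα' := Metric.ball_subset_closedBall hα
    have hα0 : α ≠ 0 := by rintro rfl; simp [hH0] at h0
    have o1 := (aH α hα').analyticOrderAt_deriv_add_one
    simp only [h0, sub_zero] at o1
    have o2 : analyticOrderAt (H * F) α = analyticOrderAt (id * deriv H) α := by
      apply analyticOrderAt_congr
      filter_upwards [Metric.isOpen_ball.mem_nhds hα] with z hz
      exact hprod z hz
    rw [analyticOrderAt_mul (aH α hα') (aF α hα),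
      analyticOrderAt_mul analyticAt_id (aH α hα').deriv,
      (analyticAt_id.analyticOrderAt_eq_zero (z₀ := α)).2 hα0, zero_add] at o2
    have o3 : analyticOrderAt H α ≠ ⊤ := by
      intro ht
      rw [analyticOrderAt_eq_top] at ht
      exact hfreq α hα' ((ht.filter_mono nhdsWithin_le_nhds).frequently)
    have o4 : analyticOrderAt H α ≤ analyticOrderAt (deriv H) α := by
      rw [← o2]; exact le_self_add
    change analyticOrderAt (deriv H) α + 1 = analyticOrderAt H α at o1
    rw [← o1] at o4 o3
    have o5 : analyticOrderAt (deriv H) α ≠ ⊤ := fun h => o3 (by simp [h])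
    obtain ⟨k, hk⟩ := ENat.ne_top_iff_exists.1 o5
    rw [← hk] at o4
    have : k + 1 ≤ k := by exact_mod_cast o4
    omega
  have hfinz : ({w ∈ Metric.closedBall (0 : ℂ) 1 | H w = 0} : Set ℂ).Finite := by
    by_contra hinf
    obtain ⟨x, hx, hacc⟩ := Set.Infinite.exists_accPt_of_subset_isCompact hinf
      (isCompact_closedBall (0 : ℂ) 1) (fun w hw => hw.1)
    exact hfreq x hx ((accPt_iff_frequently_nhdsNE.1 hacc).mono fun y hy => hy.2)
  obtain ⟨c', M, hM, hc'⟩ := logDeriv_bdd_coeff _ H aH hfinz.toFinset rfl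
    (by intro w hw; simp only [Set.Finite.mem_toFinset, Set.mem_ofPred_eq, hw, true_and])
    (by
      intro w hw
      simp only [Set.Finite.mem_toFinset, Set.mem_ofPred_eq] at hw
      have h1 : ‖w‖ ≤ 1 := by simpa using hw.1
      refine le_antisymm h1 (not_lt.1 fun hlt => hnoz w (by simpa using hlt) hw.2))
  have hev : ∀ᶠ z in nhds (0 : ℂ), z ∈ Metric.ball (0 : ℂ) 1 :=
    Metric.isOpen_ball.mem_nhds (by simp)
  have p1 : HasFPowerSeriesAt F (FormalMultilinearSeries.ofScalars ℂ (fun n => (c n : ℂ))) 0 := by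
    rw [hasFPowerSeriesAt_iff]
    filter_upwards [hev] with z hz
    simpa [FormalMultilinearSeries.coeff_ofScalars, mul_comm] using hsF z hz
  have p2 : HasFPowerSeriesAt F (FormalMultilinearSeries.ofScalars ℂ c') 0 := by
    rw [hasFPowerSeriesAt_iff]
    filter_upwards [hev] with z hz
    have e : F z = z * deriv H z / H z := by
      rw [← hprod z hz, mul_div_cancel_left₀ _ (hnoz z hz)]
    simpa [FormalMultilinearSeries.coeff_ofScalars, mul_comm, e] using hc' z hz
  have heq := p1.eq_formalMultilinearSeries p2
  refine ⟨M, fun n => ?_⟩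
  have := congrArg (fun p => p.coeff n) heq
  simp only [FormalMultilinearSeries.coeff_ofScalars] at this
  rw [← Real.norm_eq_abs, ← Complex.norm_real, this]
  exact hM n

/-- Number of `h` of degree `m` all of whose prime factors have degree at most `k`. -/
noncomputable def smoothCount {P : Type*} (deg : P → ℕ) (F : ℕ → Finset (P →₀ ℕ)) (m k : ℕ) : ℕ :=
  #{h ∈ F m | ∀ p ∈ h.support, deg p ≤ k}

theorem degG_add {P : Type*} (deg : P → ℕ) (g h : P →₀ ℕ) :
    degG deg (g + h) = degG deg g + degG deg h := by
  unfold degG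
  exact Finsupp.sum_add_index' (fun a => by simp) (fun a b c => by ring)

theorem degG_single {P : Type*} (deg : P → ℕ) (p : P) (j : ℕ) :
    degG deg (Finsupp.single p j) = j * deg p := by
  unfold degG
  simp

theorem single_le_iff' {P : Type*} (p : P) (j : ℕ) (g : P →₀ ℕ) :
    Finsupp.single p j ≤ g ↔ j ≤ g p := by
  constructor
  · intro h; simpa using h p
  · intro h x
    by_cases hx : p = x
    · subst hx; simpa using h
    · simp [Finsupp.single_apply, hx]

theorem mul_deg_le {P : Type*} (deg : P → ℕ) (g : P →₀ ℕ) (p : P) :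
    g p * deg p ≤ degG deg g := by
  by_cases h : p ∈ g.support
  · exact Finset.single_le_sum (f := fun p => g p * deg p) (fun _ _ => Nat.zero_le _) h
  · simp at h; simp [h]

theorem shift_card {P : Type*} (deg : P → ℕ) (F : ℕ → Finset (P →₀ ℕ))
    (hF : ∀ n g, g ∈ F n ↔ degG deg g = n) (a : P →₀ ℕ) (n : ℕ) (Q : (P →₀ ℕ) → Prop)
    (T : Finset (P →₀ ℕ)) (hT : ∀ g, g ∈ T ↔ g ∈ F n ∧ a ≤ g ∧ Q g) :
    #T =
      if degG deg a ≤ n then #{h ∈ F (n - degG deg a) | Q (h + a)} else 0 := by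
  split_ifs with hle
  · refine Finset.card_nbij' (fun g => g - a) (fun h => h + a) ?_ ?_ ?_ ?_
    · intro g hg
      simp only [Finset.coe_filter, Set.mem_ofPred_eq, Finset.mem_coe, hT, hF] at hg ⊢
      obtain ⟨h1, h2, h3⟩ := hg
      have e := tsub_add_cancel_of_le h2
      refine ⟨?_, by rw [e]; exact h3⟩
      have := degG_add deg (g - a) a
      rw [e] at this
      omega
    · intro h hh
      simp only [Finset.coe_filter, Set.mem_ofPred_eq, Finset.mem_coe, hT, hF] at hh ⊢
      refine ⟨?_, le_add_self, hh.2⟩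
      rw [degG_add, hh.1]; omega
    · intro g hg
      simp only [Finset.coe_filter, Set.mem_ofPred_eq, Finset.mem_coe, hT, hF] at hg
      exact tsub_add_cancel_of_le hg.2.1
    · intro h hh
      simp
  · rw [Finset.card_eq_zero, Finset.eq_empty_iff_forall_notMem]
    intro g hgT
    obtain ⟨hg, h1, -⟩ := (hT g).1 hgT
    have e := tsub_add_cancel_of_le h1
    have := degG_add deg (g - a) a
    rw [e, (hF _ _).1 hg] at this
    omega

theorem support_subset_PR {P : Type*} (deg : P → ℕ) (F : ℕ → Finset (P →₀ ℕ))
    (hF : ∀ n g, g ∈ F n ↔ degG deg g = n) (Pk : ℕ → Finset P) (hP : ∀ k p, p ∈ Pk k ↔ deg p = k)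
    (n : ℕ) (g : P →₀ ℕ) (hg : g ∈ F n) : g.support ⊆ (range (n + 1)).biUnion Pk := by
  intro p hp
  simp only [Finset.mem_biUnion, Finset.mem_range, hP]
  refine ⟨deg p, ?_, rfl⟩
  have h1 := mul_deg_le deg g p
  rw [(hF _ _).1 hg] at h1
  have h2 : 1 ≤ g p := Nat.one_le_iff_ne_zero.2 (by simpa using hp)
  nlinarith

theorem sum_PR {P : Type*} (deg : P → ℕ) (Pk : ℕ → Finset P) (hP : ∀ k p, p ∈ Pk k ↔ deg p = k)
    (n : ℕ) (f : P → ℕ) :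
    ∑ p ∈ (range (n + 1)).biUnion Pk, f p = ∑ k ∈ range (n + 1), ∑ p ∈ Pk k, f p := by
  apply Finset.sum_biUnion
  intro a _ b _ hab
  rw [Function.onFun, Finset.disjoint_left]
  intro p h1 h2
  rw [hP] at h1 h2
  exact hab (h1.symm.trans h2)

theorem F_zero {P : Type*} (deg : P → ℕ) (hdeg : ∀ p, 0 < deg p) (F : ℕ → Finset (P →₀ ℕ))
    (hF : ∀ n g, g ∈ F n ↔ degG deg g = n) : #(F 0) = 1 := by
  rw [Finset.card_eq_one]
  refine ⟨0, ?_⟩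
  ext g
  rw [hF, Finset.mem_singleton]
  constructor
  · intro h
    ext p
    have := mul_deg_le deg g p
    have := hdeg p
    simp only [Finsupp.coe_zero, Pi.zero_apply]
    by_contra hne
    have : 0 < g p * deg p := Nat.mul_pos (Nat.pos_of_ne_zero hne) (hdeg p)
    omega
  · rintro rfl; simp [degG]

theorem mangoldt_rec {P : Type*} (deg : P → ℕ) (hdeg : ∀ p, 0 < deg p) (F : ℕ → Finset (P →₀ ℕ))
    (hF : ∀ n g, g ∈ F n ↔ degG deg g = n) (Pk : ℕ → Finset P) (hP : ∀ k p, p ∈ Pk k ↔ deg p = k)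
    (n : ℕ) : n * #(F n) = ∑ kl ∈ HasAntidiagonal.antidiagonal n,
      #(F kl.1) * ∑ d ∈ kl.2.divisors, d * #(Pk d) := by
  have h1 : ∀ g ∈ F n, n = ∑ d ∈ range (n + 1), ∑ p ∈ Pk d, ∑ j ∈ Icc 1 n,
      if Finsupp.single p j ≤ g ∧ True then d else 0 := by
    intro g hg
    have e1 : n = ∑ p ∈ (range (n + 1)).biUnion Pk, g p * deg p := by
      rw [← Finsupp.sum_of_support_subset (f := g) (support_subset_PR deg F hF Pk hP n g hg)
        (fun p k => k * deg p) (by simp)]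
      exact ((hF _ _).1 hg).symm
    conv_lhs => rw [e1, sum_PR deg Pk hP]
    refine Finset.sum_congr rfl fun d _ => Finset.sum_congr rfl fun p hp => ?_
    have hpd := (hP _ _).1 hp
    have e2 : ∀ j ∈ Icc 1 n, (if Finsupp.single p j ≤ g ∧ True then d else 0)
        = (if j ≤ g p then d else 0) := by
      intro j _; simp [single_le_iff']
    rw [Finset.sum_congr rfl e2, ← Finset.sum_filter, Finset.sum_const, smul_eq_mul, hpd]
    congr 1
    have : {j ∈ Icc 1 n | j ≤ g p} = Icc 1 (g p) := by
      ext j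
      simp only [Finset.mem_filter, Finset.mem_Icc]
      have h2 := mul_deg_le deg g p
      rw [(hF _ _).1 hg] at h2
      have h3 := hdeg p
      have h4 : g p ≤ n := by nlinarith
      omega
    rw [this]; simp
  have h2 : n * #(F n) = ∑ g ∈ F n, ∑ d ∈ range (n + 1), ∑ p ∈ Pk d, ∑ j ∈ Icc 1 n,
      if Finsupp.single p j ≤ g ∧ True then d else 0 := by
    rw [← Finset.sum_congr rfl h1]; simp [mul_comm]
  rw [h2, Finset.sum_comm]
  have h3 : ∀ d ∈ range (n + 1), ∑ g ∈ F n, ∑ p ∈ Pk d, ∑ j ∈ Icc 1 n,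
      (if Finsupp.single p j ≤ g ∧ True then d else 0) =
      ∑ k ∈ range (n + 1), if d ∈ k.divisors then #(F (n - k)) * (d * #(Pk d)) else 0 := by
    intro d _
    rw [Finset.sum_comm]
    have e1 : ∀ p ∈ Pk d, ∑ g ∈ F n, ∑ j ∈ Icc 1 n,
        (if Finsupp.single p j ≤ g ∧ True then d else 0) =
        ∑ k ∈ range (n + 1), if d ∈ k.divisors then #(F (n - k)) * d else 0 := by
      intro p hp
      have hpd := (hP _ _).1 hp
      have hd : 0 < d := hpd ▸ hdeg p
      rw [Finset.sum_comm]
      have e2 : ∀ j ∈ Icc 1 n, ∑ g ∈ F n, (if Finsupp.single p j ≤ g ∧ True then d else 0)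
          = if j * d ≤ n then #(F (n - j * d)) * d else 0 := by
        intro j _
        rw [← Finset.sum_filter, Finset.sum_const, smul_eq_mul,
          shift_card deg F hF (Finsupp.single p j) n (fun _ => True)
            {g ∈ F n | Finsupp.single p j ≤ g ∧ True} (by simp), degG_single, hpd]
        split_ifs <;> simp
      rw [Finset.sum_congr rfl e2, ← Finset.sum_filter, ← Finset.sum_filter]
      refine Finset.sum_nbij' (fun j => j * d) (fun k => k / d) ?_ ?_ ?_ ?_ ?_
      · intro j hj
        simp only [Finset.mem_filter, Finset.mem_Icc, Finset.mem_range, Nat.mem_divisors] at hj ⊢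
        refine ⟨by omega, dvd_mul_left _ _, ?_⟩
        exact Nat.mul_ne_zero (by omega) (by omega)
      · intro k hk
        simp only [Finset.mem_filter, Finset.mem_Icc, Finset.mem_range, Nat.mem_divisors] at hk ⊢
        obtain ⟨h1, h2, h3⟩ := hk
        refine ⟨⟨Nat.div_pos (Nat.le_of_dvd (by omega) h2) hd, ?_⟩, ?_⟩
        · exact (Nat.div_le_self _ _).trans (by omega)
        · rw [Nat.div_mul_cancel h2]; omega
      · intro j _
        exact Nat.mul_div_cancel _ hd
      · intro k hk
        simp only [Finset.mem_filter, Nat.mem_divisors] at hk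
        exact Nat.div_mul_cancel hk.2.1
      · intro j _; rfl
    rw [Finset.sum_congr rfl e1, Finset.sum_const, smul_eq_mul, Finset.mul_sum]
    refine Finset.sum_congr rfl fun k _ => ?_
    split_ifs
    · ring
    · simp
  rw [Finset.sum_congr rfl h3, Finset.sum_comm, Finset.Nat.sum_antidiagonal_eq_sum_range_succ_mk,
    ← Finset.sum_range_reflect]
  refine Finset.sum_congr rfl fun k hk => ?_
  rw [Finset.mem_range] at hk
  have e : n - (n + 1 - 1 - k) = k := by omega
  simp only [Finset.mul_sum]
  rw [← Finset.sum_filter]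
  rw [e, Nat.add_sub_cancel]
  refine Finset.sum_congr ?_ fun d _ => rfl
  ext d
  simp only [Finset.mem_filter, Finset.mem_range, Nat.mem_divisors]
  constructor
  · exact fun h => h.2
  · intro h
    refine ⟨?_, h⟩
    have := Nat.le_of_dvd (by omega) h.1
    omega

theorem dmax_iff {P : Type*} (deg : P → ℕ) (g : P →₀ ℕ) (p : P) (k : ℕ) (hk : deg p = k) :
    (p ∈ g.support ∧ deg p = dmaxG deg g) ↔
      (Finsupp.single p 1 ≤ g ∧ ∀ p' ∈ g.support, deg p' ≤ k) := by
  rw [single_le_iff', Nat.one_le_iff_ne_zero, ← Finsupp.mem_support_iff]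
  refine and_congr_right fun hp => ?_
  unfold dmaxG
  subst hk
  constructor
  · intro h p' hp'
    rw [h]; exact Finset.le_sup hp'
  · intro h
    exact le_antisymm (Finset.le_sup hp) (Finset.sup_le h)

theorem sum_QS {P : Type*} (deg : P → ℕ) (F : ℕ → Finset (P →₀ ℕ))
    (hF : ∀ n g, g ∈ F n ↔ degG deg g = n) (Pk : ℕ → Finset P) (hP : ∀ k p, p ∈ Pk k ↔ deg p = k)
    (S : Set P) (n : ℕ) :
    ∑ g ∈ F n, QS deg S g =
      ∑ k ∈ range (n + 1), #{p ∈ Pk k | p ∈ S} * smoothCount deg F (n - k) k := by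
  have h1 : ∀ g ∈ F n, QS deg S g = ∑ k ∈ range (n + 1), ∑ p ∈ Pk k,
      if p ∈ S then (if Finsupp.single p 1 ≤ g ∧ ∀ p' ∈ g.support, deg p' ≤ k then 1 else 0) else 0 := by
    intro g hg
    have e1 : QS deg S g = ∑ p ∈ (range (n + 1)).biUnion Pk,
        if p ∈ g.support ∧ p ∈ S ∧ deg p = dmaxG deg g then 1 else 0 := by
      unfold QS
      rw [Finset.sum_boole, Nat.cast_id]
      congr 1
      ext p
      simp only [Finset.mem_filter]
      constructor
      · exact fun h => ⟨support_subset_PR deg F hF Pk hP n g hg h.1, h⟩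
      · exact fun h => h.2
    rw [e1, sum_PR deg Pk hP]
    refine Finset.sum_congr rfl fun k _ => Finset.sum_congr rfl fun p hp => ?_
    have := dmax_iff deg g p k ((hP _ _).1 hp)
    by_cases hS : p ∈ S
    · simp only [hS, true_and, if_true, this]
    · simp [hS]
  rw [Finset.sum_congr rfl h1, Finset.sum_comm]
  refine Finset.sum_congr rfl fun k hk => ?_
  rw [Finset.sum_comm, Finset.card_filter, Finset.sum_mul]
  refine Finset.sum_congr rfl fun p hp => ?_
  have hpk := (hP _ _).1 hp
  rw [Finset.mem_range] at hk
  by_cases hS : p ∈ S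
  · simp only [hS, if_true, one_mul]
    rw [Finset.sum_boole, Nat.cast_id,
      shift_card deg F hF (Finsupp.single p 1) n (fun g => ∀ p' ∈ g.support, deg p' ≤ k)
        {g ∈ F n | Finsupp.single p 1 ≤ g ∧ ∀ p' ∈ g.support, deg p' ≤ k}
        (fun g => by rw [Finset.mem_filter]),
      degG_single, one_mul, hpk, if_pos (by omega)]
    unfold smoothCount
    congr 1
    ext h
    simp only [Finset.mem_filter, Finsupp.mem_support_iff, Finsupp.add_apply]
    refine and_congr_right fun _ => ?_
    constructor
    · intro H p' hp'
      exact H p' (by omega)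
    · intro H p' hp'
      by_cases hpp : p = p'
      · subst hpp; exact hpk.le
      · exact H p' (by simpa [Finsupp.single_apply, hpp] using hp')
  · simp [hS]

theorem sum_Q_le {P : Type*} (deg : P → ℕ) (F : ℕ → Finset (P →₀ ℕ))
    (hF : ∀ n g, g ∈ F n ↔ degG deg g = n) (Pk : ℕ → Finset P) (hP : ∀ k p, p ∈ Pk k ↔ deg p = k)
    (n : ℕ) :
    ∑ g ∈ F n, QS deg Set.univ g ≤ #(F n) +
      ∑ k ∈ range (n + 1), #(Pk k) ^ 2 * (if 2 * k ≤ n then smoothCount deg F (n - 2 * k) k else 0) := by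
  have h1 : ∀ g ∈ F n, QS deg Set.univ g ≤ 1 + ∑ k ∈ range (n + 1), ∑ x ∈ (Pk k).offDiag,
      if Finsupp.single x.1 1 + Finsupp.single x.2 1 ≤ g ∧ ∀ p' ∈ g.support, deg p' ≤ k
        then 1 else 0 := by
    intro g hg
    set A := g.support.filter fun p => p ∈ Set.univ ∧ deg p = dmaxG deg g with hA
    have hQ : QS deg Set.univ g = #A := by unfold QS; rw [hA]; congr
    rcases Finset.eq_empty_or_nonempty A with hAe | hAe
    · rw [hQ, hAe]; simp
    obtain ⟨p0, hp0⟩ := hAe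
    have hk : dmaxG deg g ∈ range (n + 1) := by
      have h3 := support_subset_PR deg F hF Pk hP n g hg (Finset.mem_filter.1 hp0).1
      simp only [Finset.mem_biUnion, hP] at h3
      obtain ⟨a, ha, hb⟩ := h3
      rw [← (Finset.mem_filter.1 hp0).2.2, hb]; exact ha
    have h2 := Finset.single_le_sum (f := fun k => ∑ x ∈ (Pk k).offDiag,
      if Finsupp.single x.1 1 + Finsupp.single x.2 1 ≤ g ∧ ∀ p' ∈ g.support, deg p' ≤ k
        then 1 else 0) (fun _ _ => Nat.zero_le _) hk
    refine le_trans ?_ (Nat.add_le_add_left h2 1)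
    rw [Finset.sum_boole, Nat.cast_id]
    have h3 : A.offDiag ⊆ {x ∈ (Pk (dmaxG deg g)).offDiag |
        Finsupp.single x.1 1 + Finsupp.single x.2 1 ≤ g ∧ ∀ p' ∈ g.support, deg p' ≤ dmaxG deg g} := by
      intro x hx
      rw [Finset.mem_offDiag] at hx
      obtain ⟨a1, a2, a3⟩ := hx
      simp only [hA, Finset.mem_filter, Set.mem_univ, true_and] at a1 a2
      simp only [Finset.mem_filter, Finset.mem_offDiag, hP]
      refine ⟨⟨a1.2, a2.2, a3⟩, ?_, fun p' hp' => Finset.le_sup hp'⟩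
      intro y
      have b1 := a1.1
      have b2 := a2.1
      rw [Finsupp.mem_support_iff] at b1 b2
      simp only [Finsupp.add_apply, Finsupp.single_apply]
      split_ifs with c1 c2 c2
      · exact absurd (c1.trans c2.symm) a3
      · subst c1; omega
      · subst c2; omega
      · omega
    have h4 := Finset.card_le_card h3
    rw [Finset.offDiag_card] at h4
    rw [hQ]
    have h5 : 1 ≤ #A := Finset.card_pos.2 ⟨p0, hp0⟩
    refine le_trans ?_ (Nat.add_le_add_left h4 1)
    obtain ⟨t, ht⟩ := Nat.exists_eq_add_of_le h5
    rw [ht]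
    have : (1 + t) * (1 + t) - (1 + t) = (1 + t) * t := by
      rw [← Nat.mul_sub_one]; congr 1; omega
    rw [this]; nlinarith
  refine (Finset.sum_le_sum h1).trans ?_
  rw [Finset.sum_add_distrib, Finset.sum_const, smul_eq_mul, mul_one]
  refine Nat.add_le_add_left ?_ _
  rw [Finset.sum_comm]
  refine Finset.sum_le_sum fun k _ => ?_
  rw [Finset.sum_comm]
  have h2 : ∀ x ∈ (Pk k).offDiag, ∑ g ∈ F n, (if Finsupp.single x.1 1 + Finsupp.single x.2 1 ≤ g ∧
      ∀ p' ∈ g.support, deg p' ≤ k then 1 else 0) ≤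
      if 2 * k ≤ n then smoothCount deg F (n - 2 * k) k else 0 := by
    intro x hx
    rw [Finset.mem_offDiag, hP, hP] at hx
    rw [Finset.sum_boole, Nat.cast_id,
      shift_card deg F hF (Finsupp.single x.1 1 + Finsupp.single x.2 1) n
        (fun g => ∀ p' ∈ g.support, deg p' ≤ k)
        {g ∈ F n | Finsupp.single x.1 1 + Finsupp.single x.2 1 ≤ g ∧ ∀ p' ∈ g.support, deg p' ≤ k}
        (fun g => by rw [Finset.mem_filter]),
      degG_add, degG_single, degG_single, hx.1, hx.2.1, ← add_mul]
    split_ifs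
    · unfold smoothCount
      apply Finset.card_le_card
      intro h hh
      simp only [Finset.mem_filter] at hh ⊢
      refine ⟨hh.1, fun p' hp' => hh.2 p' ?_⟩
      rw [Finsupp.mem_support_iff] at hp' ⊢
      simp only [Finsupp.add_apply]
      omega
    · exact le_rfl
  refine (Finset.sum_le_card_nsmul _ _ _ h2).trans ?_
  rw [smul_eq_mul, Finset.offDiag_card]
  gcongr
  rw [sq]; exact Nat.sub_le _ _

theorem le_sum_Q {P : Type*} (deg : P → ℕ) (F : ℕ → Finset (P →₀ ℕ))
    (hF : ∀ n g, g ∈ F n ↔ degG deg g = n) (n : ℕ) (hn : 1 ≤ n) :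
    #(F n) ≤ ∑ g ∈ F n, QS deg Set.univ g := by
  have : ∀ g ∈ F n, 1 ≤ QS deg Set.univ g := by
    intro g hg
    have hne : g.support.Nonempty := by
      rw [Finsupp.support_nonempty_iff]
      rintro rfl
      have := (hF _ _).1 hg
      simp [degG] at this
      omega
    obtain ⟨p, hp, he⟩ := Finset.exists_mem_eq_sup g.support hne deg
    unfold QS
    apply Finset.card_pos.2
    exact ⟨p, by simp only [Finset.mem_filter]; exact ⟨hp, trivial, he.symm⟩⟩
  simpa using Finset.card_nsmul_le_sum _ _ _ this

theorem smoothCount_le {P : Type*} (deg : P → ℕ) (hdeg : ∀ p, 0 < deg p) (F : ℕ → Finset (P →₀ ℕ))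
    (hF : ∀ n g, g ∈ F n ↔ degG deg g = n) (Pk : ℕ → Finset P) (hP : ∀ k p, p ∈ Pk k ↔ deg p = k)
    (m k : ℕ) : smoothCount deg F m k ≤ (m + 1) ^ #((range (k + 1)).biUnion Pk) := by
  have : {h ∈ F m | ∀ p ∈ h.support, deg p ≤ k} ⊆
      ((range (k + 1)).biUnion Pk).finsupp (fun _ => range (m + 1)) := by
    intro h hh
    rw [Finset.mem_filter] at hh
    rw [Finset.mem_finsupp_iff]
    constructor
    · intro p hp
      simp only [Finset.mem_biUnion, Finset.mem_range, hP]
      exact ⟨deg p, by have := hh.2 p hp; omega, rfl⟩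
    · intro p _
      have h1 := mul_deg_le deg h p
      rw [(hF _ _).1 hh.1] at h1
      have := hdeg p
      rw [Finset.mem_range]
      nlinarith
  refine (Finset.card_le_card this).trans ?_
  rw [Finset.card_finsupp]
  simp

theorem chebyshev_upper (N π : ℕ → ℕ) (cG q η C : ℝ) (hc : 0 < cG) (hq : 1 < q) (hη1 : η < 1)
    (hN0 : N 0 = 1)
    (hax : ∀ n : ℕ, |(N n : ℝ) - cG * q ^ n| ≤ C * q ^ (η * n))
    (hrec : ∀ n : ℕ, n * N n = ∑ kl ∈ HasAntidiagonal.antidiagonal n,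
      N kl.1 * ∑ d ∈ kl.2.divisors, d * π d) :
    ∃ M : ℝ, ∀ k : ℕ, (k : ℝ) * π k ≤ M * q ^ k := by
  have hq0 : 0 < q := by linarith
  have hC : 0 ≤ C := by simpa using (abs_nonneg _).trans (hax 0)
  set θ : ℝ := q ^ (η - 1) with hθ
  have hθ0 : 0 < θ := Real.rpow_pos_of_pos hq0 _
  have hθ1 : θ < 1 := Real.rpow_lt_one_of_one_lt_of_neg hq (by linarith)
  have hθn : ∀ n : ℕ, q ^ (η * n) = θ ^ n * q ^ n := by
    intro n
    rw [← mul_pow, hθ, Real.rpow_sub_one hq0.ne', div_mul_cancel₀ _ hq0.ne', ← Real.rpow_mul_natCast hq0.le]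
  set z : ℕ → ℝ := fun n => N n / q ^ n with hz
  set Λ : ℕ → ℕ := fun k => ∑ d ∈ k.divisors, d * π d with hΛ
  set l : ℕ → ℝ := fun n => Λ n / q ^ n with hl
  have hqn : ∀ n : ℕ, 0 < q ^ n := fun n => pow_pos hq0 n
  have hz1 : ∀ n, |z n - cG| ≤ C * θ ^ n := by
    intro n
    have e : z n - cG = (N n - cG * q ^ n) / q ^ n := by
      simp only [hz]; field_simp
    rw [e, abs_div, abs_of_pos (hqn n), div_le_iff₀ (hqn n), mul_assoc, ← hθn]
    exact hax n
  have hz0 : z 0 = 1 := by simp [hz, hN0]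
  have hzB : ∀ n, z n ≤ cG + C := by
    intro n
    have h1 := (abs_le.1 (hz1 n)).2
    have h2 : C * θ ^ n ≤ C := mul_le_of_le_one_right hC (pow_le_one₀ hθ0.le hθ1.le)
    linarith
  have hzl : ∀ n : ℕ, n * z n = ∑ kl ∈ HasAntidiagonal.antidiagonal n, z kl.1 * l kl.2 := by
    intro n
    have h1 : (n : ℝ) * N n = ∑ kl ∈ HasAntidiagonal.antidiagonal n, (N kl.1 : ℝ) * Λ kl.2 := by
      exact_mod_cast hrec n
    simp only [hz]
    rw [← mul_div_assoc, h1, Finset.sum_div]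
    refine Finset.sum_congr rfl fun kl hkl => ?_
    rw [← Finset.HasAntidiagonal.mem_antidiagonal.1 hkl, pow_add, div_mul_div_comm]
  have hl0 : ∀ n, 0 ≤ l n := fun n => by simp only [hl]; positivity
  have hz0' : ∀ n, 0 ≤ z n := fun n => by simp only [hz]; positivity
  have hlB : ∀ n : ℕ, l n ≤ (cG + C) * n := by
    intro n
    have h1 := Finset.single_le_sum (f := fun kl : ℕ × ℕ => z kl.1 * l kl.2)
      (fun kl _ => mul_nonneg (hz0' _) (hl0 _)) (a := (0, n))
      (s := HasAntidiagonal.antidiagonal n) (by simp)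
    rw [← hzl] at h1
    simp only [hz0, one_mul] at h1
    nlinarith [hzB n, Nat.cast_nonneg (α := ℝ) n]
  let Zs : PowerSeries ℝ := PowerSeries.mk z
  let L : PowerSeries ℝ := PowerSeries.mk l
  let U : PowerSeries ℝ := PowerSeries.mk fun n => if n = 0 then 0 else 1
  let D : PowerSeries ℝ := PowerSeries.mk fun n => n * z n
  have eD : Zs * L = D := by
    ext n
    rw [PowerSeries.coeff_mul]
    simp only [Zs, L, D, PowerSeries.coeff_mk]
    exact (hzl n).symm
  have eU : (1 - PowerSeries.X) * U = PowerSeries.X := by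
    ext n
    rw [sub_mul, one_mul, map_sub]
    rcases n with _ | n
    · simp [U]
    · rw [PowerSeries.coeff_succ_X_mul, PowerSeries.coeff_X]
      simp only [U, PowerSeries.coeff_mk]
      rcases n with _ | n <;> simp
  let Hs : PowerSeries ℝ := (1 - PowerSeries.X) * Zs
  let h : ℕ → ℝ := fun n => PowerSeries.coeff n Hs
  have hh0 : h 0 = 1 := by
    simp [h, Hs, Zs, sub_mul, hz0]
  have hhs : ∀ n, h (n + 1) = z (n + 1) - z n := by
    intro n
    simp only [h, Hs, Zs, sub_mul, one_mul, map_sub, PowerSeries.coeff_succ_X_mul,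
      PowerSeries.coeff_mk]
  let c : ℕ → ℝ := fun n => l n - if n = 0 then 0 else 1
  have hmain : Hs * (L - U) = (1 - PowerSeries.X) * D - PowerSeries.X * Zs := by
    calc Hs * (L - U) = (1 - PowerSeries.X) * (Zs * L) - ((1 - PowerSeries.X) * U) * Zs := by
          simp only [Hs]; ring
      _ = _ := by rw [eD, eU]
  have hconv : ∀ n : ℕ, n * h n = ∑ kl ∈ HasAntidiagonal.antidiagonal n, h kl.1 * c kl.2 := by
    intro n
    have h1 := congrArg (PowerSeries.coeff n) hmain
    rw [PowerSeries.coeff_mul] at h1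
    have h2 : ∀ m, PowerSeries.coeff m (L - U) = c m := by
      intro m; simp [L, U, c]
    simp only [h2] at h1
    change ∑ kl ∈ HasAntidiagonal.antidiagonal n, h kl.1 * c kl.2 = _ at h1
    rw [h1]
    rcases n with _ | n
    · simp [D, sub_mul]
    · rw [hhs]
      simp only [D, Zs, sub_mul, one_mul, map_sub, PowerSeries.coeff_succ_X_mul,
        PowerSeries.coeff_mk]
      push_cast; ring
  obtain ⟨M, hM⟩ := bdd_of_conv h c (C * (1 + θ⁻¹) + 1) θ (cG + C + 1) hθ0 hθ1
    (by
      intro n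
      rcases n with _ | n
      · rw [hh0]; simp; positivity
      · rw [hhs]
        have e : z (n + 1) - z n = (z (n + 1) - cG) - (z n - cG) := by ring
        rw [e]
        refine (abs_sub _ _).trans ((add_le_add (hz1 _) (hz1 _)).trans ?_)
        have e2 : C * θ ^ (n + 1) + C * θ ^ n = C * (1 + θ⁻¹) * θ ^ (n + 1) := by
          rw [pow_succ]; field_simp
        rw [e2]
        have := pow_pos hθ0 (n + 1)
        nlinarith)
    hh0
    (by
      intro n
      rcases n with _ | n
      · simp [c, hl, hΛ]
      · simp only [c]
        refine (abs_sub _ _).trans ?_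
        rw [abs_of_nonneg (hl0 _)]
        have := hlB (n + 1)
        have hn : (1 : ℝ) ≤ ((n + 1 : ℕ) : ℝ) := by simp
        simp only [Nat.add_eq_zero_iff, one_ne_zero, and_false, if_false, abs_one]
        nlinarith)
    hconv
  refine ⟨M + 1, fun k => ?_⟩
  have h1 : l k ≤ M + 1 := by
    have := (abs_le.1 (hM k)).2
    simp only [c] at this
    split_ifs at this <;> linarith
  have h2 : (k : ℝ) * π k ≤ Λ k := by
    rcases Nat.eq_zero_or_pos k with hk | hk
    · simp [hk]
    · have := Finset.single_le_sum (f := fun d => d * π d) (fun _ _ => Nat.zero_le _)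
        (Nat.mem_divisors_self k hk.ne')
      exact_mod_cast this
  simp only [hl] at h1
  rw [div_le_iff₀ (hqn k)] at h1
  exact h2.trans h1

theorem final_analysis (N π πS : ℕ → ℕ) (Ψ : ℕ → ℕ → ℕ) (cG q δ B M : ℝ) (e : ℕ → ℕ)
    (hq : 1 < q) (hM : ∀ k : ℕ, (k : ℝ) * π k ≤ M * q ^ k)
    (hπ0 : π 0 = 0) (hπS : ∀ k, πS k ≤ π k)
    (hN : Tendsto (fun n => (N n : ℝ) / q ^ n) atTop (nhds cG))
    (hNB : ∀ n, (N n : ℝ) ≤ B * q ^ n) (hΨN : ∀ m k, Ψ m k ≤ N m)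
    (hΨe : ∀ m k, Ψ m k ≤ (m + 1) ^ e k)
    (hlow : ∀ n, 1 ≤ n → N n ≤ ∑ k ∈ range (n + 1), π k * Ψ (n - k) k)
    (hup : ∀ n, ∑ k ∈ range (n + 1), π k * Ψ (n - k) k ≤
      N n + ∑ k ∈ range (n + 1), π k ^ 2 * (if 2 * k ≤ n then Ψ (n - 2 * k) k else 0))
    (hdens : Tendsto (fun n => (πS n : ℝ) / π n) atTop (nhds δ)) :
    Tendsto (fun n => (((∑ k ∈ range (n + 1), πS k * Ψ (n - k) k : ℕ) : ℝ)) / q ^ n)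
      atTop (nhds (cG * δ)) := by
  have hq0 : 0 < q := by linarith
  have hqn : ∀ n : ℕ, 0 < q ^ n := fun n => pow_pos hq0 n
  have hB : 0 ≤ B := by simpa using (Nat.cast_nonneg _).trans (hNB 0)
  -- smooth numbers are negligible
  have hsm : ∀ k, Tendsto (fun m => (Ψ m k : ℝ) / q ^ m) atTop (nhds 0) := by
    intro k
    have h1 : Tendsto (fun m : ℕ => q * (((m + 1 : ℕ) : ℝ) ^ e k / q ^ (m + 1))) atTop (nhds 0) := by
      have := ((tendsto_add_atTop_iff_nat 1).2
        (tendsto_pow_const_div_const_pow_of_one_lt (e k) hq)).const_mul q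
      simpa using this
    refine squeeze_zero (fun m => by positivity) (fun m => ?_) h1
    have h2 : (Ψ m k : ℝ) ≤ ((m + 1 : ℕ) : ℝ) ^ e k := by exact_mod_cast hΨe m k
    have h3 : q * (((m + 1 : ℕ) : ℝ) ^ e k / q ^ (m + 1)) = ((m + 1 : ℕ) : ℝ) ^ e k / q ^ m := by
      rw [pow_succ]; field_simp
    rw [h3]
    gcongr
  have hshift : ∀ k j, Tendsto (fun n => (Ψ (n - j) k : ℝ) / q ^ n) atTop (nhds 0) := by
    intro k j
    rw [← tendsto_add_atTop_iff_nat j]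
    have := (hsm k).mul_const ((q ^ j)⁻¹)
    rw [zero_mul] at this
    refine this.congr fun n => ?_
    rw [Nat.add_sub_cancel, pow_add]; field_simp
  -- pair sums
  let f : ℕ → ℕ → ℝ := fun n k =>
    if k ∈ range (n + 1) then
      (π k : ℝ) ^ 2 * (if 2 * k ≤ n then (Ψ (n - 2 * k) k : ℝ) else 0) / q ^ n else 0
  have hfb : ∀ n k, ‖f n k‖ ≤ B * M ^ 2 * (1 / (k : ℝ) ^ 2) := by
    intro n k
    have hR : 0 ≤ B * M ^ 2 * (1 / (k : ℝ) ^ 2) := by positivity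
    simp only [f]
    split_ifs with h1 h2
    · rcases Nat.eq_zero_or_pos k with hk | hk
      · subst hk; simp [hπ0]
      · rw [Real.norm_of_nonneg (by positivity)]
        have hk' : (0 : ℝ) < k := by exact_mod_cast hk
        have a1 : (π k : ℝ) ≤ M * q ^ k / k := by
          rw [le_div_iff₀ hk', mul_comm]; exact hM k
        have a2 : (Ψ (n - 2 * k) k : ℝ) ≤ B * q ^ (n - 2 * k) :=
          le_trans (by exact_mod_cast hΨN _ _) (hNB _)
        rw [div_le_iff₀ (hqn n)]
        calc (π k : ℝ) ^ 2 * (Ψ (n - 2 * k) k : ℝ) ≤ (M * q ^ k / k) ^ 2 * (B * q ^ (n - 2 * k)) := by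
              gcongr
          _ = B * M ^ 2 * (1 / (k : ℝ) ^ 2) * (q ^ (2 * k) * q ^ (n - 2 * k)) := by
              rw [pow_mul' q 2 k, div_pow, mul_pow]; field_simp
          _ = _ := by rw [← pow_add, Nat.add_sub_cancel' h2]
    · simpa using hR
    · simpa using hR
  have hft : Tendsto (fun n => ∑' k, f n k) atTop (nhds 0) := by
    have := tendsto_tsum_of_dominated_convergence (f := f) (g := fun _ => 0) (𝓕 := atTop)
      (bound := fun k : ℕ => B * M ^ 2 * (1 / (k : ℝ) ^ 2))
      ((Real.summable_one_div_nat_pow.2 one_lt_two).mul_left _)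
      (by
        intro k
        have h1 := (hshift k (2 * k)).const_mul ((π k : ℝ) ^ 2)
        rw [mul_zero] at h1
        refine squeeze_zero (fun n => ?_) (fun n => ?_) h1
        · simp only [f]; split_ifs <;> positivity
        · simp only [f]
          split_ifs
          · rw [mul_div_assoc]
          · rw [mul_zero, zero_div]; positivity
          · positivity)
      (Eventually.of_forall hfb)
    simpa using this
  have hfsum : ∀ n, ∑' k, f n k = ((∑ k ∈ range (n + 1), π k ^ 2 *
      (if 2 * k ≤ n then Ψ (n - 2 * k) k else 0) : ℕ) : ℝ) / q ^ n := by
    intro n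
    rw [tsum_eq_sum (s := range (n + 1)) (fun k hk => by simp only [f]; rw [if_neg hk])]
    push_cast
    rw [Finset.sum_div]
    refine Finset.sum_congr rfl fun k hk => ?_
    simp only [f]; rw [if_pos hk]
  set w : ℕ → ℕ → ℝ := fun n k => (π k : ℝ) * Ψ (n - k) k / q ^ n with hw
  have hw0 : ∀ n k, 0 ≤ w n k := fun n k => by simp only [hw]; positivity
  have hwk : ∀ k, Tendsto (fun n => w n k) atTop (nhds 0) := by
    intro k
    have := (hshift k k).const_mul (π k : ℝ)
    rw [mul_zero] at this
    exact this.congr fun n => by simp only [hw]; rw [mul_div_assoc]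
  have hwsum : ∀ n, ∑ k ∈ range (n + 1), w n k =
      ((∑ k ∈ range (n + 1), π k * Ψ (n - k) k : ℕ) : ℝ) / q ^ n := by
    intro n
    push_cast
    rw [Finset.sum_div]
  have hwt : Tendsto (fun n => ∑ k ∈ range (n + 1), w n k) atTop (nhds cG) := by
    have h2 := hN.add hft
    rw [add_zero] at h2
    refine tendsto_of_tendsto_of_tendsto_of_le_of_le' hN h2 ?_ ?_
    · filter_upwards [eventually_ge_atTop 1] with n hn
      rw [hwsum]
      have : (N n : ℝ) ≤ ((∑ k ∈ range (n + 1), π k * Ψ (n - k) k : ℕ) : ℝ) := by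
        exact_mod_cast hlow n hn
      gcongr
    · refine Eventually.of_forall fun n => ?_
      rw [hwsum, hfsum, ← add_div]
      have : ((∑ k ∈ range (n + 1), π k * Ψ (n - k) k : ℕ) : ℝ) ≤ (N n : ℝ) +
          ((∑ k ∈ range (n + 1), π k ^ 2 * (if 2 * k ≤ n then Ψ (n - 2 * k) k else 0) : ℕ) : ℝ) := by
        exact_mod_cast hup n
      gcongr
  -- weighting
  set r : ℕ → ℝ := fun k => (πS k : ℝ) / π k with hr
  have hrπ : ∀ k, (πS k : ℝ) = r k * π k := by
    intro k
    simp only [hr]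
    rcases Nat.eq_zero_or_pos (π k) with hk | hk
    · have := hπS k
      have h0 : πS k = 0 := by omega
      simp [hk, h0]
    · rw [div_mul_cancel₀]; exact_mod_cast hk.ne'
  have hS : ∀ n, ((∑ k ∈ range (n + 1), πS k * Ψ (n - k) k : ℕ) : ℝ) / q ^ n =
      δ * ∑ k ∈ range (n + 1), w n k + ∑ k ∈ range (n + 1), (r k - δ) * w n k := by
    intro n
    push_cast
    rw [Finset.sum_div, Finset.mul_sum, ← Finset.sum_add_distrib]
    refine Finset.sum_congr rfl fun k _ => ?_
    rw [hrπ]; simp only [hw]; ring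
  have herr : Tendsto (fun n => ∑ k ∈ range (n + 1), (r k - δ) * w n k) atTop (nhds 0) := by
    rw [Metric.tendsto_atTop]
    intro ε hε
    have hcG : 0 ≤ cG := ge_of_tendsto' hwt fun n => Finset.sum_nonneg fun k _ => hw0 n k
    set ε1 := ε / (2 * (cG + 1)) with hε1
    have hε1p : 0 < ε1 := by positivity
    obtain ⟨K, hK⟩ := Metric.tendsto_atTop.1 hdens ε1 hε1p
    have hfinite : Tendsto (fun n => ∑ k ∈ range K, |r k - δ| * w n k) atTop (nhds 0) := by
      have := tendsto_finsetSum (range K) fun k _ => (hwk k).const_mul |r k - δ|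
      simpa using this
    have ev1 := hfinite.eventually (gt_mem_nhds (half_pos hε))
    have ev2 := hwt.eventually (gt_mem_nhds (show cG < cG + 1 by linarith))
    obtain ⟨n0, hn0⟩ := eventually_atTop.1 (ev1.and ev2)
    refine ⟨n0, fun n hn => ?_⟩
    obtain ⟨h1, h2⟩ := hn0 n hn
    rw [Real.dist_eq, sub_zero]
    have b1 : ∀ k ∈ range (n + 1), |(r k - δ) * w n k| ≤
        (if k ∈ range K then |r k - δ| * w n k else 0) + ε1 * w n k := by
      intro k _
      rw [abs_mul, abs_of_nonneg (hw0 n k)]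
      split_ifs with hk
      · have := mul_nonneg hε1p.le (hw0 n k); linarith
      · rw [zero_add]
        have := hK k (by simpa using hk)
        rw [Real.dist_eq] at this
        exact mul_le_mul_of_nonneg_right this.le (hw0 n k)
    have b2 : ∑ k ∈ range (n + 1), (if k ∈ range K then |r k - δ| * w n k else 0) ≤
        ∑ k ∈ range K, |r k - δ| * w n k := by
      rw [← Finset.sum_filter]
      refine Finset.sum_le_sum_of_subset_of_nonneg ?_ fun k _ _ => mul_nonneg (abs_nonneg _) (hw0 n k)
      intro k hk
      exact (Finset.mem_filter.1 hk).2
    calc |∑ k ∈ range (n + 1), (r k - δ) * w n k| ≤ ∑ k ∈ range (n + 1), |(r k - δ) * w n k| :=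
          Finset.abs_sum_le_sum_abs _ _
      _ ≤ _ := Finset.sum_le_sum b1
      _ ≤ ∑ k ∈ range K, |r k - δ| * w n k + ε1 * ∑ k ∈ range (n + 1), w n k := by
          rw [Finset.sum_add_distrib, ← Finset.mul_sum]
          linarith
      _ < ε / 2 + ε1 * (cG + 1) := by
          have := mul_lt_mul_of_pos_left h2 hε1p
          linarith
      _ = ε := by rw [hε1]; field_simp; ring
  have := (hwt.const_mul δ).add herr
  rw [add_zero, mul_comm] at this
  exact this.congr fun n => (hS n).symm

/-- Lemma 2.1 (equidistribution of largest prime factors): if `S ⊆ P` has natural density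
`δ(S)`, then `∑_{∂(g) = n} Q_S(g) = c_G δ(S) q^n + o(q^n)`. -/
theorem QS_equidistribution {P : Type*} [Countable P] (deg : P → ℕ) (hdeg : ∀ p, 0 < deg p)
    (cG q η : ℝ) (hc : 0 < cG) (hq : 1 < q) (hη0 : 0 ≤ η) (hη1 : η < 1)
    (hfin : ∀ n : ℕ, {g : P →₀ ℕ | degG deg g = n}.Finite)
    (hfinP : ∀ k : ℕ, {p : P | deg p = k}.Finite)
    (hax : ∃ C : ℝ, ∀ n : ℕ,
      |(Nat.card {g : P →₀ ℕ // degG deg g = n} : ℝ) - cG * q ^ n| ≤ C * q ^ (η * n))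
    (S : Set P) (δ : ℝ)
    (hdens : Tendsto (fun n : ℕ =>
        (Nat.card {p : P // p ∈ S ∧ deg p = n} : ℝ) / (Nat.card {p : P // deg p = n} : ℝ))
      atTop (nhds δ)) :
    Tendsto (fun n : ℕ =>
        (∑ g ∈ (hfin n).toFinset, (QS deg S g : ℝ)) / q ^ n)
      atTop (nhds (cG * δ)) := by
  have hq0 : 0 < q := by linarith
  have hqn : ∀ n : ℕ, 0 < q ^ n := fun n => pow_pos hq0 n
  obtain ⟨C, hax⟩ := hax
  have hC : 0 ≤ C := by simpa using (abs_nonneg _).trans (hax 0)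
  set F : ℕ → Finset (P →₀ ℕ) := fun n => (hfin n).toFinset with hFd
  have hF : ∀ n g, g ∈ F n ↔ degG deg g = n := fun n g => by
    simp only [hFd, Set.Finite.mem_toFinset]; rfl
  set Pk : ℕ → Finset P := fun k => (hfinP k).toFinset with hPd
  have hP : ∀ k p, p ∈ Pk k ↔ deg p = k := fun k p => by
    simp only [hPd, Set.Finite.mem_toFinset]; rfl
  have hcF : ∀ n, Nat.card {g : P →₀ ℕ // degG deg g = n} = #(F n) := fun n =>
    Nat.subtype_card (F n) (hF n)
  have hcP : ∀ n, Nat.card {p : P // deg p = n} = #(Pk n) := fun n =>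
    Nat.subtype_card (Pk n) (hP n)
  have hcS : ∀ n, Nat.card {p : P // p ∈ S ∧ deg p = n} = #{p ∈ Pk n | p ∈ S} := fun n =>
    Nat.subtype_card _ (fun p => by rw [Finset.mem_filter, hP, and_comm])
  simp only [hcF] at hax
  simp only [hcP, hcS] at hdens
  obtain ⟨M, hM⟩ := chebyshev_upper (fun n => #(F n)) (fun k => #(Pk k)) cG q η C hc hq hη1
    (F_zero deg hdeg F hF) hax (mangoldt_rec deg hdeg F hF Pk hP)
  have hsumQ := sum_QS deg F hF Pk hP S
  have hsumU : ∀ n, ∑ g ∈ F n, QS deg Set.univ g =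
      ∑ k ∈ range (n + 1), #(Pk k) * smoothCount deg F (n - k) k := by
    intro n
    rw [sum_QS deg F hF Pk hP Set.univ]
    refine Finset.sum_congr rfl fun k _ => ?_
    congr 2
    ext p
    simp only [Finset.mem_filter, Set.mem_univ, and_true]
  have hpow : ∀ n : ℕ, q ^ (η * n) = (q ^ (η - 1)) ^ n * q ^ n := by
    intro n
    rw [← mul_pow, Real.rpow_sub_one hq0.ne', div_mul_cancel₀ _ hq0.ne',
      ← Real.rpow_mul_natCast hq0.le]
  have hθ0 : 0 < q ^ (η - 1) := Real.rpow_pos_of_pos hq0 _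
  have hθ1 : q ^ (η - 1) < 1 := Real.rpow_lt_one_of_one_lt_of_neg hq (by linarith)
  have hN : Tendsto (fun n => (#(F n) : ℝ) / q ^ n) atTop (nhds cG) := by
    rw [tendsto_iff_norm_sub_tendsto_zero]
    have h1 := (tendsto_pow_atTop_nhds_zero_of_lt_one hθ0.le hθ1).const_mul C
    rw [mul_zero] at h1
    refine squeeze_zero (fun n => norm_nonneg _) (fun n => ?_) h1
    have e : (#(F n) : ℝ) / q ^ n - cG = (#(F n) - cG * q ^ n) / q ^ n := by
      have := (hqn n).ne'
      field_simp
    rw [e, norm_div, Real.norm_eq_abs, Real.norm_of_nonneg (hqn n).le, div_le_iff₀ (hqn n),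
      mul_assoc, ← hpow]
    exact hax n
  have hNB : ∀ n, (#(F n) : ℝ) ≤ (cG + C) * q ^ n := by
    intro n
    have h1 := (abs_le.1 (hax n)).2
    rw [hpow] at h1
    have h2 : (q ^ (η - 1)) ^ n * q ^ n ≤ q ^ n :=
      mul_le_of_le_one_left (hqn n).le (pow_le_one₀ hθ0.le hθ1.le)
    have := mul_le_mul_of_nonneg_left h2 hC
    linarith
  have := final_analysis (fun n => #(F n)) (fun k => #(Pk k)) (fun k => #{p ∈ Pk k | p ∈ S})
    (smoothCount deg F) cG q δ (cG + C) M (fun k => #((range (k + 1)).biUnion Pk)) hq hM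
    (by
      rw [Finset.card_eq_zero, Finset.eq_empty_iff_forall_notMem]
      intro p hp
      have := hdeg p
      have := (hP _ _).1 hp
      omega)
    (fun k => Finset.card_filter_le _ _) hN hNB
    (fun m k => Finset.card_filter_le _ _)
    (smoothCount_le deg hdeg F hF Pk hP)
    (fun n hn => by rw [← hsumU]; exact le_sum_Q deg F hF n hn)
    (fun n => by rw [← hsumU]; exact sum_Q_le deg F hF Pk hP n)
    hdens
  refine this.congr fun n => ?_
  rw [← hsumQ, Nat.cast_sum]
end
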